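/- For integers n, m ≥ 3 and positive integers k₁, k₂: f_{2k₁,2k₂} ≤ (Vol S̃q / Vol P̃os)^{1/D_𝓜} ≤ g_{2k₁,2k₂}, where in the case k₁ = k₂ = 1: f = 3√3/(2^{10}·7²·√(min(n,m))) and g = 2^{12}·5²·6^{1/2}·10^{2/9}/(3³·√(min(n,m)+1)); and otherwise: f = C_{2k₁,2k₂}·( n^{k₁}·m^{k₂}·(2 + max(n/k₁², m/k₂²)) )^{1/2} / ((n/2+2k₁)^{k₁}·(m/2+2k₂)^{k₂}) and g = D_{2k₁,2k₂}·(n^{k₁−1}·m^{k₂−1}·min(n,m))^{−1/2}, with C_{2k₁,2k₂} = 2·(k₁!·k₂!)^{3/2}/(√3·4^{2(k₁+k₂+1)}·√((2k₁)!·(2k₂)!)·min(k₁,k₂)) and D_{2k₁,2k₂} = √3·e³·4^{2k₁+2k₂+1}·√( ((2k₁)!·(2k₂)!/(k₁!·k₂!))·⌈ln(2·max(k₁,k₂)+1)⌉ ). -/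

import Mathlib

open MeasureTheory MvPolynomial

noncomputable section

namespace BiformPaper

/-- The weight function on the variables: the `x`-variables get weight `(1,0)` and the
`y`-variables get weight `(0,1)`. -/
def bw (n m : ℕ) : Fin n ⊕ Fin m → ℕ × ℕ := Sum.elim (fun _ => (1, 0)) (fun _ => (0, 1))

/-- The set of biforms of bidegree `(k₁, k₂)`: real polynomials in
`x = (x₁, …, xₙ)` and `y = (y₁, …, y_m)`, homogeneous of degree `k₁` in `x` and of degree
`k₂` in `y`. -/
def Biform (n m k₁ k₂ : ℕ) : Set (MvPolynomial (Fin n ⊕ Fin m) ℝ) :=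
  {f | MvPolynomial.IsWeightedHomogeneous (bw n m) f (k₁, k₂)}

/-- Evaluation of a polynomial at a point `(x, y) ∈ ℝⁿ × ℝᵐ`. -/
def beval {n m : ℕ} (f : MvPolynomial (Fin n ⊕ Fin m) ℝ) (x : Fin n → ℝ) (y : Fin m → ℝ) : ℝ :=
  eval (Sum.elim x y) f

/-- The Euclidean unit sphere `S^{n-1}` in `ℝⁿ`. -/
def unitSphere (n : ℕ) : Set (Fin n → ℝ) := {x | ∑ i, x i ^ 2 = 1}

/-- `σ` is the normalized uniform measure on the unit sphere `S^{n-1} ⊆ ℝⁿ`, i.e., the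
unique rotation-invariant Borel probability measure concentrated on the sphere. -/
structure IsSphereMeasure (n : ℕ) (σ : Measure (Fin n → ℝ)) : Prop where
  prob : IsProbabilityMeasure σ
  onSphere : σ (unitSphere n)ᶜ = 0
  invariant : ∀ Q : Matrix (Fin n) (Fin n) ℝ, Q * Q.transpose = 1 → σ.map Q.mulVec = σ

/-- The average `∫_T f dσ` of `f` over `T = S^{n-1} × S^{m-1}` (with `σ` the product of the
normalized sphere measures `σ₁`, `σ₂`). -/
def bavg {n m : ℕ} (σ₁ : Measure (Fin n → ℝ)) (σ₂ : Measure (Fin m → ℝ))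
    (f : MvPolynomial (Fin n ⊕ Fin m) ℝ) : ℝ :=
  ∫ x, ∫ y, beval f x y ∂σ₂ ∂σ₁

/-- The `L²(σ)` inner product `⟨f, g⟩ = ∫_T f·g dσ` on biforms. -/
def bip {n m : ℕ} (σ₁ : Measure (Fin n → ℝ)) (σ₂ : Measure (Fin m → ℝ))
    (f g : MvPolynomial (Fin n ⊕ Fin m) ℝ) : ℝ :=
  ∫ x, ∫ y, beval f x y * beval g x y ∂σ₂ ∂σ₁

/-- The cone `Pos^{(n,m)}_{(2k₁,2k₂)}` of nonnegative biforms of bidegree `(2k₁, 2k₂)`. -/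
def PosSet (n m k₁ k₂ : ℕ) : Set (MvPolynomial (Fin n ⊕ Fin m) ℝ) :=
  {f | f ∈ Biform n m (2 * k₁) (2 * k₂) ∧ ∀ x y, 0 ≤ beval f x y}

/-- The cone `Sq^{(n,m)}_{(2k₁,2k₂)}` of finite sums of squares of biforms of bidegree
`(k₁, k₂)`. -/
def SqSet (n m k₁ k₂ : ℕ) : Set (MvPolynomial (Fin n ⊕ Fin m) ℝ) :=
  {f | ∃ (N : ℕ) (g : Fin N → MvPolynomial (Fin n ⊕ Fin m) ℝ),
      (∀ i, g i ∈ Biform n m k₁ k₂) ∧ f = ∑ i, g i ^ 2}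

/-- The cone `Lf^{(n,m)}_{(2k₁,2k₂)}` of finite sums of products
`ℓᵢ(x)^{2k₁} · ℓ′ᵢ(y)^{2k₂}` of even powers of linear forms. -/
def LfSet (n m k₁ k₂ : ℕ) : Set (MvPolynomial (Fin n ⊕ Fin m) ℝ) :=
  {f | ∃ (N : ℕ) (a : Fin N → Fin n → ℝ) (b : Fin N → Fin m → ℝ),
      f = ∑ r, (∑ i, C (a r i) * X (Sum.inl i)) ^ (2 * k₁) *
               (∑ j, C (b r j) * X (Sum.inr j)) ^ (2 * k₂)}

/-- The biform `q = (x₁² + ⋯ + xₙ²)^{k₁} · (y₁² + ⋯ + y_m²)^{k₂}`. -/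
def qpoly (n m k₁ k₂ : ℕ) : MvPolynomial (Fin n ⊕ Fin m) ℝ :=
  (∑ i : Fin n, X (Sum.inl i) ^ 2) ^ k₁ * (∑ j : Fin m, X (Sum.inr j) ^ 2) ^ k₂

/-- The hyperplane `𝓜` of biforms of bidegree `(2k₁, 2k₂)` with average `0` on `T`. -/
def MSet (n m k₁ k₂ : ℕ) (σ₁ : Measure (Fin n → ℝ)) (σ₂ : Measure (Fin m → ℝ)) :
    Set (MvPolynomial (Fin n ⊕ Fin m) ℝ) :=
  {f | f ∈ Biform n m (2 * k₁) (2 * k₂) ∧ bavg σ₁ σ₂ f = 0}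

/-- The translated section `K̃ = {f ∈ 𝓜 : f + q ∈ K}` of a cone `K`. -/
def tilde (n m k₁ k₂ : ℕ) (σ₁ : Measure (Fin n → ℝ)) (σ₂ : Measure (Fin m → ℝ))
    (K : Set (MvPolynomial (Fin n ⊕ Fin m) ℝ)) : Set (MvPolynomial (Fin n ⊕ Fin m) ℝ) :=
  {f | f ∈ MSet n m k₁ k₂ σ₁ σ₂ ∧ f + qpoly n m k₁ k₂ ∈ K}

/-- The unit ball `B_𝓜` of `𝓜` in the `L²(σ)` norm. -/
def bball (n m k₁ k₂ : ℕ) (σ₁ : Measure (Fin n → ℝ)) (σ₂ : Measure (Fin m → ℝ)) :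
    Set (MvPolynomial (Fin n ⊕ Fin m) ℝ) :=
  {f | f ∈ MSet n m k₁ k₂ σ₁ σ₂ ∧ bip σ₁ σ₂ f f ≤ 1}

/-- `ψ : ℝ^D → Mset` is a unitary isomorphism: an injective linear map with range `Mset`
carrying the standard inner product of `ℝ^D` to the `L²(σ)` inner product.  Volumes of
Borel subsets `E` of `Mset` are computed as the Lebesgue measure of `ψ ⁻¹' E`
(by Lemma 1.1 of the paper this does not depend on the choice of `ψ`). -/
structure IsUnitaryParam (n m D : ℕ) (σ₁ : Measure (Fin n → ℝ)) (σ₂ : Measure (Fin m → ℝ))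
    (Mset : Set (MvPolynomial (Fin n ⊕ Fin m) ℝ))
    (ψ : (Fin D → ℝ) →ₗ[ℝ] MvPolynomial (Fin n ⊕ Fin m) ℝ) : Prop where
  inj : Function.Injective ψ
  range : Set.range ψ = Mset
  ip : ∀ a b : Fin D → ℝ, bip σ₁ σ₂ (ψ a) (ψ b) = ∑ i, a i * b i

/-- The apolar inner product `⟨r, s⟩_d = D_r(s)` on biforms, where `D_r` is the
differential operator obtained from `r` by replacing each variable by the corresponding
partial derivative; its value on a pair of forms of the same bidegree is
`∑_α r_α · s_α · α!`. -/
def apolar {n m : ℕ} (r s : MvPolynomial (Fin n ⊕ Fin m) ℝ) : ℝ :=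
  ∑ α ∈ r.support, coeff α r * coeff α s * α.prod fun _ k => (k.factorial : ℝ)

end BiformPaper

namespace BiformPaper

section PrekopaLeindler

/-- One-dimensional Brunn–Minkowski inequality for compact sets. -/
lemma volume_add_le_of_isCompact {K L C : Set ℝ} (hK : IsCompact K) (hL : IsCompact L)
    (hK0 : K.Nonempty) (hL0 : L.Nonempty) (h : ∀ x ∈ K, ∀ y ∈ L, x + y ∈ C) :
    volume K + volume L ≤ volume C := by
  obtain ⟨k, hk, hkmax⟩ := hK.exists_isMaxOn hK0 continuousOn_id
  obtain ⟨l, hl, hlmin⟩ := hL.exists_isMinOn hL0 continuousOn_id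
  have e1 : volume ((fun x => x + l) '' K) = volume K := by
    simp
  have e2 : volume ((fun y => k + y) '' L) = volume L := by
    simp
  have hdisj : AEDisjoint volume ((fun x => x + l) '' K) ((fun y => k + y) '' L) := by
    refine measure_mono_null (t := {k + l}) ?_ (by simp)
    rintro _ ⟨⟨x, hx, rfl⟩, ⟨y, hy, hxy⟩⟩
    have h1 : x ≤ k := hkmax hx
    have h2 : l ≤ y := hlmin hy
    simp only [Set.mem_singleton_iff] at *
    linarith
  have hm : NullMeasurableSet ((fun y => k + y) '' L) :=
    (hL.image (by fun_prop)).measurableSet.nullMeasurableSet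
  rw [← e1, ← e2, ← measure_union₀ hm hdisj]
  apply measure_mono
  rintro _ (⟨x, hx, rfl⟩ | ⟨y, hy, rfl⟩)
  · exact h x hx l hl
  · exact h k hk y hy

/-- One-dimensional Brunn–Minkowski inequality. -/
lemma volume_add_le {A B C : Set ℝ} (hA : MeasurableSet A) (hB : MeasurableSet B)
    (hA0 : A.Nonempty) (hB0 : B.Nonempty) (h : ∀ x ∈ A, ∀ y ∈ B, x + y ∈ C) :
    volume A + volume B ≤ volume C := by
  have trans1 : ∀ (S : Set ℝ) (a : ℝ), (∀ x ∈ S, a + x ∈ C) → volume S ≤ volume C := by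
    intro S a hS
    rw [← measure_preimage_add volume a C]
    exact measure_mono hS
  rcases eq_or_ne (volume A) 0 with hA' | hA'
  · obtain ⟨a, ha⟩ := hA0
    rw [hA', zero_add]
    exact trans1 B a fun y hy => h a ha y hy
  rcases eq_or_ne (volume B) 0 with hB' | hB'
  · obtain ⟨b, hb⟩ := hB0
    rw [hB', add_zero]
    exact trans1 A b fun x hx => add_comm x b ▸ h x hx b hb
  by_contra! hcon
  obtain ⟨r, hr, s, hs, hrs⟩ := ENNReal.exists_lt_add_of_lt_add hcon hA' hB'
  obtain ⟨K, hKA, hK, hrK⟩ := hA.exists_lt_isCompact hr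
  obtain ⟨L, hLB, hL, hsL⟩ := hB.exists_lt_isCompact hs
  have ne : ∀ {S : Set ℝ} {r : ENNReal}, r < volume S → S.Nonempty := by
    intro S r hr
    exact nonempty_of_measure_ne_zero (ne_bot_of_gt hr)
  refine absurd ((add_le_add hrK.le hsL.le).trans ?_) (not_le.mpr hrs)
  exact volume_add_le_of_isCompact hK hL (ne hrK) (ne hsL) fun x hx y hy => h x (hKA hx) y (hLB hy)

/-- One-dimensional Brunn–Minkowski inequality for convex combinations. -/
lemma volume_convexComb_le {A B C : Set ℝ} {a b : ℝ} (ha : 0 < a) (hb : 0 < b)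
    (hA : MeasurableSet A) (hB : MeasurableSet B)
    (hA0 : A.Nonempty) (hB0 : B.Nonempty) (h : ∀ x ∈ A, ∀ y ∈ B, a * x + b * y ∈ C) :
    ENNReal.ofReal a * volume A + ENNReal.ofReal b * volume B ≤ volume C := by
  have hs : ∀ (S : Set ℝ) (c : ℝ), 0 < c → MeasurableSet S → S.Nonempty →
      MeasurableSet ((fun x => c⁻¹ * x) ⁻¹' S) ∧ ((fun x => c⁻¹ * x) ⁻¹' S).Nonempty ∧
      volume ((fun x => c⁻¹ * x) ⁻¹' S) = ENNReal.ofReal c * volume S := by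
    intro S c hc hS hS0
    refine ⟨hS.preimage (by fun_prop), ?_, ?_⟩
    · obtain ⟨x, hx⟩ := hS0
      exact ⟨c * x, by simpa [hc.ne'] using hx⟩
    · rw [Real.volume_preimage_mul_left (inv_ne_zero hc.ne')]
      simp [abs_of_pos hc]
  obtain ⟨hA1, hA2, hA3⟩ := hs A a ha hA hA0
  obtain ⟨hB1, hB2, hB3⟩ := hs B b hb hB hB0
  rw [← hA3, ← hB3]
  refine volume_add_le hA1 hB1 hA2 hB2 fun x hx y hy => ?_
  have := h _ hx _ hy
  rwa [mul_inv_cancel_left₀ ha.ne', mul_inv_cancel_left₀ hb.ne'] at this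

/-- Weighted arithmetic-geometric mean inequality in `ℝ≥0∞`. -/
lemma ennreal_geom_le_arith {a b : ℝ} (ha : 0 < a) (hb : 0 < b) (hab : a + b = 1)
    (p q : ENNReal) : p ^ a * q ^ b ≤ ENNReal.ofReal a * p + ENNReal.ofReal b * q := by
  rcases eq_or_ne p ⊤ with rfl | hp
  · simp [ENNReal.mul_top, ENNReal.ofReal_eq_zero, not_le.mpr ha]
  rcases eq_or_ne q ⊤ with rfl | hq
  · simp [ENNReal.mul_top, ENNReal.ofReal_eq_zero, not_le.mpr hb]
  lift p to NNReal using hp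
  lift q to NNReal using hq
  lift a to NNReal using ha.le
  lift b to NNReal using hb.le
  have := NNReal.geom_mean_le_arith_mean2_weighted a b p q (by exact_mod_cast hab)
  rw [ENNReal.ofReal_coe_nnreal, ENNReal.ofReal_coe_nnreal,
    ← ENNReal.coe_rpow_of_nonneg _ a.coe_nonneg, ← ENNReal.coe_rpow_of_nonneg _ b.coe_nonneg]
  exact_mod_cast this

/-- Layer cake for functions bounded by one. -/
lemma lintegral_eq_lintegral_Ioo_of_le_one {f : ℝ → ENNReal} (hf : Measurable f)
    (h1 : ∀ x, f x ≤ 1) :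
    ∫⁻ x, f x = ∫⁻ t in Set.Ioo (0 : ℝ) 1, volume {x | ENNReal.ofReal t < f x} := by
  have hfin : ∀ x, f x ≠ ⊤ := fun x => ((h1 x).trans_lt ENNReal.one_lt_top).ne
  have e := lintegral_eq_lintegral_meas_lt (volume : Measure ℝ) (f := fun x => (f x).toReal)
    (Filter.Eventually.of_forall fun x => ENNReal.toReal_nonneg) hf.ennreal_toReal.aemeasurable
  simp only [ENNReal.ofReal_toReal (hfin _)] at e
  rw [e, ← Set.Ioo_union_Ici_eq_Ioi (zero_lt_one : (0:ℝ) < 1), lintegral_union measurableSet_Ici]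
  · have h0 : ∫⁻ t in Set.Ici (1:ℝ), volume {a | t < (f a).toReal} = 0 := by
      rw [setLIntegral_congr_fun (g := fun _ => 0) measurableSet_Ici]
      · simp
      · intro t ht
        have : {a | t < (f a).toReal} = ∅ := by
          ext x
          simp only [Set.mem_ofPred_eq, Set.mem_empty_iff_false, iff_false, not_lt]
          exact (ENNReal.toReal_mono ENNReal.one_ne_top (h1 x)).trans (by simpa using ht)
        simp [this]
    rw [h0, add_zero]
    refine setLIntegral_congr_fun measurableSet_Ioo fun t ht => ?_
    congr 1
    ext x
    exact (ENNReal.ofReal_lt_iff_lt_toReal ht.1.le (hfin x)).symm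
  · refine Set.disjoint_left.mpr fun x hx hx2 => ?_
    exact absurd hx.2 (not_lt.mpr hx2)

/-- Bounded normalized case of the one-dimensional Prékopa–Leindler inequality. -/
lemma prekopa_leindler_normalized {a b : ℝ} (ha : 0 < a) (hb : 0 < b) (hab : a + b = 1)
    {f g h : ℝ → ENNReal} (hf : Measurable f) (hg : Measurable g) (hh : Measurable h)
    (hf1 : ⨆ x, f x = 1) (hg1 : ⨆ x, g x = 1)
    (hyp : ∀ x y, f x ^ a * g y ^ b ≤ h (a * x + b * y)) :
    (∫⁻ x, f x) ^ a * (∫⁻ x, g x) ^ b ≤ ∫⁻ x, h x := by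
  refine (ennreal_geom_le_arith ha hb hab _ _).trans ?_
  have hh1 : ∫⁻ x, min (h x) 1 ≤ ∫⁻ x, h x := lintegral_mono fun x => min_le_left _ _
  refine le_trans ?_ hh1
  rw [lintegral_eq_lintegral_Ioo_of_le_one hf fun x => hf1 ▸ le_iSup f x,
    lintegral_eq_lintegral_Ioo_of_le_one hg fun x => hg1 ▸ le_iSup g x,
    lintegral_eq_lintegral_Ioo_of_le_one (hh.min measurable_const) fun x => min_le_right _ _]
  have meas : ∀ u : ℝ → ENNReal, Measurable fun t : ℝ => volume {x | ENNReal.ofReal t < u x} := by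
    intro u
    refine Antitone.measurable fun s t hst => measure_mono fun x hx => ?_
    exact (ENNReal.ofReal_le_ofReal hst).trans_lt hx
  rw [← lintegral_const_mul _ (meas f), ← lintegral_const_mul _ (meas g),
    ← lintegral_add_left ((meas f).const_mul _)]
  refine setLIntegral_mono' measurableSet_Ioo fun t ht => ?_
  have ht1 : ENNReal.ofReal t < 1 := by
    rw [← ENNReal.ofReal_one]; exact (ENNReal.ofReal_lt_ofReal_iff one_pos).mpr ht.2
  refine volume_convexComb_le ha hb (measurableSet_lt measurable_const hf)
    (measurableSet_lt measurable_const hg) ?_ ?_ ?_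
  · exact lt_iSup_iff.mp (hf1.symm ▸ ht1)
  · exact lt_iSup_iff.mp (hg1.symm ▸ ht1)
  · intro x hx y hy
    refine lt_min (lt_of_lt_of_le ?_ (hyp x y)) ht1
    have h0 : ENNReal.ofReal t ≠ 0 := by simpa using ht.1
    calc ENNReal.ofReal t = ENNReal.ofReal t ^ a * ENNReal.ofReal t ^ b := by
          rw [← ENNReal.rpow_add _ _ h0 ENNReal.ofReal_ne_top, hab, ENNReal.rpow_one]
      _ < f x ^ a * g y ^ b :=
          ENNReal.mul_lt_mul (ENNReal.rpow_lt_rpow hx ha) (ENNReal.rpow_lt_rpow hy hb)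

/-- Bounded case of the one-dimensional Prékopa–Leindler inequality. -/
lemma prekopa_leindler_bounded {a b : ℝ} (ha : 0 < a) (hb : 0 < b) (hab : a + b = 1)
    {f g h : ℝ → ENNReal} (hf : Measurable f) (hg : Measurable g) (hh : Measurable h)
    (hf1 : ⨆ x, f x ≠ ⊤) (hg1 : ⨆ x, g x ≠ ⊤)
    (hyp : ∀ x y, f x ^ a * g y ^ b ≤ h (a * x + b * y)) :
    (∫⁻ x, f x) ^ a * (∫⁻ x, g x) ^ b ≤ ∫⁻ x, h x := by
  set A := ⨆ x, f x with hA
  set B := ⨆ x, g x with hB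
  rcases eq_or_ne A 0 with hA0 | hA0
  · have : ∀ x, f x = 0 := fun x => le_antisymm ((le_iSup f x).trans hA0.le) zero_le
    simp [this, ENNReal.zero_rpow_of_pos ha]
  rcases eq_or_ne B 0 with hB0 | hB0
  · have : ∀ x, g x = 0 := fun x => le_antisymm ((le_iSup g x).trans hB0.le) zero_le
    simp [this, ENNReal.zero_rpow_of_pos hb]
  have hAi : A⁻¹ ≠ ⊤ := by simpa using hA0
  have hBi : B⁻¹ ≠ ⊤ := by simpa using hB0
  have key := prekopa_leindler_normalized ha hb hab (hf.const_mul A⁻¹) (hg.const_mul B⁻¹)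
    (hh.const_mul (A⁻¹ ^ a * B⁻¹ ^ b))
    (by rw [← ENNReal.mul_iSup, ← hA, ENNReal.inv_mul_cancel hA0 hf1])
    (by rw [← ENNReal.mul_iSup, ← hB, ENNReal.inv_mul_cancel hB0 hg1])
    (fun x y => by
      rw [ENNReal.mul_rpow_of_nonneg _ _ ha.le, ENNReal.mul_rpow_of_nonneg _ _ hb.le,
        mul_mul_mul_comm]
      gcongr
      exact hyp x y)
  rw [lintegral_const_mul _ hf, lintegral_const_mul _ hg, lintegral_const_mul _ hh,
    ENNReal.mul_rpow_of_nonneg _ _ ha.le, ENNReal.mul_rpow_of_nonneg _ _ hb.le,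
    mul_mul_mul_comm] at key
  refine (ENNReal.mul_le_mul_iff_right ?_ ?_).mp key
  · have hz : ∀ {u : ENNReal} {c : ℝ}, u ≠ ⊤ → 0 < c → u⁻¹ ^ c ≠ 0 := fun hu hc h0 => by
      rcases ENNReal.rpow_eq_zero_iff.mp h0 with h0 | h0
      · exact hu (by simpa using h0.1)
      · exact absurd h0.2 hc.not_gt
    exact mul_ne_zero (hz hf1 ha) (hz hg1 hb)
  · refine ENNReal.mul_ne_top ?_ ?_ <;> apply ENNReal.rpow_ne_top_of_nonneg <;>
      first | assumption | positivity

/-- The one-dimensional Prékopa–Leindler inequality. -/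
lemma prekopa_leindler_one {a b : ℝ} (ha : 0 < a) (hb : 0 < b) (hab : a + b = 1)
    {f g h : ℝ → ENNReal} (hf : Measurable f) (hg : Measurable g) (hh : Measurable h)
    (hyp : ∀ x y, f x ^ a * g y ^ b ≤ h (a * x + b * y)) :
    (∫⁻ x, f x) ^ a * (∫⁻ x, g x) ^ b ≤ ∫⁻ x, h x := by
  have lim : ∀ u : ℝ → ENNReal, Measurable u →
      Filter.Tendsto (fun N : ℕ => ∫⁻ x, min (u x) N) Filter.atTop (nhds (∫⁻ x, u x)) := by
    intro u hu
    refine lintegral_tendsto_of_tendsto_of_monotone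
      (fun N => (hu.min measurable_const).aemeasurable)
      (Filter.Eventually.of_forall fun x => ?_) (Filter.Eventually.of_forall fun x => ?_)
    · intro M N hMN
      dsimp only
      gcongr
    · have : Filter.Tendsto (fun N : ℕ => min (u x) (N : ENNReal)) Filter.atTop
          (nhds (min (u x) ⊤)) :=
        tendsto_const_nhds.min ENNReal.tendsto_nat_nhds_top
      simpa using this
  rcases eq_or_ne (∫⁻ x, f x) 0 with hf0 | hf0
  · simp [hf0, ENNReal.zero_rpow_of_pos ha]
  rcases eq_or_ne (∫⁻ x, g x) 0 with hg0 | hg0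
  · simp [hg0, ENNReal.zero_rpow_of_pos hb]
  have hbound : ∀ (u : ℝ → ENNReal) (N : ℕ), ⨆ x, min (u x) N ≠ ⊤ := fun u N =>
    ((iSup_le fun x => min_le_right _ _).trans_lt (ENNReal.natCast_lt_top N)).ne
  refine le_of_tendsto (ENNReal.Tendsto.mul
    ((ENNReal.continuous_rpow_const (y := a)).continuousAt.tendsto.comp (lim f hf))
    (Or.inl ?_) ((ENNReal.continuous_rpow_const (y := b)).continuousAt.tendsto.comp (lim g hg))
    (Or.inl ?_)) (Filter.Eventually.of_forall fun N => ?_)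
  · simp [ENNReal.rpow_eq_zero_iff, hf0, ha.not_gt]
  · simp [ENNReal.rpow_eq_zero_iff, hg0, hb.not_gt]
  · refine prekopa_leindler_bounded ha hb hab (hf.min measurable_const) (hg.min measurable_const)
      hh (hbound f N) (hbound g N) fun x y => le_trans ?_ (hyp x y)
    gcongr <;> exact min_le_left _ _

/-- The Prékopa–Leindler inequality on `ℝ^D`. -/
theorem prekopa_leindler {a b : ℝ} (ha : 0 < a) (hb : 0 < b) (hab : a + b = 1) (D : ℕ)
    {f g h : (Fin D → ℝ) → ENNReal} (hf : Measurable f) (hg : Measurable g) (hh : Measurable h)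
    (hyp : ∀ x y, f x ^ a * g y ^ b ≤ h (a • x + b • y)) :
    (∫⁻ x, f x) ^ a * (∫⁻ x, g x) ^ b ≤ ∫⁻ x, h x := by
  induction D with
  | zero =>
    have e : ∀ u : (Fin 0 → ℝ) → ENNReal, ∫⁻ x, u x = u 0 := by
      intro u
      rw [lintegral_unique, volume_pi, Measure.pi_of_empty _ 0]
      simp
      congr
    rw [e, e, e]
    simpa using hyp 0 0
  | succ D ih =>
    have e : ∀ u : (Fin (D + 1) → ℝ) → ENNReal, Measurable u →
        ∫⁻ x, u x = ∫⁻ s : ℝ, ∫⁻ x : Fin D → ℝ, u (Fin.cons s x) := by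
      intro u hu
      have mp := (volume_preserving_piFinSuccAbove (fun _ : Fin (D+1) => ℝ) 0).symm
      rw [← mp.lintegral_comp hu, Measure.volume_eq_prod, lintegral_prod _ (by fun_prop)]
      refine lintegral_congr fun s => lintegral_congr fun x => congrArg u ?_
      ext i
      refine Fin.cases ?_ (fun i => ?_) i <;> simp [MeasurableEquiv.piFinSuccAbove]
    have mc : Measurable fun p : ℝ × (Fin D → ℝ) => (Fin.cons p.1 p.2 : Fin (D + 1) → ℝ) :=
      measurable_pi_iff.mpr fun i => by
        refine Fin.cases ?_ (fun i => ?_) i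
        · simpa using measurable_fst
        · exact (measurable_pi_apply i).comp measurable_snd
    have mm : ∀ u : (Fin (D + 1) → ℝ) → ENNReal, Measurable u →
        Measurable fun s : ℝ => ∫⁻ x : Fin D → ℝ, u (Fin.cons s x) := by
      intro u hu
      exact Measurable.lintegral_prod_right' (hu.comp mc)
    have mi : ∀ u : (Fin (D + 1) → ℝ) → ENNReal, Measurable u → ∀ s : ℝ,
        Measurable fun x : Fin D → ℝ => u (Fin.cons s x) := by
      intro u hu s
      exact (hu.comp mc).comp measurable_prodMk_left
    rw [e f hf, e g hg, e h hh]
    refine prekopa_leindler_one ha hb hab (mm f hf) (mm g hg) (mm h hh) fun s t => ?_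
    refine ih (mi f hf s) (mi g hg t) (mi h hh _) fun x y => ?_
    refine (hyp _ _).trans (le_of_eq ?_)
    congr 1
    ext i
    refine Fin.cases ?_ (fun i => ?_) i <;> simp

end PrekopaLeindler

section Gaussian

open ProbabilityTheory

/-- The standard Gaussian measure on `ι → ℝ`. -/
def gam (ι : Type*) [Fintype ι] : Measure (ι → ℝ) := Measure.pi fun _ => gaussianReal 0 1

instance (ι : Type*) [Fintype ι] : IsProbabilityMeasure (gam ι) := by
  unfold gam; infer_instance

variable {ι : Type*} [Fintype ι]

lemma prod_gaussianPDFReal (x : ι → ℝ) :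
    ∏ i, gaussianPDFReal 0 1 (x i) =
      (Real.sqrt (2 * Real.pi))⁻¹ ^ Fintype.card ι * Real.exp (-(∑ i, x i ^ 2) / 2) := by
  simp only [gaussianPDFReal, NNReal.coe_one, mul_one, sub_zero, Finset.prod_mul_distrib,
    Finset.prod_const, ← Real.exp_sum, Finset.card_univ]
  congr 2
  rw [← Finset.sum_div, Finset.sum_neg_distrib]

lemma gam_eq_withDensity : gam ι = (volume : Measure (ι → ℝ)).withDensity
    fun x => ENNReal.ofReal (∏ i, gaussianPDFReal 0 1 (x i)) := by
  refine Measure.pi_eq (μ := fun _ : ι => gaussianReal 0 1) fun s hs => ?_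
  rw [withDensity_apply _ (MeasurableSet.univ_pi hs)]
  have h0 : ∀ i, gaussianReal 0 1 (s i) =
      ENNReal.ofReal (∫ t, (s i).indicator (gaussianPDFReal 0 1) t) := by
    intro i
    rw [gaussianReal_apply_eq_integral 0 one_ne_zero, integral_indicator (hs i)]
  simp_rw [h0]
  rw [← ENNReal.ofReal_prod_of_nonneg fun i _ => integral_nonneg fun t =>
    Set.indicator_nonneg (fun t _ => gaussianPDFReal_nonneg 0 1 t) t,
    ← integral_fintype_prod_volume_eq_prod, ← lintegral_indicator (MeasurableSet.univ_pi hs),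
    ofReal_integral_eq_lintegral_ofReal]
  · refine lintegral_congr fun x => ?_
    by_cases hx : x ∈ Set.univ.pi s
    · rw [Set.indicator_of_mem hx]
      congr 1
      refine Finset.prod_congr rfl fun i _ => ?_
      rw [Set.indicator_of_mem (hx i trivial)]
    · rw [Set.indicator_of_notMem hx]
      simp only [Set.mem_pi, not_forall] at hx
      obtain ⟨i, -, hi⟩ := hx
      rw [Finset.prod_eq_zero (Finset.mem_univ i), ENNReal.ofReal_zero]
      rw [Set.indicator_of_notMem hi]
  · refine Integrable.fintype_prod fun i => ?_
    exact (integrable_gaussianPDFReal 0 1).indicator (hs i)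
  · exact Filter.Eventually.of_forall fun x => Finset.prod_nonneg fun i _ =>
      Set.indicator_nonneg (fun t _ => gaussianPDFReal_nonneg 0 1 t) _

/-- Integration against the Gaussian measure through its density. -/
lemma lintegral_gam {F : (ι → ℝ) → ENNReal} (hF : Measurable F) :
    ∫⁻ z, F z ∂gam ι = ENNReal.ofReal ((Real.sqrt (2 * Real.pi))⁻¹ ^ Fintype.card ι) *
      ∫⁻ z, ENNReal.ofReal (Real.exp (-(∑ i, z i ^ 2) / 2)) * F z := by
  rw [gam_eq_withDensity, lintegral_withDensity_eq_lintegral_mul _ (by fun_prop) hF,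
    ← lintegral_const_mul _ (by fun_prop)]
  refine lintegral_congr fun x => ?_
  rw [Pi.mul_apply, prod_gaussianPDFReal, ENNReal.ofReal_mul (by positivity), mul_assoc]

lemma gam_le_volume (S : Set (ι → ℝ)) :
    gam ι S ≤ ENNReal.ofReal ((Real.sqrt (2 * Real.pi))⁻¹ ^ Fintype.card ι) * volume S := by
  have h : gam ι ≤ ENNReal.ofReal ((Real.sqrt (2 * Real.pi))⁻¹ ^ Fintype.card ι) •
      (volume : Measure (ι → ℝ)) := by
    rw [gam_eq_withDensity, ← withDensity_const]
    refine withDensity_mono (Filter.Eventually.of_forall fun x => ?_)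
    dsimp only
    gcongr
    rw [prod_gaussianPDFReal]
    refine mul_le_of_le_one_right (by positivity) (Real.exp_le_one_iff.mpr ?_)
    have : 0 ≤ ∑ i, x i ^ 2 := Finset.sum_nonneg fun i _ => sq_nonneg _
    linarith
  simpa using h S

lemma lintegral_exp_neg_mul_sq {c : ℝ} (hc : 0 < c) :
    ∫⁻ z : ι → ℝ, ENNReal.ofReal (Real.exp (-(c * ∑ i, z i ^ 2))) =
      ENNReal.ofReal (Real.sqrt (Real.pi / c) ^ Fintype.card ι) := by
  rw [← integral_gaussian c, ← integral_fintype_prod_volume_eq_pow,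
    ofReal_integral_eq_lintegral_ofReal]
  · refine lintegral_congr fun x => ?_
    rw [← Real.exp_sum, Finset.mul_sum, ← Finset.sum_neg_distrib]
    simp only [neg_mul]
  · exact Integrable.fintype_prod fun i => integrable_exp_neg_mul_sq hc
  · exact Filter.Eventually.of_forall fun x => Finset.prod_nonneg fun i _ => (Real.exp_pos _).le

lemma integrable_exp_mul_abs_gaussian (c : ℝ) :
    Integrable (fun t => Real.exp (c * |t|)) (gaussianReal 0 1) := by
  have h := (integrable_exp_mul_gaussianReal (μ := 0) (v := 1) c).add
    (integrable_exp_mul_gaussianReal (μ := 0) (v := 1) (-c))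
  refine h.mono' (by fun_prop) (Filter.Eventually.of_forall fun t => ?_)
  rw [Real.norm_of_nonneg (Real.exp_pos _).le]
  simp only [Pi.add_apply]
  rcases abs_cases t with ⟨ht, _⟩ | ⟨ht, _⟩ <;> rw [ht]
  · linarith [Real.exp_pos (-c * t)]
  · rw [mul_neg, ← neg_mul]; linarith [Real.exp_pos (c * t)]

lemma integrable_exp_mul_sum_abs_gam (c : ℝ) :
    Integrable (fun z : ι → ℝ => Real.exp (c * ∑ i, |z i|)) (gam ι) := by
  have := Integrable.fintype_prod (μ := fun _ : ι => gaussianReal 0 1)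
    fun i => integrable_exp_mul_abs_gaussian c
  simpa only [← Real.exp_sum, ← Finset.mul_sum, gam] using this

end Gaussian

section Urysohn

open ProbabilityTheory
open scoped Pointwise

lemma exp_mul_le_quadratic {b x : ℝ} (hb : 0 ≤ b) (hb1 : b ≤ 1) (hx : 0 ≤ x) :
    Real.exp (b * x) ≤ 1 + b * x + b ^ 2 * (2 * Real.exp (2 * x)) := by
  have hu : 0 ≤ b * x := mul_nonneg hb hx
  have h1 : Real.exp (b * x) - 1 ≤ b * x * Real.exp (b * x) := by
    have := Real.add_one_le_exp (-(b * x))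
    have h2 : Real.exp (-(b * x)) * Real.exp (b * x) = 1 := by rw [← Real.exp_add]; simp
    nlinarith [Real.exp_pos (b * x)]
  have h3 : Real.exp (b * x) ≤ Real.exp x := Real.exp_le_exp.mpr (by nlinarith)
  have h4 : x ^ 2 ≤ 2 * Real.exp x := by
    have := Real.quadratic_le_exp_of_nonneg hx
    nlinarith
  have h5 : Real.exp (2 * x) = Real.exp x * Real.exp x := by rw [← Real.exp_add]; ring_nf
  have h6 : x ^ 2 * Real.exp (b * x) ≤ 2 * Real.exp (2 * x) := by
    rw [h5]
    calc x ^ 2 * Real.exp (b * x) ≤ (2 * Real.exp x) * Real.exp x := by gcongr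
      _ = _ := by ring
  have h7 : b ^ 2 * (x ^ 2 * Real.exp (b * x)) ≤ b ^ 2 * (2 * Real.exp (2 * x)) := by gcongr
  nlinarith

/-- Urysohn-type inequality: the volume of a set is controlled by the Gaussian mean of any
function dominating its support function. -/
lemma urysohn_exp {D : ℕ} {X : (Fin D → ℝ) → ℝ} (hX : Measurable X) (h0 : ∀ z, 0 ≤ X z) {B : ℝ}
    (hB : ∀ z, X z ≤ B * ∑ i, |z i|) {w : ℝ} (hw : ∫ z, X z ∂gam (Fin D) ≤ w)
    {K : Set (Fin D → ℝ)} (hK : ∀ x ∈ K, ∀ z, ∑ i, x i * z i ≤ X z) :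
    volume K ≤ ENNReal.ofReal (Real.exp (D * (Real.log (2 * Real.pi) - 1) / 2 + w)) := by
  set Kh : Set (Fin D → ℝ) := {x | ∀ z, ∑ i, x i * z i ≤ X z} with hKh
  have hKc : IsClosed Kh := by
    rw [hKh, Set.ofPred_forall]
    exact isClosed_iInter fun z => isClosed_le (by fun_prop) continuous_const
  refine (measure_mono (show K ⊆ Kh from fun x hx => hK x hx)).trans ?_
  set M : ℝ := ∫ z, 2 * Real.exp (2 * (B * ∑ i, |z i|)) ∂gam (Fin D) with hM
  have hMint : Integrable (fun z : Fin D → ℝ => 2 * Real.exp (2 * (B * ∑ i, |z i|)))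
      (gam (Fin D)) := by
    simp_rw [← mul_assoc 2 B]
    exact (integrable_exp_mul_sum_abs_gam (2 * B)).const_mul 2
  have hXint : Integrable X (gam (Fin D)) := by
    refine hMint.mono' hX.aestronglyMeasurable (Filter.Eventually.of_forall fun z => ?_)
    rw [Real.norm_of_nonneg (h0 z)]
    have h1 := Real.add_one_le_exp (2 * (B * ∑ i, |z i|))
    have h2 := hB z
    have h3 := h0 z
    linarith [Real.exp_pos (2 * (B * ∑ i, |z i|))]
  have hexp : ∀ b : ℝ, 0 < b → b < 1 →
      ∫⁻ z, ENNReal.ofReal (Real.exp (b * X z)) ∂gam (Fin D) ≤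
        ENNReal.ofReal (Real.exp (b * (w + b * M))) := by
    intro b hb hb1
    have hle : ∀ z, Real.exp (b * X z) ≤ 1 + b * X z +
        b ^ 2 * (2 * Real.exp (2 * (B * ∑ i, |z i|))) := by
      intro z
      refine (exp_mul_le_quadratic hb.le hb1.le (h0 z)).trans ?_
      gcongr
      exact hB z
    have hI1 : Integrable (fun z => 1 + b * X z) (gam (Fin D)) :=
      (integrable_const _).add (hXint.const_mul b)
    have hI : Integrable (fun z => 1 + b * X z +
        b ^ 2 * (2 * Real.exp (2 * (B * ∑ i, |z i|)))) (gam (Fin D)) :=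
      hI1.add (hMint.const_mul _)
    calc ∫⁻ z, ENNReal.ofReal (Real.exp (b * X z)) ∂gam (Fin D)
        ≤ ∫⁻ z, ENNReal.ofReal (1 + b * X z +
          b ^ 2 * (2 * Real.exp (2 * (B * ∑ i, |z i|)))) ∂gam (Fin D) :=
          lintegral_mono fun z => ENNReal.ofReal_le_ofReal (hle z)
      _ = ENNReal.ofReal (∫ z, (1 + b * X z +
          b ^ 2 * (2 * Real.exp (2 * (B * ∑ i, |z i|)))) ∂gam (Fin D)) := by
          rw [ofReal_integral_eq_lintegral_ofReal hI]
          exact Filter.Eventually.of_forall fun z => (Real.exp_pos _).le.trans (hle z)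
      _ ≤ ENNReal.ofReal (Real.exp (b * (w + b * M))) := by
          refine ENNReal.ofReal_le_ofReal ?_
          rw [integral_add hI1 (hMint.const_mul _),
            integral_add (integrable_const _) (hXint.const_mul b), integral_const_mul,
            integral_const_mul, ← hM]
          simp only [integral_const, probReal_univ, smul_eq_mul, mul_one]
          have := Real.add_one_le_exp (b * (w + b * M))
          nlinarith
  have key : ∀ b : ℝ, 0 < b → b < 1 → volume Kh ≤ ENNReal.ofReal
      (Real.exp (D * (Real.log (2 * Real.pi) - 1) / 2 + w + b * (M + D / 2))) := by
    intro b hb hb1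
    set a := 1 - b with ha
    have ha0 : 0 < a := by linarith
    have hfm : Measurable fun x : Fin D → ℝ =>
        ENNReal.ofReal (Real.exp (-(a / 2 * ∑ i, x i ^ 2))) := by fun_prop
    have hgm : Measurable (Kh.indicator (fun _ => (1 : ENNReal))) :=
      measurable_const.indicator hKc.measurableSet
    have hhm : Measurable fun z : Fin D → ℝ => ENNReal.ofReal (Real.exp (-(∑ i, z i ^ 2) / 2)) *
        ENNReal.ofReal (Real.exp (b * X z)) := by fun_prop
    have pl := prekopa_leindler ha0 hb (by rw [ha]; ring) D hfm hgm hhm (fun x y => by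
      by_cases hy : y ∈ Kh
      · rw [Set.indicator_of_mem hy, ENNReal.one_rpow, mul_one,
          ENNReal.ofReal_rpow_of_pos (Real.exp_pos _), ← ENNReal.ofReal_mul (Real.exp_pos _).le,
          ← Real.exp_mul, ← Real.exp_add]
        refine ENNReal.ofReal_le_ofReal (Real.exp_le_exp.mpr ?_)
        have h1 := hy (a • x + b • y)
        have e1 : ∑ i, (a • x + b • y) i ^ 2 = a ^ 2 * ∑ i, x i ^ 2 +
            2 * b * ∑ i, y i * (a • x + b • y) i - b ^ 2 * ∑ i, y i ^ 2 := by
          simp only [Finset.mul_sum, ← Finset.sum_add_distrib, ← Finset.sum_sub_distrib]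
          refine Finset.sum_congr rfl fun i _ => ?_
          simp only [Pi.add_apply, Pi.smul_apply, smul_eq_mul]
          ring
        have h2 : 0 ≤ ∑ i, y i ^ 2 := Finset.sum_nonneg fun i _ => sq_nonneg _
        rw [e1]
        nlinarith [mul_le_mul_of_nonneg_left h1 hb.le, mul_nonneg (sq_nonneg b) h2]
      · rw [Set.indicator_of_notMem hy, ENNReal.zero_rpow_of_pos hb, mul_zero]
        exact zero_le)
    have hV : ∫⁻ x, Kh.indicator (fun _ => (1 : ENNReal)) x = volume Kh := by
      rw [lintegral_indicator hKc.measurableSet]; simp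
    have hI : ∫⁻ z : Fin D → ℝ, ENNReal.ofReal (Real.exp (-(∑ i, z i ^ 2) / 2)) *
        ENNReal.ofReal (Real.exp (b * X z)) =
        ENNReal.ofReal (Real.sqrt (2 * Real.pi) ^ D) *
          ∫⁻ z, ENNReal.ofReal (Real.exp (b * X z)) ∂gam (Fin D) := by
      rw [lintegral_gam (by fun_prop), ← mul_assoc, ← ENNReal.ofReal_mul (by positivity),
        Fintype.card_fin, ← mul_pow, mul_inv_cancel₀ (by positivity)]
      simp
    rw [hV, hI, lintegral_exp_neg_mul_sq (by positivity), Fintype.card_fin] at pl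
    replace pl := pl.trans (mul_le_mul_right (hexp b hb hb1) _)
    have hpi : (0:ℝ) < 2 * Real.pi := by positivity
    have ex : ∀ u : ℝ, 0 < u → Real.sqrt u ^ D = Real.exp (D * Real.log u / 2) := by
      intro u hu
      rw [Real.sqrt_eq_rpow, Real.rpow_def_of_pos hu, ← Real.exp_nat_mul]
      congr 1; ring
    rw [ex _ (by positivity), ex _ hpi, ENNReal.ofReal_rpow_of_pos (Real.exp_pos _),
      ← Real.exp_mul, ← ENNReal.ofReal_mul (Real.exp_pos _).le, ← Real.exp_add,
      show Real.pi / (a / 2) = 2 * Real.pi / a by field_simp,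
      Real.log_div hpi.ne' ha0.ne'] at pl
    have hT : ∀ (V : ENNReal) (s t : ℝ), ENNReal.ofReal (Real.exp s) * V ^ b ≤
        ENNReal.ofReal (Real.exp t) → V ≤ ENNReal.ofReal (Real.exp ((t - s) / b)) := by
      intro V s t hV
      have h1 : V ^ b ≤ ENNReal.ofReal (Real.exp (t - s)) := by
        have h2 :
            ENNReal.ofReal (Real.exp (-s)) * (ENNReal.ofReal (Real.exp s) * V ^ b) = V ^ b := by
          rw [← mul_assoc, ← ENNReal.ofReal_mul (Real.exp_pos _).le, ← Real.exp_add]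
          simp
        rw [← h2]
        refine (mul_le_mul_right hV _).trans (le_of_eq ?_)
        rw [← ENNReal.ofReal_mul (Real.exp_pos _).le, ← Real.exp_add]
        congr 2; ring
      have h3 := ENNReal.rpow_le_rpow h1 (inv_pos.mpr hb).le
      rw [← ENNReal.rpow_mul, mul_inv_cancel₀ hb.ne', ENNReal.rpow_one,
        ENNReal.ofReal_rpow_of_pos (Real.exp_pos _), ← Real.exp_mul] at h3
      rwa [div_eq_mul_inv]
    refine (hT _ _ _ pl).trans (ENNReal.ofReal_le_ofReal (Real.exp_le_exp.mpr ?_))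
    rw [div_le_iff₀ hb]
    have hl : Real.log a ≤ a - 1 := Real.log_le_sub_one_of_pos ha0
    have hl2 : a * Real.log a ≤ -b + b ^ 2 := by rw [ha] at hl ⊢; nlinarith
    have hD : (0:ℝ) ≤ D := Nat.cast_nonneg D
    have hl3 := mul_le_mul_of_nonneg_left hl2 hD
    have : a = 1 - b := ha
    generalize Real.log a = la at *
    generalize Real.log (2 * Real.pi) = l at *
    have e1 : D * (l - la) / 2 * a = D * l / 2 * (1 - b) - D * (a * la) / 2 := by
      rw [← this]; ring
    rw [e1]
    nlinarith
  have hlim : Filter.Tendsto (fun b : ℝ => ENNReal.ofReal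
      (Real.exp (D * (Real.log (2 * Real.pi) - 1) / 2 + w + b * (M + D / 2))))
      (nhdsWithin 0 (Set.Ioi 0)) (nhds (ENNReal.ofReal
        (Real.exp (D * (Real.log (2 * Real.pi) - 1) / 2 + w)))) := by
    have : Continuous fun b : ℝ => ENNReal.ofReal
      (Real.exp (D * (Real.log (2 * Real.pi) - 1) / 2 + w + b * (M + D / 2))) :=
      ENNReal.continuous_ofReal.comp (by fun_prop)
    have h := this.tendsto 0
    simp only [zero_mul, add_zero] at h
    exact h.mono_left nhdsWithin_le_nhds
  refine ge_of_tendsto hlim ?_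
  filter_upwards [Ioo_mem_nhdsGT (zero_lt_one : (0:ℝ) < 1)] with b hb
  exact key b hb.1 hb.2

/-- Urysohn-type inequality in scale-invariant form. -/
lemma urysohn {D : ℕ} (hD : 0 < D) {X : (Fin D → ℝ) → ℝ} (hX : Measurable X) (h0 : ∀ z, 0 ≤ X z)
    {B : ℝ} (hB : ∀ z, X z ≤ B * ∑ i, |z i|) {w : ℝ} (hw0 : 0 < w)
    (hw : ∫ z, X z ∂gam (Fin D) ≤ w)
    {K : Set (Fin D → ℝ)} (hK : ∀ x ∈ K, ∀ z, ∑ i, x i * z i ≤ X z) :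
    volume K ≤ ENNReal.ofReal ((Real.sqrt (2 * Real.pi * Real.exp 1) * w / D) ^ D) := by
  have hD' : (0:ℝ) < D := by exact_mod_cast hD
  set t : ℝ := D / w with ht
  have ht0 : 0 < t := by positivity
  have h := urysohn_exp (X := fun z => t * X z) (B := t * B) (w := D) (K := t • K)
    (hX.const_mul t) (fun z => mul_nonneg ht0.le (h0 z))
    (fun z => by rw [mul_assoc]; exact mul_le_mul_of_nonneg_left (hB z) ht0.le)
    (by
      rw [integral_const_mul]
      refine (mul_le_mul_of_nonneg_left hw ht0.le).trans (le_of_eq ?_)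
      rw [ht]; field_simp)
    (by
      rintro _ ⟨x, hx, rfl⟩ z
      have : ∑ i, (t • x) i * z i = t * ∑ i, x i * z i := by
        rw [Finset.mul_sum]
        exact Finset.sum_congr rfl fun i _ => by simp [mul_assoc]
      rw [this]
      exact mul_le_mul_of_nonneg_left (hK x hx z) ht0.le)
  rw [Measure.addHaar_smul, Module.finrank_fin_fun, abs_of_pos (by positivity)] at h
  have h2 : volume K = ENNReal.ofReal ((t⁻¹) ^ D) * (ENNReal.ofReal (t ^ D) * volume K) := by
    rw [← mul_assoc, ← ENNReal.ofReal_mul (by positivity), ← mul_pow, inv_mul_cancel₀ ht0.ne']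
    simp
  rw [h2]
  refine (mul_le_mul_right h _).trans ?_
  rw [← ENNReal.ofReal_mul (by positivity)]
  refine ENNReal.ofReal_le_ofReal (le_of_eq ?_)
  have e1 : Real.exp (D * (Real.log (2 * Real.pi) - 1) / 2 + D) =
      Real.sqrt (2 * Real.pi * Real.exp 1) ^ D := by
    rw [Real.sqrt_eq_rpow, Real.rpow_def_of_pos (by positivity), ← Real.exp_nat_mul,
      Real.log_mul (by positivity) (Real.exp_pos _).ne', Real.log_exp]
    congr 1; ring
  rw [e1, ← mul_pow, ht]
  congr 1
  field_simp

end Urysohn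

section GaussianMoments

open ProbabilityTheory

lemma integrable_pow_gaussianReal (k : ℕ) : Integrable (fun t : ℝ => t ^ k) (gaussianReal 0 1) := by
  have h := (memLp_id_gaussianReal (μ := 0) (v := 1) k)
  have h2 := MemLp.integrable_norm_pow' h
  refine h2.mono (by fun_prop) (Filter.Eventually.of_forall fun t => by simp)

lemma integral_pow_succ_gaussianReal (k : ℕ) :
    ∫ t, t ^ (k + 1) ∂gaussianReal 0 1 = k * ∫ t, t ^ (k - 1) ∂gaussianReal 0 1 := by
  have hI : ∀ j : ℕ, Integrable (fun t : ℝ => gaussianPDFReal 0 1 t * t ^ j) := by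
    intro j
    have h := integrable_pow_gaussianReal j
    rw [gaussianReal_of_var_ne_zero 0 one_ne_zero,
      integrable_withDensity_iff_integrable_smul' (measurable_gaussianPDF _ _)
        (Filter.Eventually.of_forall fun _ => gaussianPDF_lt_top)] at h
    simpa using h
  have hd : ∀ t : ℝ, HasDerivAt (fun t : ℝ => gaussianPDFReal 0 1 t * t ^ k)
      (k * (gaussianPDFReal 0 1 t * t ^ (k - 1)) - gaussianPDFReal 0 1 t * t ^ (k + 1)) t := by
    intro t
    have h1 : HasDerivAt (gaussianPDFReal 0 1) (-t * gaussianPDFReal 0 1 t) t := by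
      simp only [gaussianPDFReal_def, NNReal.coe_one, mul_one, sub_zero]
      have h2 : HasDerivAt (fun x : ℝ => -x ^ 2 / 2) (-t) t := by
        refine ((hasDerivAt_pow 2 t).neg.div_const 2).congr_deriv ?_
        simp
        ring
      refine (h2.exp.const_mul _).congr_deriv ?_
      ring
    refine (h1.mul (hasDerivAt_pow k t)).congr_deriv ?_
    ring
  have h0 := integral_eq_zero_of_hasDerivAt_of_integrable hd
    (((hI (k - 1)).const_mul _).sub (hI (k + 1))) (hI k)
  rw [integral_sub ((hI (k - 1)).const_mul _) (hI (k + 1)), integral_const_mul] at h0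
  simp only [integral_gaussianReal_eq_integral_smul one_ne_zero, smul_eq_mul]
  linarith

variable {ι : Type*} [Fintype ι]

lemma integrable_eval (p : MvPolynomial ι ℝ) : Integrable (fun z => eval z p) (gam ι) := by
  induction p using MvPolynomial.induction_on' with
  | monomial α c =>
    simp only [eval_monomial, Finsupp.prod_fintype _ _ (fun _ => pow_zero _)]
    exact (Integrable.fintype_prod fun i => integrable_pow_gaussianReal (α i)).const_mul c
  | add p q hp hq =>
    simp only [map_add]
    exact hp.add hq

/-- The Gaussian expectation of a polynomial. -/
def gE : MvPolynomial ι ℝ →ₗ[ℝ] ℝ where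
  toFun p := ∫ z, eval z p ∂gam ι
  map_add' p q := by
    simp only [map_add]
    exact integral_add (integrable_eval p) (integrable_eval q)
  map_smul' c p := by
    simp only [smul_eval, RingHom.id_apply, smul_eq_mul]
    exact integral_const_mul c _

lemma gE_def (p : MvPolynomial ι ℝ) : gE p = ∫ z, eval z p ∂gam ι := rfl

lemma gE_C_mul (c : ℝ) (p : MvPolynomial ι ℝ) : gE (C c * p) = c * gE p := by
  rw [C_mul', map_smul, smul_eq_mul]

lemma gE_one : gE (1 : MvPolynomial ι ℝ) = 1 := by
  simp [gE_def]

lemma gE_mono {p q : MvPolynomial ι ℝ} (h : ∀ z, eval z p ≤ eval z q) : gE p ≤ gE q :=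
  integral_mono (integrable_eval p) (integrable_eval q) h

lemma gE_nonneg {p : MvPolynomial ι ℝ} (h : ∀ z, 0 ≤ eval z p) : 0 ≤ gE p :=
  integral_nonneg h

lemma gE_sq_nonneg (p : MvPolynomial ι ℝ) : 0 ≤ gE (p ^ 2) :=
  gE_nonneg fun z => by rw [map_pow]; exact sq_nonneg _

lemma gE_monomial (α : ι →₀ ℕ) (c : ℝ) :
    gE (monomial α c) = c * ∏ i, ∫ t, t ^ α i ∂gaussianReal 0 1 := by
  simp only [gE_def, eval_monomial, Finsupp.prod_fintype _ _ (fun _ => pow_zero _)]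
  rw [integral_const_mul]
  congr 1
  exact integral_fintype_prod_eq_prod (μ := fun _ => gaussianReal 0 1) fun i t => t ^ α i

/-- Gaussian integration by parts. -/
lemma gE_X_mul (i : ι) (p : MvPolynomial ι ℝ) : gE (X i * p) = gE (pderiv i p) := by
  classical
  induction p using MvPolynomial.induction_on' with
  | monomial α c =>
    rw [X, monomial_mul, pderiv_monomial, gE_monomial, gE_monomial, one_mul, mul_assoc]
    congr 1
    rw [Fintype.prod_eq_mul_prod_compl i, Fintype.prod_eq_mul_prod_compl i
      (fun j => ∫ t, t ^ (α - Finsupp.single i 1 : ι →₀ ℕ) j ∂gaussianReal 0 1)]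
    have h : ∀ j ∈ ({i} : Finset ι)ᶜ,
        ∫ t, t ^ (Finsupp.single i 1 + α : ι →₀ ℕ) j ∂gaussianReal 0 1 =
        ∫ t, t ^ (α - Finsupp.single i 1 : ι →₀ ℕ) j ∂gaussianReal 0 1 := by
      intro j hj
      have : i ≠ j := fun h => by simp [h] at hj
      simp [this]
    rw [Finset.prod_congr rfl h, ← mul_assoc]
    congr 1
    have := integral_pow_succ_gaussianReal (α i)
    simp only [Finsupp.add_apply, Finsupp.single_eq_same, Finsupp.tsub_apply, add_comm 1]
    exact this
  | add p q hp hq => rw [mul_add, map_add, map_add, map_add, hp, hq]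

omit [Fintype ι] in
lemma pderiv_pderiv_comm' (i j : ι) (p : MvPolynomial ι ℝ) :
    pderiv i (pderiv j p) = pderiv j (pderiv i p) := by
  classical
  ext β
  simp only [coeff_pderiv, add_assoc]
  rw [add_comm (Finsupp.single i 1) (Finsupp.single j 1)]
  by_cases hij : i = j
  · subst hij; ring
  · simp [Ne.symm hij, hij]; ring

/-- The Ornstein–Uhlenbeck number operator on polynomials. -/
def ouN (p : MvPolynomial ι ℝ) : MvPolynomial ι ℝ :=
  ∑ i, X i * pderiv i p - ∑ i, pderiv i (pderiv i p)

lemma gE_mul_ouN (q p : MvPolynomial ι ℝ) :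
    gE (q * ouN p) = ∑ i, gE (pderiv i q * pderiv i p) := by
  rw [ouN, mul_sub, Finset.mul_sum, Finset.mul_sum, map_sub, map_sum, map_sum,
    ← Finset.sum_sub_distrib]
  refine Finset.sum_congr rfl fun i _ => ?_
  rw [mul_left_comm, gE_X_mul, pderiv_mul, map_add]
  ring

lemma pderiv_ouN (i : ι) (p : MvPolynomial ι ℝ) :
    pderiv i (ouN p) = ouN (pderiv i p) + pderiv i p := by
  classical
  simp only [ouN, map_sub, map_sum, pderiv_mul, pderiv_X, Finset.sum_add_distrib]
  have h1 : ∑ x, Pi.single (M := fun _ => MvPolynomial ι ℝ) i 1 x * pderiv x p = pderiv i p := by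
    rw [Finset.sum_eq_single i]
    · simp
    · intro j _ hj; simp [hj]
    · simp
  have h2 : ∀ j, pderiv i (pderiv j p) = pderiv j (pderiv i p) := fun j => pderiv_pderiv_comm' i j p
  have h3 : ∀ j, pderiv i (pderiv j (pderiv j p)) = pderiv j (pderiv j (pderiv i p)) := fun j => by
    rw [pderiv_pderiv_comm' i j, h2]
  simp only [h1, h2, h3]
  ring

/-- Reverse Poincaré inequality for homogeneous polynomials. -/
lemma sum_gE_pderiv_sq_le (k : ℕ) (p : MvPolynomial ι ℝ) (hp : p.IsHomogeneous k) :
    ∑ i, gE (pderiv i p ^ 2) ≤ k * gE (p ^ 2) := by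
  induction k generalizing p with
  | zero =>
    have h0 : ∀ i, pderiv i p = 0 := by
      intro i
      rw [totalDegree_eq_zero_iff_eq_C.mp (Nat.le_zero.mp hp.totalDegree_le)]
      exact pderiv_C
    simp [h0]
  | succ k ih =>
    set S := ∑ i, gE (pderiv i p ^ 2) with hS
    have hS' : gE (p * ouN p) = S := by
      rw [gE_mul_ouN, hS]
      exact Finset.sum_congr rfl fun i _ => by rw [sq]
    have hN : gE (ouN p * ouN p) ≤ (k + 1) * S := by
      rw [gE_mul_ouN, hS, Finset.mul_sum]
      refine Finset.sum_le_sum fun i _ => ?_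
      have hi := ih (pderiv i p) (by simpa using hp.pderiv (i := i))
      rw [pderiv_ouN, add_mul, map_add, mul_comm (ouN _), gE_mul_ouN, ← sq]
      simp only [sq] at hi ⊢
      linarith
    have h0 : 0 ≤ gE ((ouN p - C ((k : ℝ) + 1) * p) ^ 2) := gE_sq_nonneg _
    have e : (ouN p - C ((k : ℝ) + 1) * p) ^ 2 = ouN p * ouN p -
        C (2 * ((k : ℝ) + 1)) * (p * ouN p) + C (((k : ℝ) + 1) ^ 2) * p ^ 2 := by
      simp only [C_mul, C_pow, C_add, map_ofNat]
      ring
    rw [e, map_add, map_sub, gE_C_mul, gE_C_mul, hS'] at h0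
    have hk : (0 : ℝ) < (k : ℝ) + 1 := by positivity
    push_cast
    nlinarith

end GaussianMoments

section Apolar

variable {ι : Type*} [Fintype ι]

/-- The factorial `α!` of a multi-index. -/
def fac (α : ι →₀ ℕ) : ℝ := ∏ i, ((α i).factorial : ℝ)

lemma fac_pos (α : ι →₀ ℕ) : 0 < fac α :=
  Finset.prod_pos fun i _ => by exact_mod_cast Nat.factorial_pos _

/-- The apolar pairing `∑_α α! p_α q_α` as a bilinear map. -/
def apI : MvPolynomial ι ℝ →ₗ[ℝ] MvPolynomial ι ℝ →ₗ[ℝ] ℝ :=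
  (basisMonomials ι ℝ).constr ℝ fun α => fac α • lcoeff ℝ α

lemma apI_eq_sum {S : Finset (ι →₀ ℕ)} {p : MvPolynomial ι ℝ} (q : MvPolynomial ι ℝ)
    (h : ∀ α ∉ S, coeff α p = 0) :
    apI p q = ∑ α ∈ S, fac α * (coeff α p * coeff α q) := by
  rw [apI, Module.Basis.constr_apply, Finsupp.sum, LinearMap.sum_apply]
  refine Finset.sum_subset_zero_on_sdiff ?_ ?_ ?_
  · intro α hα
    by_contra hS
    exact (Finsupp.mem_support_iff.mp hα) (h α hS)
  · intro α hα
    have : coeff α p = 0 := Finsupp.notMem_support_iff.mp (Finset.mem_sdiff.mp hα).2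
    simp [this]
  · intro α _
    change coeff α p * (fac α * coeff α q) = _
    ring

lemma apI_comm (p q : MvPolynomial ι ℝ) : apI p q = apI q p := by
  classical
  rw [apI_eq_sum (S := p.support ∪ q.support) q, apI_eq_sum (S := p.support ∪ q.support) p]
  · exact Finset.sum_congr rfl fun α _ => by ring
  · intro α h; rw [Finset.notMem_union] at h; exact notMem_support_iff.mp h.2
  · intro α h; rw [Finset.notMem_union] at h; exact notMem_support_iff.mp h.1

/-- The squared apolar norm. -/
def apN (p : MvPolynomial ι ℝ) : ℝ := apI p p

lemma apN_eq_sum {S : Finset (ι →₀ ℕ)} {p : MvPolynomial ι ℝ}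
    (h : ∀ α ∉ S, coeff α p = 0) :
    apN p = ∑ α ∈ S, fac α * coeff α p ^ 2 := by
  rw [apN, apI_eq_sum _ h]
  exact Finset.sum_congr rfl fun α _ => by ring

lemma apN_eq_sum_support (p : MvPolynomial ι ℝ) :
    apN p = ∑ α ∈ p.support, fac α * coeff α p ^ 2 :=
  apN_eq_sum fun _ h => notMem_support_iff.mp h

lemma apN_nonneg (p : MvPolynomial ι ℝ) : 0 ≤ apN p := by
  rw [apN_eq_sum_support]
  exact Finset.sum_nonneg fun α _ => mul_nonneg (fac_pos α).le (sq_nonneg _)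

lemma eq_zero_of_apN_eq_zero {p : MvPolynomial ι ℝ} (h : apN p = 0) : p = 0 := by
  rw [apN_eq_sum_support, Finset.sum_eq_zero_iff_of_nonneg
    fun α _ => mul_nonneg (fac_pos α).le (sq_nonneg _)] at h
  by_contra hp
  obtain ⟨α, hα⟩ := support_nonempty.mpr hp
  have := h α hα
  rcases mul_eq_zero.mp this with h1 | h1
  · exact (fac_pos α).ne' h1
  · exact mem_support_iff.mp hα (by simpa using h1)

/-- Cauchy–Schwarz for the apolar pairing. -/
lemma apI_sq_le (p q : MvPolynomial ι ℝ) : apI p q ^ 2 ≤ apN p * apN q := by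
  have h : ∀ t : ℝ, 0 ≤ apN p * (t * t) + 2 * apI p q * t + apN q := by
    intro t
    have := apN_nonneg (t • p + q)
    simp only [apN, map_add, map_smul, LinearMap.add_apply, LinearMap.smul_apply, smul_eq_mul,
      apI_comm q p] at this ⊢
    linarith
  have := discrim_le_zero h
  rw [discrim] at this
  linarith

lemma apN_pderiv (i : ι) (p : MvPolynomial ι ℝ) :
    apN (pderiv i p) = ∑ α ∈ p.support, fac α * (α i) * coeff α p ^ 2 := by
  classical
  rw [apN_eq_sum_support]
  refine Finset.sum_of_injOn (fun β => β + Finsupp.single i 1)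
    (fun a _ b _ h => add_right_cancel h) ?_ ?_ ?_
  · intro β hβ
    simp only [Finset.mem_coe, mem_support_iff, coeff_pderiv] at hβ ⊢
    exact left_ne_zero_of_mul hβ
  · intro α hα hn
    by_cases h0 : α i = 0
    · simp [h0]
    · exfalso
      have e : α - Finsupp.single i 1 + Finsupp.single i 1 = α := by
        ext j
        by_cases hj : i = j
        · subst hj; simp; omega
        · simp [hj]
      refine hn ⟨α - Finsupp.single i 1, ?_, e⟩
      simp only [Finset.mem_coe, mem_support_iff, coeff_pderiv, e]
      refine mul_ne_zero (mem_support_iff.mp hα) ?_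
      positivity
  · intro β _
    have e : fac (β + Finsupp.single i 1) = (β i + 1 : ℕ) * fac β := by
      rw [fac, fac, Fintype.prod_eq_mul_prod_compl i, Fintype.prod_eq_mul_prod_compl i
        (fun j => ((β j).factorial : ℝ)), ← mul_assoc]
      congr 1
      · simp [Nat.factorial_succ]
      · refine Finset.prod_congr rfl fun j hj => ?_
        have : i ≠ j := fun h => by simp [h] at hj
        simp [this]
    simp only [coeff_pderiv, e, Finsupp.add_apply, Finsupp.single_eq_same]
    push_cast
    ring

lemma sum_apN_pderiv {s : Finset ι} {k : ℕ} {p : MvPolynomial ι ℝ}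
    (hp : ∀ α ∈ p.support, ∑ i ∈ s, α i = k) :
    ∑ i ∈ s, apN (pderiv i p) = k * apN p := by
  simp only [apN_pderiv]
  rw [Finset.sum_comm, apN_eq_sum_support, Finset.mul_sum]
  refine Finset.sum_congr rfl fun α hα => ?_
  rw [← hp α hα, ← Finset.sum_mul, ← Finset.mul_sum]
  push_cast
  ring

lemma sum_eq_of_mem_support {k : ℕ} {p : MvPolynomial ι ℝ} (hp : p.IsHomogeneous k)
    {α : ι →₀ ℕ} (hα : α ∈ p.support) : ∑ i, α i = k := by
  have := hp (mem_support_iff.mp hα)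
  rw [Finsupp.weight_apply, Finsupp.sum_fintype _ _ (by simp)] at this
  simpa using this

/-- The apolar norm is dominated by the Gaussian `L²` norm on homogeneous polynomials. -/
lemma apN_le_gE_sq (k : ℕ) (p : MvPolynomial ι ℝ) (hp : p.IsHomogeneous k) :
    apN p ≤ gE (p ^ 2) := by
  induction k generalizing p with
  | zero =>
    obtain ⟨c, rfl⟩ : ∃ c, p = C c :=
      ⟨_, totalDegree_eq_zero_iff_eq_C.mp (Nat.le_zero.mp hp.totalDegree_le)⟩
    have h1 : apN (C c : MvPolynomial ι ℝ) = c ^ 2 := by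
      classical
      rw [apN_eq_sum (S := {0})]
      · simp [fac]
      · intro α hα
        rw [coeff_C, if_neg]
        exact fun h => hα (by simp [h])
    have h2 : gE ((C c : MvPolynomial ι ℝ) ^ 2) = c ^ 2 := by
      simp [gE_def]
    rw [h1, h2]
  | succ k ih =>
    have h1 := sum_apN_pderiv (s := Finset.univ) fun α hα => sum_eq_of_mem_support hp hα
    have h2 := sum_gE_pderiv_sq_le (k + 1) p hp
    have h3 : ∑ i, apN (pderiv i p) ≤ ∑ i, gE (pderiv i p ^ 2) :=
      Finset.sum_le_sum fun i _ => ih _ (by simpa using hp.pderiv (i := i))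
    rw [h1] at h3
    exact le_of_mul_le_mul_left (h3.trans h2) (by positivity)

lemma eval_sq_le {S : Finset (ι →₀ ℕ)} {p : MvPolynomial ι ℝ}
    (h : ∀ α ∉ S, coeff α p = 0) (z : ι → ℝ) :
    eval z p ^ 2 ≤ apN p * ∑ α ∈ S, (∏ i, (z i ^ 2) ^ α i) / fac α := by
  have hS : p.support ⊆ S := fun α hα => by
    by_contra hn
    exact mem_support_iff.mp hα (h α hn)
  rw [eval_eq', apN_eq_sum h, Finset.sum_subset hS
    (fun α _ hα => by rw [notMem_support_iff.mp hα, zero_mul])]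
  refine Finset.sum_sq_le_sum_mul_sum_of_sq_le_mul _
    (fun α _ => mul_nonneg (fac_pos α).le (sq_nonneg _))
    (fun α _ => div_nonneg (Finset.prod_nonneg fun i _ => by positivity) (fac_pos α).le)
    fun α _ => le_of_eq ?_
  have := (fac_pos α).ne'
  rw [mul_pow, ← Finset.prod_pow]
  simp only [← pow_mul, mul_comm 2]
  field_simp

end Apolar

section MultiIndex

section
variable {ι : Type*} [Fintype ι] {R : Type*} [CommRing R] [Algebra ℝ R]

lemma sum_pow_eq_smul [DecidableEq ι] (w : ι → R) (a : ℕ) :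
    (∑ i, w i) ^ a = ∑ u ∈ Finset.piAntidiag Finset.univ a,
      ((a.factorial : ℝ) / ∏ i, ((u i).factorial : ℝ)) • ∏ i, w i ^ u i := by
  rw [Finset.sum_pow_eq_sum_piAntidiag]
  refine Finset.sum_congr rfl fun u hu => ?_
  rw [← nsmul_eq_mul, ← Nat.cast_smul_eq_nsmul ℝ]
  congr 1
  have h := Nat.multinomial_spec Finset.univ u
  rw [(Finset.mem_piAntidiag.mp hu).1] at h
  rw [← h, eq_div_iff (Finset.prod_ne_zero_iff.mpr fun i _ => by positivity)]
  push_cast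
  ring

/-- The exponents of total degree `a`. -/
def sexp (ι : Type*) [Fintype ι] (a : ℕ) : Finset (ι →₀ ℕ) :=
  letI := Classical.decEq ι
  (Finset.piAntidiag Finset.univ a).map Finsupp.equivFunOnFinite.symm.toEmbedding

lemma mem_sexp {a : ℕ} {α : ι →₀ ℕ} : α ∈ sexp ι a ↔ ∑ i, α i = a := by
  classical
  rw [sexp, Finset.mem_map_equiv, Equiv.symm_symm, Finset.mem_piAntidiag]
  simp

lemma sum_pow_eq_sum_sexp (w : ι → R) (a : ℕ) :
    (∑ i, w i) ^ a = ∑ α ∈ sexp ι a, ((a.factorial : ℝ) / fac α) • ∏ i, w i ^ α i := by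
  classical
  rw [sexp, Finset.sum_map, sum_pow_eq_smul]
  rfl

lemma card_sexp (a : ℕ) :
    (sexp ι a).card = (Fintype.card ι + a - 1).choose a := by
  classical
  rw [sexp, Finset.card_map, ← Finset.map_sym_eq_piAntidiag, Finset.card_map, Finset.sym_univ,
    Finset.card_univ, Sym.card_sym_eq_choose]

end

variable {ι κ : Type*} [Fintype ι] [Fintype κ]

/-- Gluing exponents. -/
def glue : (ι →₀ ℕ) × (κ →₀ ℕ) ≃ (ι ⊕ κ →₀ ℕ) := Finsupp.sumFinsuppEquivProdFinsupp.symm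

/-- The exponents of bidegree `(a, b)`. -/
def bexp (ι κ : Type*) [Fintype ι] [Fintype κ] (a b : ℕ) : Finset (ι ⊕ κ →₀ ℕ) :=
  (sexp ι a ×ˢ sexp κ b).map glue.toEmbedding

lemma mem_bexp {a b : ℕ} {α : ι ⊕ κ →₀ ℕ} :
    α ∈ bexp ι κ a b ↔ ∑ i, α (Sum.inl i) = a ∧ ∑ j, α (Sum.inr j) = b := by
  rw [bexp, Finset.mem_map_equiv, Finset.mem_product, mem_sexp, mem_sexp]
  rfl

lemma card_bexp (a b : ℕ) : (bexp ι κ a b).card = (sexp ι a).card * (sexp κ b).card := by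
  rw [bexp, Finset.card_map, Finset.card_product]

lemma fac_glue (p : (ι →₀ ℕ) × (κ →₀ ℕ)) : fac (glue p) = fac p.1 * fac p.2 := by
  rw [fac, Fintype.prod_sum_type]
  simp [fac, glue]

/-- The multinomial coefficients of bidegree `(a, b)`. -/
def mlt (a b : ℕ) (α : ι ⊕ κ →₀ ℕ) : ℝ := a.factorial * b.factorial / fac α

lemma mlt_pos (a b : ℕ) (α : ι ⊕ κ →₀ ℕ) : 0 < mlt a b α :=
  div_pos (by positivity) (fac_pos α)

lemma sum_pow_mul_sum_pow {R : Type*} [CommRing R] [Algebra ℝ R] (w : ι ⊕ κ → R) (a b : ℕ) :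
    (∑ i, w (Sum.inl i)) ^ a * (∑ j, w (Sum.inr j)) ^ b =
      ∑ α ∈ bexp ι κ a b, mlt a b α • ∏ i, w i ^ α i := by
  rw [bexp, Finset.sum_map, Finset.sum_product, sum_pow_eq_sum_sexp, sum_pow_eq_sum_sexp,
    Finset.sum_mul_sum]
  refine Finset.sum_congr rfl fun α _ => Finset.sum_congr rfl fun β _ => ?_
  rw [smul_mul_smul_comm, Fintype.prod_sum_type, mlt]
  simp only [Equiv.coe_toEmbedding, fac_glue]
  rw [mul_div_mul_comm]
  simp [glue]

end MultiIndex

section SphericalMoments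

/-- `E|x|^{2k}` for a standard Gaussian vector in `ℝⁿ`. -/
def Gm (n k : ℕ) : ℝ := ∏ i ∈ Finset.range k, ((n : ℝ) + 2 * i)

lemma Gm_succ (n k : ℕ) : Gm n (k + 1) = Gm n k * (n + 2 * k) := Finset.prod_range_succ _ _

lemma Gm_zero (n : ℕ) : Gm n 0 = 1 := Finset.prod_range_zero _

lemma Gm_nonneg (n k : ℕ) : 0 ≤ Gm n k := Finset.prod_nonneg fun i _ => by positivity

lemma Gm_pos {n : ℕ} (hn : 0 < n) (k : ℕ) : 0 < Gm n k :=
  Finset.prod_pos fun i _ => by positivity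

variable {ι κ τ : Type*} [Fintype ι] [Fintype κ] [Fintype τ]

/-- The sum of the squares of the variables in the range of `e`. -/
def rsq (e : ι → τ) : MvPolynomial τ ℝ := ∑ i, X (e i) ^ 2

omit [Fintype τ] in
lemma eval_rsq (e : ι → τ) (z : τ → ℝ) : eval z (rsq e) = ∑ i, z (e i) ^ 2 := by
  simp [rsq]

omit [Fintype τ] in
lemma pderiv_rsq {e : ι → τ} (he : Function.Injective e) (i : ι) :
    pderiv (e i) (rsq e) = C 2 * X (e i) := by
  classical
  rw [rsq, map_sum, Finset.sum_eq_single i]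
  · rw [pderiv_pow, pderiv_X_self, show (C 2 : MvPolynomial τ ℝ) = 2 from map_ofNat C 2]
    simp
  · intro j _ hj
    rw [pderiv_pow, pderiv_X_of_ne (fun h => hj (he h)), mul_zero]
  · simp

omit [Fintype τ] in
lemma pderiv_rsq_of_notMem {e : ι → τ} {j : τ} (hj : ∀ i, e i ≠ j) :
    pderiv j (rsq e) = 0 := by
  rw [rsq, map_sum]
  refine Finset.sum_eq_zero fun i _ => ?_
  rw [pderiv_pow, pderiv_X_of_ne (hj i), mul_zero]

lemma gE_rsq_pow_succ_mul {e : ι → τ} (he : Function.Injective e) (a : ℕ)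
    {Q : MvPolynomial τ ℝ} (hQ : ∀ i, pderiv (e i) Q = 0) :
    gE (rsq e ^ (a + 1) * Q) = (Fintype.card ι + 2 * a) * gE (rsq e ^ a * Q) := by
  have h1 : rsq e ^ (a + 1) * Q = ∑ i, X (e i) * (X (e i) * (rsq e ^ a * Q)) := by
    rw [pow_succ', mul_assoc, rsq, Finset.sum_mul]
    exact Finset.sum_congr rfl fun i _ => by ring
  have h2 : ∀ i, pderiv (e i) (X (e i) * (rsq e ^ a * Q)) =
      rsq e ^ a * Q + C (2 * a : ℝ) * (X (e i) ^ 2 * (rsq e ^ (a - 1) * Q)) := by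
    intro i
    rw [pderiv_mul, pderiv_X_self, pderiv_mul, hQ, pderiv_pow, pderiv_rsq he]
    simp only [C_mul, map_natCast]
    ring
  rw [h1, map_sum]
  simp only [gE_X_mul, h2, map_add, Finset.sum_add_distrib, gE_C_mul]
  rw [← Finset.mul_sum, ← map_sum (gE : MvPolynomial τ ℝ →ₗ[ℝ] ℝ)
    (fun i => X (e i) ^ 2 * (rsq e ^ (a - 1) * Q)), ← Finset.sum_mul, ← rsq]
  rcases a with _ | a
  · simp
  · rw [Nat.add_sub_cancel, ← mul_assoc, ← pow_succ']
    simp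
    ring

lemma gE_rsq_pow_mul {e : ι → τ} (he : Function.Injective e) (a : ℕ)
    {Q : MvPolynomial τ ℝ} (hQ : ∀ i, pderiv (e i) Q = 0) :
    gE (rsq e ^ a * Q) = Gm (Fintype.card ι) a * gE Q := by
  induction a with
  | zero => simp [Gm_zero]
  | succ a ih => rw [gE_rsq_pow_succ_mul he a hQ, ih, Gm_succ]; ring

lemma gE_rsq_pow (a : ℕ) : gE (rsq (id : ι → ι) ^ a) = Gm (Fintype.card ι) a := by
  have := gE_rsq_pow_mul (e := (id : ι → ι)) Function.injective_id a (Q := 1) fun i => by simp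
  simpa [gE_one] using this

lemma gE_rsq_pow_mul_rsq_pow (a b : ℕ) :
    gE (rsq (Sum.inl : ι → ι ⊕ κ) ^ a * rsq (Sum.inr : κ → ι ⊕ κ) ^ b) =
      Gm (Fintype.card ι) a * Gm (Fintype.card κ) b := by
  rw [gE_rsq_pow_mul Sum.inl_injective]
  · congr 1
    have := gE_rsq_pow_mul (e := (Sum.inr : κ → ι ⊕ κ)) Sum.inr_injective b (Q := 1)
      fun i => by simp
    simpa [gE_one] using this
  · intro i
    rw [pderiv_pow, pderiv_rsq_of_notMem (by simp), mul_zero]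

/-- The odd double factorial `(2p-1)!!`. -/
def dfac (p : ℕ) : ℝ := ∏ i ∈ Finset.range p, (2 * (i : ℝ) + 1)

lemma dfac_nonneg (p : ℕ) : 0 ≤ dfac p := Finset.prod_nonneg fun i _ => by positivity

lemma gE_linear_pow (a : ι → ℝ) (p : ℕ) :
    gE ((∑ i, C (a i) * X i) ^ (2 * p)) = dfac p * (∑ i, a i ^ 2) ^ p := by
  classical
  set L : MvPolynomial ι ℝ := ∑ i, C (a i) * X i with hL
  have hd : ∀ i, pderiv i L = C (a i) := by
    intro i
    rw [hL, map_sum, Finset.sum_eq_single i]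
    · rw [pderiv_C_mul, pderiv_X_self]; simp
    · intro j _ hj
      rw [pderiv_C_mul, pderiv_X_of_ne hj]; simp
    · simp
  induction p with
  | zero => simp [dfac, gE_one]
  | succ p ih =>
    have h1 : L ^ (2 * (p + 1)) = ∑ i, C (a i) * (X i * L ^ (2 * p + 1)) := by
      rw [show 2 * (p + 1) = (2 * p + 1) + 1 by ring, pow_succ' L]
      nth_rewrite 1 [hL]
      rw [Finset.sum_mul]
      exact Finset.sum_congr rfl fun i _ => by ring
    have h2 : ∀ i, gE (X i * L ^ (2 * p + 1)) = a i * (2 * p + 1) * gE (L ^ (2 * p)) := by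
      intro i
      rw [gE_X_mul, pderiv_pow, hd, Nat.add_sub_cancel,
        show ((2 * p + 1 : ℕ) : MvPolynomial ι ℝ) * L ^ (2 * p) * C (a i) =
          C (a i * (2 * p + 1)) * L ^ (2 * p) by
            simp only [C_mul, C_add, map_natCast, map_ofNat, map_one]; push_cast; ring, gE_C_mul]
    rw [h1, map_sum]
    simp only [gE_C_mul, h2, ih]
    rw [show dfac (p + 1) = dfac p * (2 * p + 1) from Finset.prod_range_succ _ _, pow_succ,
      Finset.mul_sum, Finset.mul_sum]
    refine Finset.sum_congr rfl fun i _ => by ring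

/-- The Gaussian moment `E_u (∑ zᵢ bᵢ(u))^k` as a polynomial in `z`. -/
def momP (b : ι → MvPolynomial κ ℝ) (k : ℕ) : MvPolynomial ι ℝ :=
  ∑ α ∈ sexp ι k, monomial α ((k.factorial : ℝ) / fac α * gE (∏ i, b i ^ α i))

lemma eval_momP (b : ι → MvPolynomial κ ℝ) (k : ℕ) (z : ι → ℝ) :
    eval z (momP b k) = gE ((∑ i, C (z i) * b i) ^ k) := by
  rw [sum_pow_eq_sum_sexp, momP, map_sum, map_sum]
  refine Finset.sum_congr rfl fun α _ => ?_
  rw [eval_monomial, Finsupp.prod_fintype _ _ (fun _ => pow_zero _), map_smul]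
  simp only [mul_pow, Finset.prod_mul_distrib, ← map_pow C, ← map_prod C, gE_C_mul, smul_eq_mul]
  ring

lemma isHomogeneous_momP (b : ι → MvPolynomial κ ℝ) (k : ℕ) : (momP b k).IsHomogeneous k := by
  refine IsHomogeneous.sum _ _ _ fun α hα => isHomogeneous_monomial _ ?_
  rw [Finsupp.degree_eq_sum]
  exact mem_sexp.mp hα

lemma gE_momP_le (b : ι → MvPolynomial κ ℝ) (p : ℕ) (W : MvPolynomial κ ℝ)
    (h : ∀ u, ∑ i, eval u (b i) ^ 2 ≤ eval u W) :
    gE (momP b (2 * p)) ≤ dfac p * gE (W ^ p) := by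
  have h1 : gE (momP b (2 * p)) = gE (∑ α ∈ sexp ι (2 * p),
      C (((2 * p).factorial : ℝ) / fac α * gE (monomial α (1 : ℝ))) * ∏ i, b i ^ α i) := by
    rw [momP, map_sum, map_sum]
    refine Finset.sum_congr rfl fun α _ => ?_
    rw [gE_C_mul, ← mul_one (_ * _ : ℝ), ← C_mul_monomial, gE_C_mul]
    ring
  rw [h1, ← gE_C_mul]
  refine gE_mono fun u => ?_
  have h2 : eval u (∑ α ∈ sexp ι (2 * p),
      C (((2 * p).factorial : ℝ) / fac α * gE (monomial α (1 : ℝ))) * ∏ i, b i ^ α i) =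
      gE ((∑ i, C (eval u (b i)) * X i) ^ (2 * p)) := by
    rw [sum_pow_eq_sum_sexp, map_sum, map_sum]
    refine Finset.sum_congr rfl fun α _ => ?_
    simp only [mul_pow, Finset.prod_mul_distrib, ← map_pow C, ← map_prod C, map_smul, smul_eq_mul]
    have : (∏ i, (X i : MvPolynomial ι ℝ) ^ α i) = monomial α 1 := by
      rw [monomial_eq, Finsupp.prod_fintype _ _ (fun _ => pow_zero _)]; simp
    rw [gE_C_mul, map_mul, eval_C, this, map_prod]
    simp only [map_pow]
    ring
  rw [h2, gE_linear_pow, map_mul, eval_C, map_pow]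
  exact mul_le_mul_of_nonneg_left
    (pow_le_pow_left₀ (Finset.sum_nonneg fun i _ => sq_nonneg _) (h u) p) (dfac_nonneg p)

end SphericalMoments

section Biform

variable {ι κ : Type*} [Fintype ι] [Fintype κ]

lemma eval_sq_mul_le (a : ℕ) {p : MvPolynomial ι ℝ} (hp : p.IsHomogeneous a) (z : ι → ℝ) :
    a.factorial * eval z p ^ 2 ≤ (∑ i, z i ^ 2) ^ a * gE (p ^ 2) := by
  have h := eval_sq_le (S := sexp ι a) (p := p) (fun α hα => by
    by_contra h
    exact hα (mem_sexp.mpr (sum_eq_of_mem_support hp (mem_support_iff.mpr h)))) z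
  have e := sum_pow_eq_sum_sexp (fun i => z i ^ 2) a
  have e2 : (∑ i, z i ^ 2) ^ a = a.factorial * ∑ α ∈ sexp ι a, (∏ i, (z i ^ 2) ^ α i) / fac α := by
    rw [e, Finset.mul_sum]
    exact Finset.sum_congr rfl fun α _ => by rw [smul_eq_mul]; ring
  have h2 := apN_le_gE_sq a p hp
  rw [e2, mul_assoc]
  refine mul_le_mul_of_nonneg_left (h.trans ?_) (by positivity)
  rw [mul_comm]
  refine mul_le_mul_of_nonneg_left h2 ?_
  exact Finset.sum_nonneg fun α _ =>
    div_nonneg (Finset.prod_nonneg fun i _ => by positivity) (fac_pos α).le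

/-- `p` is homogeneous of degree `a` in the first and of degree `b` in the second block. -/
def IsBih (a b : ℕ) (p : MvPolynomial (ι ⊕ κ) ℝ) : Prop := ∀ α ∉ bexp ι κ a b, coeff α p = 0

lemma mem_biform_iff {n m a b : ℕ} {p : MvPolynomial (Fin n ⊕ Fin m) ℝ} :
    p ∈ Biform n m a b ↔ IsBih a b p := by
  have h : ∀ α : Fin n ⊕ Fin m →₀ ℕ, Finsupp.weight (bw n m) α =
      (∑ i, α (Sum.inl i), ∑ j, α (Sum.inr j)) := by
    intro α
    rw [Finsupp.weight_apply, Finsupp.sum_fintype _ _ (by simp), Fintype.sum_sum_type]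
    ext
    · simp [bw, Prod.fst_sum]
    · simp [bw, Prod.snd_sum]
  constructor
  · intro hp α hα
    by_contra h0
    have := hp h0
    rw [h, Prod.mk.injEq] at this
    exact hα (mem_bexp.mpr this)
  · intro hp α hα
    rw [h, Prod.mk.injEq, ← mem_bexp]
    by_contra h0
    exact hα (hp α h0)

lemma IsBih.add {a b : ℕ} {p q : MvPolynomial (ι ⊕ κ) ℝ} (hp : IsBih a b p) (hq : IsBih a b q) :
    IsBih a b (p + q) := fun α hα => by rw [coeff_add, hp α hα, hq α hα, add_zero]

lemma IsBih.smul {a b : ℕ} {p : MvPolynomial (ι ⊕ κ) ℝ} (hp : IsBih a b p) (c : ℝ) :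
    IsBih a b (c • p) := fun α hα => by rw [coeff_smul, hp α hα, smul_zero]

lemma IsBih.sum {a b : ℕ} {η : Type*} {s : Finset η} {p : η → MvPolynomial (ι ⊕ κ) ℝ}
    (hp : ∀ i ∈ s, IsBih a b (p i)) : IsBih a b (∑ i ∈ s, p i) := fun α hα => by
  rw [coeff_sum]
  exact Finset.sum_eq_zero fun i hi => hp i hi α hα

lemma IsBih.mul {a b a' b' : ℕ} {p q : MvPolynomial (ι ⊕ κ) ℝ} (hp : IsBih a b p)
    (hq : IsBih a' b' q) : IsBih (a + a') (b + b') (p * q) := fun α hα => by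
  classical
  rw [coeff_mul]
  refine Finset.sum_eq_zero fun βγ h => ?_
  by_contra h0
  have h1 : βγ.1 ∈ bexp ι κ a b := by
    by_contra h1; exact h0 (by rw [hp _ h1, zero_mul])
  have h2 : βγ.2 ∈ bexp ι κ a' b' := by
    by_contra h1; exact h0 (by rw [hq _ h1, mul_zero])
  rw [mem_bexp] at h1 h2
  rw [Finset.HasAntidiagonal.mem_antidiagonal] at h
  refine hα (mem_bexp.mpr ?_)
  rw [← h]
  simp [Finset.sum_add_distrib, h1, h2]

lemma isBih_one : IsBih 0 0 (1 : MvPolynomial (ι ⊕ κ) ℝ) := fun α hα => by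
  classical
  rw [coeff_one, if_neg]
  rintro rfl
  exact hα (mem_bexp.mpr (by simp))

lemma IsBih.pow {a b : ℕ} {p : MvPolynomial (ι ⊕ κ) ℝ} (hp : IsBih a b p) (k : ℕ) :
    IsBih (k * a) (k * b) (p ^ k) := by
  induction k with
  | zero => simpa using isBih_one
  | succ k ih => rw [pow_succ, add_mul, add_mul, one_mul, one_mul]; exact ih.mul hp

lemma isBih_X_inl (i : ι) : IsBih 1 0 (X (Sum.inl i) : MvPolynomial (ι ⊕ κ) ℝ) := fun α hα => by
  classical
  rw [coeff_X, if_neg]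
  rintro rfl
  exact hα (mem_bexp.mpr (by simp [Finsupp.single_apply]))

lemma isBih_X_inr (j : κ) : IsBih 0 1 (X (Sum.inr j) : MvPolynomial (ι ⊕ κ) ℝ) := fun α hα => by
  classical
  rw [coeff_X, if_neg]
  rintro rfl
  exact hα (mem_bexp.mpr (by simp [Finsupp.single_apply]))

lemma IsBih.isHomogeneous {a b : ℕ} {p : MvPolynomial (ι ⊕ κ) ℝ} (hp : IsBih a b p) :
    p.IsHomogeneous (a + b) := by
  intro α hα
  have : α ∈ bexp ι κ a b := by
    by_contra h; exact hα (hp α h)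
  rw [mem_bexp] at this
  rw [Finsupp.weight_apply, Finsupp.sum_fintype _ _ (by simp), Fintype.sum_sum_type]
  simp [this]

lemma IsBih.pderiv_inl {a b : ℕ} {p : MvPolynomial (ι ⊕ κ) ℝ} (hp : IsBih (a + 1) b p) (i : ι) :
    IsBih a b (pderiv (Sum.inl i) p) := fun α hα => by
  classical
  rw [coeff_pderiv, hp, zero_mul]
  intro h
  rw [mem_bexp] at h hα
  refine hα ⟨?_, ?_⟩
  · have := h.1
    simpa [Finsupp.single_apply, Finset.sum_add_distrib] using this
  · have := h.2
    simpa [Finsupp.single_apply, Finset.sum_add_distrib] using this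

lemma isBih_rsq_pow_mul (a b : ℕ) :
    IsBih (2 * a) (2 * b) (rsq (Sum.inl : ι → ι ⊕ κ) ^ a * rsq (Sum.inr : κ → ι ⊕ κ) ^ b) := by
  have h1 : IsBih 2 0 (rsq (Sum.inl : ι → ι ⊕ κ)) :=
    IsBih.sum fun i _ => by simpa using (isBih_X_inl i).pow 2
  have h2 : IsBih 0 2 (rsq (Sum.inr : κ → ι ⊕ κ)) :=
    IsBih.sum fun i _ => by simpa using (isBih_X_inr i).pow 2
  have := (h1.pow a).mul (h2.pow b)
  simpa [mul_comm] using this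

lemma eval_rsq_pow_mul (z : ι ⊕ κ → ℝ) (a b : ℕ) :
    eval z (rsq (Sum.inl : ι → ι ⊕ κ) ^ a * rsq (Sum.inr : κ → ι ⊕ κ) ^ b) =
      (∑ i, z (Sum.inl i) ^ 2) ^ a * (∑ j, z (Sum.inr j) ^ 2) ^ b := by
  rw [map_mul, map_pow, map_pow, eval_rsq, eval_rsq]

lemma rsq_pow_mul_eq_sum (a b : ℕ) :
    rsq (Sum.inl : ι → ι ⊕ κ) ^ a * rsq (Sum.inr : κ → ι ⊕ κ) ^ b =
      ∑ α ∈ bexp ι κ a b, mlt a b α • (monomial α (1 : ℝ)) ^ 2 := by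
  rw [rsq, rsq, sum_pow_mul_sum_pow (fun i => (X i : MvPolynomial (ι ⊕ κ) ℝ) ^ 2)]
  refine Finset.sum_congr rfl fun α _ => ?_
  rw [monomial_eq, Finsupp.prod_fintype _ _ (fun _ => pow_zero _), C_1, one_mul,
    ← Finset.prod_pow]
  simp only [← pow_mul, mul_comm]

/-- Pointwise bound by the apolar norm. -/
lemma IsBih.eval_sq_le {a b : ℕ} {p : MvPolynomial (ι ⊕ κ) ℝ} (hp : IsBih a b p)
    (z : ι ⊕ κ → ℝ) :
    a.factorial * b.factorial * eval z p ^ 2 ≤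
      apN p * ((∑ i, z (Sum.inl i) ^ 2) ^ a * (∑ j, z (Sum.inr j) ^ 2) ^ b) := by
  have h := BiformPaper.eval_sq_le hp z
  have e := sum_pow_mul_sum_pow (fun i => z i ^ 2) a b
  simp only [mlt, smul_eq_mul] at e
  rw [e]
  have e2 : ∑ α ∈ bexp ι κ a b, a.factorial * b.factorial / fac α * ∏ i, (z i ^ 2) ^ α i =
      (a.factorial * b.factorial : ℝ) * ∑ α ∈ bexp ι κ a b, (∏ i, (z i ^ 2) ^ α i) / fac α := by
    rw [Finset.mul_sum]
    exact Finset.sum_congr rfl fun α _ => by ring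
  rw [e2, mul_left_comm]
  exact mul_le_mul_of_nonneg_left h (by positivity)

lemma IsBih.eval_sq_le_gE {a b : ℕ} {p : MvPolynomial (ι ⊕ κ) ℝ} (hp : IsBih a b p)
    (z : ι ⊕ κ → ℝ) :
    a.factorial * b.factorial * eval z p ^ 2 ≤
      gE (p ^ 2) * ((∑ i, z (Sum.inl i) ^ 2) ^ a * (∑ j, z (Sum.inr j) ^ 2) ^ b) :=
  (hp.eval_sq_le z).trans (mul_le_mul_of_nonneg_right (apN_le_gE_sq _ p hp.isHomogeneous)
    (by positivity))

end Biform

section GramMatrix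

variable {ι κ : Type*} [Fintype ι] [Fintype κ]

lemma fac_mul_mlt (a b : ℕ) (α : ι ⊕ κ →₀ ℕ) :
    fac α * mlt a b α = a.factorial * b.factorial := by
  have := (fac_pos α).ne'
  rw [mlt]; field_simp

/-- The multinomial generating polynomial of bidegree `(a, b)`. -/
def mltP (ι κ : Type*) [Fintype ι] [Fintype κ] (a b : ℕ) : MvPolynomial (ι ⊕ κ) ℝ :=
  ∑ α ∈ bexp ι κ a b, monomial α (mlt a b α)

lemma mltP_eq (a b : ℕ) : mltP ι κ a b =
    (∑ i, X (Sum.inl i)) ^ a * (∑ j, X (Sum.inr j)) ^ b := by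
  rw [sum_pow_mul_sum_pow (fun i => (X i : MvPolynomial (ι ⊕ κ) ℝ)), mltP]
  refine Finset.sum_congr rfl fun α _ => ?_
  have : (∏ i, (X i : MvPolynomial (ι ⊕ κ) ℝ) ^ α i) = monomial α 1 := by
    rw [monomial_eq, Finsupp.prod_fintype _ _ (fun _ => pow_zero _)]; simp
  rw [this, smul_monomial, smul_eq_mul, mul_one]

lemma mltP_mul (a b a' b' : ℕ) :
    mltP ι κ a b * mltP ι κ a' b' = mltP ι κ (a + a') (b + b') := by
  simp only [mltP_eq]; ring

lemma coeff_mltP_of_mem {a b : ℕ} {α : ι ⊕ κ →₀ ℕ} (h : α ∈ bexp ι κ a b) :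
    coeff α (mltP ι κ a b) = mlt a b α := by
  classical
  rw [mltP, coeff_sum, Finset.sum_eq_single α]
  · simp
  · intro β _ hβ
    rw [coeff_monomial, if_neg hβ]
  · exact fun h' => absurd h h'

lemma coeff_mltP_nonneg (a b : ℕ) (α : ι ⊕ κ →₀ ℕ) : 0 ≤ coeff α (mltP ι κ a b) := by
  classical
  rw [mltP, coeff_sum]
  refine Finset.sum_nonneg fun β _ => ?_
  rw [coeff_monomial]
  split_ifs
  exacts [(mlt_pos _ _ _).le, le_rfl]

/-- The Bombieri norm is submultiplicative on squares. -/
lemma IsBih.apN_sq_le {a b : ℕ} {p : MvPolynomial (ι ⊕ κ) ℝ} (hp : IsBih a b p) :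
    apN (p ^ 2) ≤ ((2 * a).factorial * (2 * b).factorial : ℝ) *
      (apN p / (a.factorial * b.factorial)) ^ 2 := by
  classical
  set r : (ι ⊕ κ →₀ ℕ) → ℝ := fun β => coeff β p ^ 2 / mlt a b β with hr
  have hr0 : ∀ β, 0 ≤ r β := fun β => div_nonneg (sq_nonneg _) (mlt_pos _ _ _).le
  set R : MvPolynomial (ι ⊕ κ) ℝ := ∑ β ∈ bexp ι κ a b, monomial β (r β) with hR
  have hRc : ∀ β, coeff β R = r β := by
    intro β
    rw [hR, coeff_sum]
    simp only [coeff_monomial, Finset.sum_ite_eq']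
    split_ifs with h
    · rfl
    · rw [hr]; simp [hp β h]
  have hRb : IsBih a b R := fun β hβ => by rw [hRc]; simp [hr, hp β hβ]
  have hR1 : eval (fun _ => 1) R = apN p / (a.factorial * b.factorial) := by
    rw [hR, map_sum, apN_eq_sum hp, Finset.sum_div]
    refine Finset.sum_congr rfl fun β _ => ?_
    have := (fac_pos β).ne'
    rw [eval_monomial, hr]
    simp only [mlt, Finsupp.prod, one_pow, Finset.prod_const_one, mul_one]
    field_simp
  have hp2 : IsBih (2 * a) (2 * b) (p ^ 2) := hp.pow 2
  have hR2 : IsBih (2 * a) (2 * b) (R ^ 2) := hRb.pow 2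
  have hsum : eval (fun _ => 1) (R ^ 2) = ∑ α ∈ bexp ι κ (2 * a) (2 * b), coeff α (R ^ 2) := by
    rw [eval_eq']
    simp only [one_pow, Finset.prod_const_one, mul_one]
    refine Finset.sum_subset (fun α hα => ?_) (fun α _ hα => notMem_support_iff.mp hα)
    by_contra hn
    exact mem_support_iff.mp hα (hR2 α hn)
  rw [← hR1, ← map_pow, hsum, apN_eq_sum hp2, Finset.mul_sum]
  refine Finset.sum_le_sum fun α hα => ?_
  rw [← fac_mul_mlt (2 * a) (2 * b) α, mul_assoc]
  refine mul_le_mul_of_nonneg_left ?_ (fac_pos α).le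
  rw [← coeff_mltP_of_mem hα, two_mul, two_mul, ← mltP_mul, sq p, sq R, coeff_mul, coeff_mul,
    coeff_mul]
  refine Finset.sum_sq_le_sum_mul_sum_of_sq_le_mul _
    (fun x _ => mul_nonneg (coeff_mltP_nonneg _ _ _) (coeff_mltP_nonneg _ _ _))
    (fun x _ => by rw [hRc, hRc]; exact mul_nonneg (hr0 _) (hr0 _)) fun x _ => ?_
  rw [hRc, hRc]
  by_cases h1 : x.1 ∈ bexp ι κ a b
  · by_cases h2 : x.2 ∈ bexp ι κ a b
    · rw [coeff_mltP_of_mem h1, coeff_mltP_of_mem h2, hr]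
      have h3 := (mlt_pos a b x.1).ne'
      have h4 := (mlt_pos a b x.2).ne'
      refine le_of_eq ?_
      field_simp
    · rw [hp _ h2, mul_zero, zero_pow two_ne_zero]
      exact mul_nonneg (mul_nonneg (coeff_mltP_nonneg _ _ _) (coeff_mltP_nonneg _ _ _))
        (mul_nonneg (hr0 _) (hr0 _))
  · rw [hp _ h1, zero_mul, zero_pow two_ne_zero]
    exact mul_nonneg (mul_nonneg (coeff_mltP_nonneg _ _ _) (coeff_mltP_nonneg _ _ _))
      (mul_nonneg (hr0 _) (hr0 _))

lemma apI_monomial (f : MvPolynomial ι ℝ) (α : ι →₀ ℕ) (c : ℝ) :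
    apI f (monomial α c) = fac α * coeff α f * c := by
  classical
  rw [apI_comm, apI_eq_sum (S := {α})]
  · simp; ring
  · intro β hβ
    rw [coeff_monomial, if_neg]
    exact fun h => hβ (by simp [h])

/-- The index type of monomials of bidegree `(a, b)`. -/
abbrev BIdx (ι κ : Type*) [Fintype ι] [Fintype κ] (a b : ℕ) : Type _ :=
  {α : ι ⊕ κ →₀ ℕ // α ∈ bexp ι κ a b}

/-- The normalized monomials. -/
def bmon {a b : ℕ} (β : BIdx ι κ a b) : MvPolynomial (ι ⊕ κ) ℝ :=
  monomial β.1 (√(mlt a b β.1))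

lemma isBih_monomial {a b : ℕ} (β : BIdx ι κ a b) (c : ℝ) : IsBih a b (monomial β.1 c) := by
  classical
  intro α hα
  rw [coeff_monomial, if_neg]
  rintro rfl
  exact hα β.2

/-- The biform with normalized coordinates `u`. -/
def bform {a b : ℕ} (u : BIdx ι κ a b → ℝ) : MvPolynomial (ι ⊕ κ) ℝ := ∑ β, u β • bmon β

lemma isBih_bform {a b : ℕ} (u : BIdx ι κ a b → ℝ) : IsBih a b (bform u) :=
  IsBih.sum fun β _ => (isBih_monomial β _).smul _

lemma coeff_bform {a b : ℕ} (u : BIdx ι κ a b → ℝ) (β : BIdx ι κ a b) :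
    coeff β.1 (bform u) = u β * √(mlt a b β.1) := by
  classical
  rw [bform, coeff_sum, Finset.sum_eq_single β]
  · simp [bmon]
  · intro γ _ h
    rw [coeff_smul, bmon, coeff_monomial, if_neg fun h' => h (Subtype.ext h'), smul_zero]
  · simp

lemma apN_bform {a b : ℕ} (u : BIdx ι κ a b → ℝ) :
    apN (bform u) = a.factorial * b.factorial * ∑ β, u β ^ 2 := by
  rw [apN_eq_sum (isBih_bform u), ← Finset.sum_coe_sort, Finset.mul_sum]
  refine Finset.sum_congr rfl fun β _ => ?_
  rw [coeff_bform, mul_pow, Real.sq_sqrt (mlt_pos _ _ _).le, ← fac_mul_mlt a b β.1]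
  ring

lemma IsBih.exists_bform {a b : ℕ} {p : MvPolynomial (ι ⊕ κ) ℝ} (hp : IsBih a b p) :
    ∃ u : BIdx ι κ a b → ℝ, p = bform u := by
  refine ⟨fun β => coeff β.1 p / √(mlt a b β.1), ?_⟩
  ext α
  by_cases h : α ∈ bexp ι κ a b
  · have := coeff_bform (fun β : BIdx ι κ a b => coeff β.1 p / √(mlt a b β.1)) ⟨α, h⟩
    simp only at this
    rw [this, div_mul_cancel₀ _ (Real.sqrt_ne_zero'.mpr (mlt_pos _ _ _))]
  · rw [hp α h, isBih_bform _ α h]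

/-- The Gram matrix of a biform of bidegree `(2a, 2b)`. -/
def gramM (a b : ℕ) (f : MvPolynomial (ι ⊕ κ) ℝ) : Matrix (BIdx ι κ a b) (BIdx ι κ a b) ℝ :=
  Matrix.of fun β γ => √(mlt a b β.1) * √(mlt a b γ.1) *
    (fac (β.1 + γ.1) * coeff (β.1 + γ.1) f / ((2 * a).factorial * (2 * b).factorial))

lemma sum_gramM (a b : ℕ) (f : MvPolynomial (ι ⊕ κ) ℝ) (u : BIdx ι κ a b → ℝ) :
    ∑ β, ∑ γ, gramM a b f β γ * u β * u γ =
      apI f (bform u ^ 2) / ((2 * a).factorial * (2 * b).factorial) := by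
  rw [bform, sq, Finset.sum_mul_sum, map_sum, Finset.sum_div]
  refine Finset.sum_congr rfl fun β _ => ?_
  rw [map_sum, Finset.sum_div]
  refine Finset.sum_congr rfl fun γ _ => ?_
  rw [smul_mul_smul_comm, map_smul, bmon, bmon, monomial_mul, apI_monomial, gramM, Matrix.of_apply,
    smul_eq_mul]
  ring

lemma IsBih.eq_sum_gramM {a b : ℕ} {f : MvPolynomial (ι ⊕ κ) ℝ} (hf : IsBih (2 * a) (2 * b) f) :
    f = ∑ β : BIdx ι κ a b, ∑ γ : BIdx ι κ a b, gramM a b f β γ • (bmon β * bmon γ) := by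
  set T : MvPolynomial (ι ⊕ κ) ℝ →ₗ[ℝ] MvPolynomial (ι ⊕ κ) ℝ :=
    (basisMonomials (ι ⊕ κ) ℝ).constr ℝ fun α =>
      monomial α (fac α * coeff α f / ((2 * a).factorial * (2 * b).factorial)) with hT
  have hTm : ∀ α c, T (monomial α c) =
      monomial α (c * (fac α * coeff α f / ((2 * a).factorial * (2 * b).factorial))) := by
    intro α c
    have h1 : monomial α c = c • (basisMonomials (ι ⊕ κ) ℝ α) := by
      rw [coe_basisMonomials, smul_monomial, smul_eq_mul, mul_one]
    rw [h1, map_smul, hT, Module.Basis.constr_basis, smul_monomial, smul_eq_mul]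
  have h1 : T (mltP ι κ (2 * a) (2 * b)) = f := by
    classical
    rw [mltP, map_sum]
    ext α
    rw [coeff_sum]
    simp only [hTm, coeff_monomial, Finset.sum_ite_eq']
    split_ifs with h
    · have h1 := fac_mul_mlt (2 * a) (2 * b) α
      have h2 : ((2 * a).factorial * (2 * b).factorial : ℝ) ≠ 0 := by positivity
      rw [← h1] at h2 ⊢
      rw [mul_div_assoc', div_eq_iff h2]
      ring
    · exact (hf α h).symm
  have h2 : T (mltP ι κ a b * mltP ι κ a b) =
      ∑ β : BIdx ι κ a b, ∑ γ : BIdx ι κ a b, gramM a b f β γ • (bmon β * bmon γ) := by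
    rw [mltP, Finset.sum_mul_sum, map_sum, ← Finset.sum_coe_sort]
    refine Finset.sum_congr rfl fun β _ => ?_
    rw [map_sum, ← Finset.sum_coe_sort]
    refine Finset.sum_congr rfl fun γ _ => ?_
    rw [monomial_mul, hTm, bmon, bmon, monomial_mul, smul_monomial, smul_eq_mul, gramM,
      Matrix.of_apply]
    congr 1
    have e1 := Real.mul_self_sqrt (mlt_pos a b β.1).le
    have e2 := Real.mul_self_sqrt (mlt_pos a b γ.1).le
    nth_rewrite 1 [← e1, ← e2]
    ring
  rw [← h2, mltP_mul, ← two_mul, ← two_mul, h1]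

open scoped MatrixOrder ComplexOrder Matrix.Norms.L2Operator in
lemma _root_.Matrix.PosSemidef.exists_conjTranspose_mul_self {η : Type*} [Fintype η] [DecidableEq η]
    {A : Matrix η η ℝ} (hA : A.PosSemidef) : ∃ B : Matrix η η ℝ, A = B.conjTranspose * B :=
  CStarAlgebra.nonneg_iff_eq_star_mul_self.mp hA.nonneg

lemma sum_sq_eq_sum_conjTranspose_mul_self {η R : Type*} [Fintype η] [CommRing R] [Algebra ℝ R]
    (B : Matrix η η ℝ) (v : η → R) :
    ∑ r, (∑ β, B r β • v β) ^ 2 = ∑ β, ∑ γ, (B.conjTranspose * B) β γ • (v β * v γ) := by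
  have h : ∀ r, (∑ β, B r β • v β) ^ 2 = ∑ β, ∑ γ, (B r β * B r γ) • (v β * v γ) := by
    intro r
    rw [sq, Finset.sum_mul_sum]
    simp only [smul_mul_smul_comm]
  simp only [h, Matrix.mul_apply, Matrix.conjTranspose_apply, star_trivial, Finset.sum_smul]
  rw [Finset.sum_comm]
  exact Finset.sum_congr rfl fun β _ => Finset.sum_comm

/-- If the Gram form of `f` dominates `-|u|²` then `f + q` is a sum of squares. -/
lemma IsBih.exists_sum_sq {a b : ℕ} {f : MvPolynomial (ι ⊕ κ) ℝ} (hf : IsBih (2 * a) (2 * b) f)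
    (h : ∀ u : BIdx ι κ a b → ℝ,
      0 ≤ apI f (bform u ^ 2) / ((2 * a).factorial * (2 * b).factorial) + ∑ β, u β ^ 2) :
    ∃ (N : ℕ) (g : Fin N → MvPolynomial (ι ⊕ κ) ℝ), (∀ i, IsBih a b (g i)) ∧
      f + rsq Sum.inl ^ a * rsq Sum.inr ^ b = ∑ i, g i ^ 2 := by
  classical
  have hpsd : (gramM a b f + 1).PosSemidef := by
    refine Matrix.PosSemidef.of_dotProduct_mulVec_nonneg ?_ fun u => ?_
    · ext β γ
      simp only [gramM, Matrix.conjTranspose_apply, Matrix.add_apply, Matrix.of_apply, star_trivial,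
        Matrix.one_apply, add_comm γ.1 β.1, eq_comm (a := γ)]
      ring
    · have e : star u ⬝ᵥ (gramM a b f + 1).mulVec u =
          ∑ β, ∑ γ, gramM a b f β γ * u β * u γ + ∑ β, u β ^ 2 := by
        rw [star_trivial, Matrix.add_mulVec, dotProduct_add, Matrix.one_mulVec]
        congr 1
        · simp only [dotProduct, Matrix.mulVec, Finset.mul_sum]
          exact Finset.sum_congr rfl fun β _ => Finset.sum_congr rfl fun γ _ => by ring
        · exact Finset.sum_congr rfl fun β _ => by ring
      rw [e, sum_gramM]
      exact h u
  obtain ⟨B, hB⟩ := hpsd.exists_conjTranspose_mul_self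
  let eqv := (Fintype.equivFin (BIdx ι κ a b)).symm
  refine ⟨Fintype.card (BIdx ι κ a b), fun i => ∑ β, B (eqv i) β • bmon β, fun i =>
    IsBih.sum fun β _ => (isBih_monomial β _).smul _, ?_⟩
  have e1 : ∑ i, (∑ β, B (eqv i) β • (bmon β : MvPolynomial (ι ⊕ κ) ℝ)) ^ 2 =
      ∑ r, (∑ β, B r β • (bmon β : MvPolynomial (ι ⊕ κ) ℝ)) ^ 2 :=
    Equiv.sum_comp eqv fun r => (∑ β, B r β • (bmon β : MvPolynomial (ι ⊕ κ) ℝ)) ^ 2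
  have e2 := sum_sq_eq_sum_conjTranspose_mul_self B
    (fun β => (bmon β : MvPolynomial (ι ⊕ κ) ℝ))
  rw [← hB] at e2
  have e3 : ∑ β, ∑ γ, (1 : Matrix (BIdx ι κ a b) (BIdx ι κ a b) ℝ) β γ • (bmon β * bmon γ) =
      rsq Sum.inl ^ a * rsq Sum.inr ^ b := by
    rw [rsq_pow_mul_eq_sum, ← Finset.sum_coe_sort (bexp ι κ a b)]
    refine Finset.sum_congr rfl fun β _ => ?_
    rw [Finset.sum_eq_single β]
    · rw [Matrix.one_apply_eq, one_smul, bmon, ← sq, monomial_pow, monomial_pow, smul_monomial,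
        Real.sq_sqrt (mlt_pos _ _ _).le]
      simp
    · intro γ _ hγ
      rw [Matrix.one_apply_ne (Ne.symm hγ), zero_smul]
    · simp
  rw [e1, e2]
  simp only [Matrix.add_apply, add_smul, Finset.sum_add_distrib]
  rw [e3, ← hf.eq_sum_gramM]

end GramMatrix

section ApolarParametrization

lemma sum_sq_le_of_forall {η : Type*} [Fintype η] {v : η → ℝ} {c : ℝ} (hc : 0 ≤ c)
    (h : ∀ z : η → ℝ, (∑ i, z i * v i) ^ 2 ≤ c * ∑ i, z i ^ 2) : ∑ i, v i ^ 2 ≤ c := by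
  have h1 := h v
  simp only [← sq] at h1
  set S := ∑ i, v i ^ 2
  have hS : 0 ≤ S := Finset.sum_nonneg fun i _ => sq_nonneg _
  rcases hS.eq_or_lt with h0 | h0
  · rwa [← h0]
  · rw [sq] at h1
    exact le_of_mul_le_mul_right h1 h0

lemma map_eq_sum_single {D : ℕ} {E : Type*} [AddCommGroup E] [Module ℝ E]
    (φ : (Fin D → ℝ) →ₗ[ℝ] E) (z : Fin D → ℝ) : φ z = ∑ i, z i • φ (Pi.single i 1) := by
  conv_lhs => rw [pi_eq_sum_univ' z]
  rw [map_sum]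
  exact Finset.sum_congr rfl fun i _ => by
    rw [map_smul]

/-- Orthonormal coordinates for the apolar norm. -/
lemma exists_apolar_param {ι : Type*} [Fintype ι] {D : ℕ}
    (ψ : (Fin D → ℝ) →ₗ[ℝ] MvPolynomial ι ℝ) (hψ : Function.Injective ψ) {K : ℝ} (hK : 0 < K) :
    ∃ L : (Fin D → ℝ) →ₗ[ℝ] (Fin D → ℝ), LinearMap.det L ≠ 0 ∧
      ∀ a, apN (ψ (L a)) = K * ∑ i, a i ^ 2 := by
  set A : Matrix (Fin D) (Fin D) ℝ :=
    Matrix.of fun i j => apI (ψ (Pi.single i 1)) (ψ (Pi.single j 1)) / K with hA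
  have hq : ∀ a : Fin D → ℝ, apN (ψ a) = K * (a ⬝ᵥ A.mulVec a) := by
    intro a
    have hsum : apN (ψ a) =
        ∑ i, ∑ j, a i * (a j * apI (ψ (Pi.single i 1)) (ψ (Pi.single j 1))) := by
      rw [apN, map_eq_sum_single ψ a, map_sum apI, LinearMap.sum_apply]
      refine Finset.sum_congr rfl fun i _ => ?_
      rw [map_sum]
      refine Finset.sum_congr rfl fun j _ => ?_
      rw [map_smul, map_smul, LinearMap.smul_apply, smul_eq_mul, smul_eq_mul]
      ring
    rw [hsum, dotProduct, Finset.mul_sum]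
    refine Finset.sum_congr rfl fun i _ => ?_
    rw [Matrix.mulVec, dotProduct, Finset.mul_sum, Finset.mul_sum]
    refine Finset.sum_congr rfl fun j _ => ?_
    rw [hA, Matrix.of_apply]
    field_simp
  have hpsd : A.PosSemidef := by
    refine Matrix.PosSemidef.of_dotProduct_mulVec_nonneg ?_ fun u => ?_
    · ext i j
      simp only [hA, Matrix.conjTranspose_apply, Matrix.of_apply, star_trivial]
      rw [apI_comm]
    · have := apN_nonneg (ψ u)
      rw [hq] at this
      rw [star_trivial]
      exact nonneg_of_mul_nonneg_right this hK
  obtain ⟨B, hB⟩ := hpsd.exists_conjTranspose_mul_self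
  have hBq : ∀ a : Fin D → ℝ, apN (ψ a) = K * ∑ i, (B.mulVec a) i ^ 2 := by
    intro a
    rw [hq, hB, ← Matrix.mulVec_mulVec, Matrix.dotProduct_mulVec,
      Matrix.conjTranspose_eq_transpose_of_trivial, Matrix.vecMul_transpose, dotProduct]
    simp only [sq]
  have hdet : B.det ≠ 0 := by
    intro h0
    obtain ⟨v, hv, hv0⟩ := Matrix.exists_mulVec_eq_zero_iff.mpr h0
    refine hv (hψ ?_)
    rw [map_zero]
    apply eq_zero_of_apN_eq_zero
    rw [hBq, hv0]
    simp
  refine ⟨Matrix.toLin' B⁻¹, ?_, fun a => ?_⟩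
  · rw [LinearMap.det_toLin', Matrix.det_nonsing_inv, Ring.inverse_eq_inv']
    exact inv_ne_zero hdet
  · rw [hBq, Matrix.toLin'_apply, Matrix.mulVec_mulVec,
      Matrix.mul_nonsing_inv _ (isUnit_iff_ne_zero.mpr hdet), Matrix.one_mulVec]

open scoped Pointwise in
/-- Lower bound for a volume from a Gaussian moment bound. -/
lemma volume_ge_of_gE_le {D : ℕ} {P : MvPolynomial (Fin D) ℝ} (hP : ∀ z, 0 ≤ eval z P) {M : ℝ}
    (hM : 0 < M) (hPM : gE P ≤ M) {t : ℝ} (ht : 0 < t) {A : Set (Fin D → ℝ)}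
    (hA : ∀ z, eval z P ≤ 2 * M → t⁻¹ • z ∈ A) :
    ENNReal.ofReal (1 / 2 * (√(2 * Real.pi) / t) ^ D) ≤ volume A := by
  set S : Set (Fin D → ℝ) := {z | eval z P ≤ 2 * M} with hS
  have hmeas : Measurable fun z : Fin D → ℝ => eval z P := (continuous_eval P).measurable
  have hSm : MeasurableSet S := measurableSet_le hmeas measurable_const
  have h1 : (gam (Fin D)).real Sᶜ ≤ 1 / 2 := by
    have hmk := mul_meas_ge_le_integral_of_nonneg (μ := gam (Fin D))
      (Filter.Eventually.of_forall hP) (integrable_eval P) (2 * M)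
    have hsub : Sᶜ ⊆ {z | 2 * M ≤ eval z P} := fun z hz =>
      (not_le.mp (show ¬ (eval z P ≤ 2 * M) from hz)).le
    have h2 : (gam (Fin D)).real Sᶜ ≤ (gam (Fin D)).real {z | 2 * M ≤ eval z P} :=
      measureReal_mono hsub
    have h3 : 2 * M * (gam (Fin D)).real {z | 2 * M ≤ eval z P} ≤ M := hmk.trans hPM
    nlinarith
  have h2 : (1 / 2 : ℝ) ≤ (gam (Fin D)).real S := by
    have := probReal_compl_eq_one_sub (μ := gam (Fin D)) hSm
    linarith
  have h3 : S ⊆ t • A := fun z hz => by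
    rw [Set.mem_smul_set_iff_inv_smul_mem₀ ht.ne']
    exact hA z hz
  have h4 : volume (t • A) = ENNReal.ofReal (t ^ D) * volume A := by
    rw [Measure.addHaar_smul]
    simp [abs_of_pos ht]
  have h5 : ENNReal.ofReal (1 / 2) ≤ gam (Fin D) S := by
    rw [ENNReal.ofReal_le_iff_le_toReal (measure_ne_top _ _)]
    exact h2
  have h6 := (h5.trans (gam_le_volume S)).trans (mul_le_mul_right (measure_mono h3) _)
  rw [h4, ← mul_assoc, ← ENNReal.ofReal_mul (by positivity)] at h6
  have hc : 0 < (√(2 * Real.pi) / t) ^ D := by positivity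
  have h7 := mul_le_mul_right h6 (ENNReal.ofReal ((√(2 * Real.pi) / t) ^ D))
  rw [← mul_assoc, ← ENNReal.ofReal_mul hc.le, ← ENNReal.ofReal_mul hc.le] at h7
  have e : (√(2 * Real.pi) / t) ^ D * ((√(2 * Real.pi))⁻¹ ^ Fintype.card (Fin D) * t ^ D) = 1 := by
    rw [Fintype.card_fin, ← mul_pow, ← mul_pow]
    have : √(2 * Real.pi) ≠ 0 := by positivity
    field_simp
    simp
  rw [e, ENNReal.ofReal_one, one_mul, mul_comm] at h7
  exact h7

variable {ι κ : Type*} [Fintype ι] [Fintype κ]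

/-- The Gram form of a biform, as a quadratic polynomial. -/
def gramP (a b : ℕ) (f : MvPolynomial (ι ⊕ κ) ℝ) : MvPolynomial (BIdx ι κ a b) ℝ :=
  ∑ β, ∑ γ, C (gramM a b f β γ) * (X β * X γ)

lemma eval_gramP (a b : ℕ) (f : MvPolynomial (ι ⊕ κ) ℝ) (u : BIdx ι κ a b → ℝ) :
    eval u (gramP a b f) = apI f (bform u ^ 2) / ((2 * a).factorial * (2 * b).factorial) := by
  rw [← sum_gramM, gramP]
  simp [mul_assoc]

lemma gramP_isHomogeneous (a b : ℕ) (f : MvPolynomial (ι ⊕ κ) ℝ) :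
    (gramP a b f).IsHomogeneous 2 := by
  refine IsHomogeneous.sum _ _ _ fun β _ => IsHomogeneous.sum _ _ _ fun γ _ => ?_
  simpa using (isHomogeneous_C _ (gramM a b f β γ)).mul
    ((isHomogeneous_X ℝ β).mul (isHomogeneous_X ℝ γ))

lemma eval_gramP_sq_le (a b : ℕ) (f : MvPolynomial (ι ⊕ κ) ℝ) (u : BIdx ι κ a b → ℝ) :
    eval u (gramP a b f) ^ 2 ≤
      apN f / ((2 * a).factorial * (2 * b).factorial) * (∑ β, u β ^ 2) ^ 2 := by
  have h1 := apI_sq_le f (bform u ^ 2)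
  have h2 := (isBih_bform u).apN_sq_le
  have hk : (0 : ℝ) < a.factorial * b.factorial := by positivity
  have hK : (0 : ℝ) < (2 * a).factorial * (2 * b).factorial := by positivity
  rw [apN_bform, mul_div_cancel_left₀ _ hk.ne'] at h2
  rw [eval_gramP, div_pow, div_le_iff₀ (by positivity)]
  refine (h1.trans (mul_le_mul_of_nonneg_left h2 (apN_nonneg f))).trans (le_of_eq ?_)
  field_simp

lemma gramP_eq_sum {D : ℕ} (a b : ℕ) (φ : (Fin D → ℝ) →ₗ[ℝ] MvPolynomial (ι ⊕ κ) ℝ)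
    (z : Fin D → ℝ) :
    gramP a b (φ z) = ∑ i, C (z i) * gramP a b (φ (Pi.single i 1)) := by
  apply MvPolynomial.funext
  intro u
  rw [map_sum, eval_gramP, map_eq_sum_single φ z, map_sum, LinearMap.sum_apply, Finset.sum_div]
  refine Finset.sum_congr rfl fun i _ => ?_
  rw [map_mul, eval_C, eval_gramP, map_smul, LinearMap.smul_apply, smul_eq_mul, mul_div_assoc]

/-- Apolar coordinates on a space of biforms. -/
structure IsApolarParam {D : ℕ} (a b : ℕ)
    (φ : (Fin D → ℝ) →ₗ[ℝ] MvPolynomial (ι ⊕ κ) ℝ) : Prop where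
  bih : ∀ z, IsBih (2 * a) (2 * b) (φ z)
  norm : ∀ z, apN (φ z) = (2 * a).factorial * (2 * b).factorial * ∑ i, z i ^ 2
  mean : ∀ z, gE (φ z) = 0

variable {D : ℕ} {a b : ℕ} {φ : (Fin D → ℝ) →ₗ[ℝ] MvPolynomial (ι ⊕ κ) ℝ}

lemma IsApolarParam.sum_gramP_sq_le (hφ : IsApolarParam a b φ) (u : BIdx ι κ a b → ℝ) :
    ∑ i, eval u (gramP a b (φ (Pi.single i 1))) ^ 2 ≤
      eval u (rsq (id : BIdx ι κ a b → BIdx ι κ a b) ^ 2) := by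
  rw [map_pow, eval_rsq]
  refine sum_sq_le_of_forall (by positivity) fun z => ?_
  have h := eval_gramP_sq_le a b (φ z) u
  rw [hφ.norm, mul_div_cancel_left₀ _ (by positivity), gramP_eq_sum, map_sum] at h
  simp only [map_mul, eval_C] at h
  rw [mul_comm]
  exact h

/-- The moment polynomial of the Gram form. -/
def gramMom (a b : ℕ) (φ : (Fin D → ℝ) →ₗ[ℝ] MvPolynomial (ι ⊕ κ) ℝ) (p : ℕ) :
    MvPolynomial (Fin D) ℝ :=
  momP (fun i => gramP a b (φ (Pi.single i 1))) (2 * p)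

lemma IsApolarParam.gE_gramMom_le (hφ : IsApolarParam a b φ) (p : ℕ) :
    gE (gramMom a b φ p) ≤ dfac p * Gm (bexp ι κ a b).card (2 * p) := by
  have h := gE_momP_le (fun i => gramP a b (φ (Pi.single i 1))) p _ hφ.sum_gramP_sq_le
  rwa [← pow_mul, gE_rsq_pow, Fintype.card_coe] at h

lemma eval_gramMom (p : ℕ) (z : Fin D → ℝ) :
    eval z (gramMom a b φ p) = gE (gramP a b (φ z) ^ (2 * p)) := by
  rw [gramMom, eval_momP, ← gramP_eq_sum]

lemma eval_gramMom_nonneg (p : ℕ) (z : Fin D → ℝ) : 0 ≤ eval z (gramMom a b φ p) := by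
  rw [eval_gramMom, mul_comm 2, pow_mul]
  exact gE_sq_nonneg _

lemma eval_gramP_pow_le (p : ℕ) (z : Fin D → ℝ) (u : BIdx ι κ a b → ℝ) :
    (2 * p).factorial * eval u (gramP a b (φ z)) ^ (2 * p) ≤
      (∑ β, u β ^ 2) ^ (2 * p) * eval z (gramMom a b φ p) := by
  have h := eval_sq_mul_le (2 * p) ((gramP_isHomogeneous a b (φ z)).pow p) u
  rwa [map_pow, ← pow_mul, ← pow_mul, mul_comm p 2, ← eval_gramMom] at h

lemma IsApolarParam.volume_sq_ge (hφ : IsApolarParam a b φ) {p : ℕ} (hp : 0 < p) {t : ℝ}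
    (ht : 0 < t) (hd : 0 < (bexp ι κ a b).card)
    (h : 2 * (dfac p * Gm (bexp ι κ a b).card (2 * p)) ≤ (2 * p).factorial * t ^ (2 * p)) :
    ENNReal.ofReal (1 / 2 * (√(2 * Real.pi) / t) ^ D) ≤
      volume {z | ∃ (N : ℕ) (g : Fin N → MvPolynomial (ι ⊕ κ) ℝ), (∀ i, IsBih a b (g i)) ∧
        φ z + rsq Sum.inl ^ a * rsq Sum.inr ^ b = ∑ i, g i ^ 2} := by
  refine volume_ge_of_gE_le (eval_gramMom_nonneg (a := a) (b := b) (φ := φ) p)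
    (mul_pos (Finset.prod_pos fun i _ => by positivity) (Gm_pos hd _)) (hφ.gE_gramMom_le p) ht
    fun z hz => ?_
  refine (hφ.bih _).exists_sum_sq fun u => ?_
  rw [← eval_gramP]
  have h1 := eval_gramP_pow_le (φ := φ) p z u
  have h2 : (2 * p).factorial * eval u (gramP a b (φ z)) ^ (2 * p) ≤
      (2 * p).factorial * (t * ∑ β, u β ^ 2) ^ (2 * p) := by
    refine h1.trans ((mul_le_mul_of_nonneg_left (hz.trans h) (by positivity)).trans (le_of_eq ?_))
    rw [mul_pow]; ring
  have h3 := le_of_mul_le_mul_left h2 (by positivity)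
  have h4 : |eval u (gramP a b (φ z))| ≤ t * ∑ β, u β ^ 2 := by
    refine le_of_pow_le_pow_left₀ (n := 2 * p) (by omega) (by positivity) ?_
    rwa [(even_two_mul p).pow_abs]
  have h5 : eval u (gramP a b (φ (t⁻¹ • z))) = t⁻¹ * eval u (gramP a b (φ z)) := by
    rw [eval_gramP, eval_gramP, map_smul, map_smul, LinearMap.smul_apply, smul_eq_mul,
      mul_div_assoc]
  rw [h5]
  have h6 := neg_le_of_abs_le h4
  have h7 := mul_le_mul_of_nonneg_left h6 (inv_pos.mpr ht).le
  rw [mul_neg, inv_mul_cancel_left₀ ht.ne'] at h7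
  linarith

lemma IsApolarParam.volume_pos_ge (hφ : IsApolarParam a b φ) {p : ℕ} (hp : 0 < p) {t : ℝ}
    (ht : 0 < t) (hn : 0 < Fintype.card ι) (hm : 0 < Fintype.card κ)
    (h : 2 * (dfac p * (Gm (Fintype.card ι) (p * (2 * a)) * Gm (Fintype.card κ) (p * (2 * b)))) ≤
      ((p * (2 * a)).factorial * (p * (2 * b)).factorial) * t ^ (2 * p)) :
    ENNReal.ofReal (1 / 2 * (√(2 * Real.pi) / t) ^ D) ≤
      volume {z | ∀ w, 0 ≤ eval w (φ z + rsq Sum.inl ^ a * rsq Sum.inr ^ b)} := by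
  set e : Fin D → MvPolynomial (ι ⊕ κ) ℝ := fun i => φ (Pi.single i 1) with he
  have hφz : ∀ z, φ z = ∑ i, C (z i) * e i := by
    intro z
    rw [map_eq_sum_single φ z]
    exact Finset.sum_congr rfl fun i _ => by rw [C_mul']
  have hev : ∀ z, eval z (momP e (2 * p)) = gE (φ z ^ (2 * p)) := by
    intro z; rw [eval_momP, ← hφz]
  have hW : ∀ w, ∑ i, eval w (e i) ^ 2 ≤
      eval w (rsq Sum.inl ^ (2 * a) * rsq Sum.inr ^ (2 * b)) := by
    intro w
    rw [eval_rsq_pow_mul]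
    refine sum_sq_le_of_forall (by positivity) fun z => ?_
    have h := (hφ.bih z).eval_sq_le w
    rw [hφ.norm, mul_assoc ((2 * a).factorial * (2 * b).factorial : ℝ)] at h
    have h' := le_of_mul_le_mul_left h (by positivity)
    rw [hφz, map_sum] at h'
    simp only [map_mul, eval_C] at h'
    rw [mul_comm]
    exact h'
  have hE := gE_momP_le e p _ hW
  rw [mul_pow, ← pow_mul, ← pow_mul, gE_rsq_pow_mul_rsq_pow, mul_comm (2 * a) p,
    mul_comm (2 * b) p] at hE
  refine volume_ge_of_gE_le (P := momP e (2 * p)) (fun z => ?_)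
    (mul_pos (Finset.prod_pos fun i _ => by positivity) (mul_pos (Gm_pos hn _) (Gm_pos hm _)))
    hE ht fun z hz w => ?_
  · rw [hev, mul_comm 2, pow_mul]
    exact gE_sq_nonneg _
  · have h1 := ((hφ.bih z).pow p).eval_sq_le_gE w
    rw [← pow_mul, mul_comm p 2, ← hev, map_pow, ← pow_mul, mul_comm p 2] at h1
    set x2 := ∑ i, w (Sum.inl i) ^ 2
    set y2 := ∑ i, w (Sum.inr i) ^ 2
    have hx2 : 0 ≤ x2 := Finset.sum_nonneg fun i _ => sq_nonneg _
    have hy2 : 0 ≤ y2 := Finset.sum_nonneg fun i _ => sq_nonneg _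
    have h2 : ((p * (2 * a)).factorial * (p * (2 * b)).factorial : ℝ) * eval w (φ z) ^ (2 * p) ≤
        ((p * (2 * a)).factorial * (p * (2 * b)).factorial : ℝ) *
          (t * (x2 ^ a * y2 ^ b)) ^ (2 * p) := by
      refine h1.trans ((mul_le_mul_of_nonneg_right (hz.trans h) (by positivity)).trans
        (le_of_eq ?_))
      rw [mul_pow t, mul_pow, ← pow_mul, ← pow_mul, mul_assoc]
      ring_nf
    have h3 := le_of_mul_le_mul_left h2 (by positivity)
    have h4 : |eval w (φ z)| ≤ t * (x2 ^ a * y2 ^ b) := by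
      refine le_of_pow_le_pow_left₀ (n := 2 * p) (by omega) (by positivity) ?_
      rwa [(even_two_mul p).pow_abs]
    rw [map_add, eval_rsq_pow_mul, map_smul, smul_eval]
    have h6 := neg_le_of_abs_le h4
    have h7 := mul_le_mul_of_nonneg_left h6 (inv_pos.mpr ht).le
    rw [mul_neg, inv_mul_cancel_left₀ ht.ne'] at h7
    linarith

end ApolarParametrization

section SumsOfSquaresVolume

variable {ι κ : Type*} [Fintype ι] [Fintype κ] {D : ℕ} {a b : ℕ}
  {φ : (Fin D → ℝ) →ₗ[ℝ] MvPolynomial (ι ⊕ κ) ℝ}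

lemma IsApolarParam.apI_eq (hφ : IsApolarParam a b φ) (x z : Fin D → ℝ) :
    apI (φ x) (φ z) = (2 * a).factorial * (2 * b).factorial * ∑ i, x i * z i := by
  have h1 := hφ.norm (x + z)
  have h2 := hφ.norm x
  have h3 := hφ.norm z
  have h4 : apN (φ (x + z)) = apN (φ x) + 2 * apI (φ x) (φ z) + apN (φ z) := by
    rw [apN, map_add, map_add, map_add, LinearMap.add_apply, LinearMap.add_apply,
      apI_comm (φ z) (φ x), apN, apN]
    ring
  have h5 : ∑ i, (x + z) i ^ 2 = ∑ i, x i ^ 2 + 2 * ∑ i, x i * z i + ∑ i, z i ^ 2 := by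
    rw [Finset.mul_sum, ← Finset.sum_add_distrib, ← Finset.sum_add_distrib]
    exact Finset.sum_congr rfl fun i _ => by rw [Pi.add_apply]; ring
  rw [h4, h5, h2, h3] at h1
  linarith

lemma sum_sq_le_sq_sum_abs {η : Type*} [Fintype η] (z : η → ℝ) :
    ∑ i, z i ^ 2 ≤ (∑ i, |z i|) ^ 2 := by
  have := Finset.sum_sq_le_sq_sum_of_nonneg (s := Finset.univ) (f := fun i => |z i|)
    (fun i _ => abs_nonneg _)
  simpa using this

/-- The mean of the `k`-th root of a nonnegative form of degree `k`, `k ≥ 1`. -/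
lemma integral_rpow_inv_le {P : MvPolynomial (Fin D) ℝ} (hP0 : ∀ z, 0 ≤ eval z P) {k : ℕ}
    (hk : 0 < k) {L : ℝ} (hL : 0 < L) (h : gE P ≤ L ^ k) :
    ∫ z, (eval z P) ^ ((k : ℝ)⁻¹) ∂gam (Fin D) ≤ L := by
  have hb : ∀ z : Fin D → ℝ, (eval z P) ^ ((k : ℝ)⁻¹) ≤
      L * (1 - 1 / k) + L / k * ((L ^ k)⁻¹ * eval z P) := by
    intro z
    have h0 : 0 ≤ (eval z P) ^ ((k : ℝ)⁻¹) := Real.rpow_nonneg (hP0 z) _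
    have h1 : ((eval z P) ^ ((k : ℝ)⁻¹)) ^ k = eval z P :=
      Real.rpow_inv_natCast_pow (hP0 z) hk.ne'
    set l := (eval z P) ^ ((k : ℝ)⁻¹)
    have h2 := one_add_mul_le_pow (a := l / L - 1) (by
      have : 0 ≤ l / L := by positivity
      linarith) k
    rw [add_sub_cancel, div_pow, h1] at h2
    have hk' : (0 : ℝ) < k := by exact_mod_cast hk
    have h3 : l = L * (1 - 1 / k) + L / k * (1 + k * (l / L - 1)) := by
      field_simp
      ring
    rw [h3]
    have h4 : (L ^ k)⁻¹ * eval z P = eval z P / L ^ k := by rw [div_eq_inv_mul]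
    rw [h4]
    gcongr
  have hI : Integrable (fun z : Fin D → ℝ => L * (1 - 1 / k) + L / k * ((L ^ k)⁻¹ * eval z P))
      (gam (Fin D)) :=
    (integrable_const _).add (((integrable_eval P).const_mul _).const_mul _)
  refine (integral_mono_of_nonneg (Filter.Eventually.of_forall fun z => Real.rpow_nonneg (hP0 z) _)
    hI (Filter.Eventually.of_forall hb)).trans ?_
  rw [integral_add (integrable_const _) (((integrable_eval P).const_mul _).const_mul _),
    integral_const, probReal_univ, one_smul, integral_const_mul, integral_const_mul, ← gE_def]
  have hk' : (0 : ℝ) < k := by exact_mod_cast hk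
  have h5 : (L ^ k)⁻¹ * gE P ≤ 1 := by
    rw [inv_mul_le_iff₀ (by positivity), mul_one]; exact h
  calc L * (1 - 1 / k) + L / k * ((L ^ k)⁻¹ * gE P) ≤ L * (1 - 1 / k) + L / k * 1 := by gcongr
    _ = L := by field_simp; ring

lemma rpow_inv_le_sum_abs {P : MvPolynomial (Fin D) ℝ} {k : ℕ} (hP : P.IsHomogeneous k)
    (hP0 : ∀ z, 0 ≤ eval z P) (hk : 0 < k) :
    ∃ B : ℝ, ∀ z, (eval z P) ^ ((k : ℝ)⁻¹) ≤ B * ∑ i, |z i| := by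
  set c := √(gE (P ^ 2) / k.factorial) with hc
  refine ⟨c ^ ((k : ℝ)⁻¹), fun z => ?_⟩
  have h1 := eval_sq_mul_le k hP z
  have hs : 0 ≤ ∑ i, |z i| := Finset.sum_nonneg fun i _ => abs_nonneg _
  have h2 : eval z P ≤ c * (∑ i, |z i|) ^ k := by
    refine le_of_pow_le_pow_left₀ two_ne_zero (by positivity) ?_
    rw [mul_pow, hc, Real.sq_sqrt (div_nonneg (gE_sq_nonneg _) (by positivity)), div_mul_eq_mul_div,
      le_div_iff₀ (by positivity), mul_comm, ← pow_mul, mul_comm k 2, pow_mul, mul_comm (gE _)]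
    refine h1.trans (mul_le_mul_of_nonneg_right ?_ (gE_sq_nonneg _))
    exact pow_le_pow_left₀ (Finset.sum_nonneg fun i _ => sq_nonneg _) (sum_sq_le_sq_sum_abs z) k
  calc (eval z P) ^ ((k : ℝ)⁻¹) ≤ (c * (∑ i, |z i|) ^ k) ^ ((k : ℝ)⁻¹) :=
        Real.rpow_le_rpow (hP0 z) h2 (by positivity)
    _ = c ^ ((k : ℝ)⁻¹) * ∑ i, |z i| := by
        rw [Real.mul_rpow (Real.sqrt_nonneg _) (by positivity), Real.pow_rpow_inv_natCast hs hk.ne']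

/-- Sums of squares form a small set. -/
lemma IsApolarParam.volume_sq_le (hφ : IsApolarParam a b φ) (hD : 0 < D) {p : ℕ} (hp : 0 < p)
    {L : ℝ} (hL : 0 < L) (hn : 0 < Fintype.card ι) (hm : 0 < Fintype.card κ)
    (h : dfac p * Gm (bexp ι κ a b).card (2 * p) ≤ (2 * p).factorial * L ^ (2 * p)) :
    volume {z | ∃ (N : ℕ) (g : Fin N → MvPolynomial (ι ⊕ κ) ℝ), (∀ i, IsBih a b (g i)) ∧
        φ z + rsq Sum.inl ^ a * rsq Sum.inr ^ b = ∑ i, g i ^ 2} ≤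
      ENNReal.ofReal ((√(2 * Real.pi * Real.exp 1) *
        (Gm (Fintype.card ι) a * Gm (Fintype.card κ) b / (a.factorial * b.factorial) * L) / D) ^
          D) := by
  set c : ℝ := Gm (Fintype.card ι) a * Gm (Fintype.card κ) b / (a.factorial * b.factorial) with hc
  have hc0 : 0 < c := by
    have := Gm_pos hn a
    have := Gm_pos hm b
    positivity
  set A : Set (Fin D → ℝ) := {z | ∃ (N : ℕ) (g : Fin N → MvPolynomial (ι ⊕ κ) ℝ),
    (∀ i, IsBih a b (g i)) ∧ φ z + rsq Sum.inl ^ a * rsq Sum.inr ^ b = ∑ i, g i ^ 2}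
  set K : ℝ := (2 * a).factorial * (2 * b).factorial with hK
  have hK0 : 0 < K := by positivity
  set q : MvPolynomial (ι ⊕ κ) ℝ := rsq Sum.inl ^ a * rsq Sum.inr ^ b with hq
  set a0 : Fin D → ℝ := fun i => apI q (φ (Pi.single i 1)) / K with ha0
  set P : MvPolynomial (Fin D) ℝ := C (((2 * p).factorial : ℝ)⁻¹) * gramMom a b φ p with hP
  have hPev : ∀ z, eval z P = ((2 * p).factorial : ℝ)⁻¹ * eval z (gramMom a b φ p) := by
    intro z; rw [hP, map_mul, eval_C]
  have hP0 : ∀ z, 0 ≤ eval z P := fun z => by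
    rw [hPev]; exact mul_nonneg (by positivity) (eval_gramMom_nonneg p z)
  have hk : 0 < 2 * p := by omega
  have hPh : P.IsHomogeneous (2 * p) := by
    rw [hP, ← Nat.zero_add (2 * p)]
    exact (isHomogeneous_C _ _).mul (isHomogeneous_momP _ (2 * p))
  have hgE : gE P ≤ L ^ (2 * p) := by
    rw [hP, gE_C_mul, inv_mul_le_iff₀ (by positivity)]
    exact (hφ.gE_gramMom_le p).trans h
  set lam : (Fin D → ℝ) → ℝ := fun z => (eval z P) ^ (((2 * p : ℕ) : ℝ)⁻¹) with hlam
  have hlam0 : ∀ z, 0 ≤ lam z := fun z => Real.rpow_nonneg (hP0 z) _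
  have hlamk : ∀ z, lam z ^ (2 * p) = eval z P := fun z =>
    Real.rpow_inv_natCast_pow (hP0 z) hk.ne'
  have hI : ∫ z, lam z ∂gam (Fin D) ≤ L := integral_rpow_inv_le hP0 hk hL hgE
  obtain ⟨B, hB⟩ := rpow_inv_le_sum_abs hPh hP0 hk
  have hform : ∀ z u, |eval u (gramP a b (φ z))| ≤ lam z * ∑ β, u β ^ 2 := by
    intro z u
    refine le_of_pow_le_pow_left₀ hk.ne' (mul_nonneg (hlam0 z) (by positivity)) ?_
    rw [(even_two_mul p).pow_abs, mul_pow, hlamk, hPev]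
    have := eval_gramP_pow_le (φ := φ) p z u
    rw [mul_assoc, le_inv_mul_iff₀ (by positivity), mul_comm (eval z _)]
    exact this
  have hmeas : Measurable lam :=
    ((continuous_eval P).measurable).pow_const _
  have hkey : ∀ x ∈ (fun x => x + a0) '' A, ∀ z, ∑ i, x i * z i ≤ c * lam z := by
    rintro _ ⟨x, ⟨N, g, hg, hxg⟩, rfl⟩ z
    choose u hu using fun i => (hg i).exists_bform
    have e1 : ∑ i, (x + a0) i * z i = apI (φ x + q) (φ z) / K := by
      rw [map_add, LinearMap.add_apply, hφ.apI_eq, add_div, ← hK, mul_div_cancel_left₀ _ hK0.ne']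
      conv_rhs => rw [map_eq_sum_single φ z]
      rw [map_sum, Finset.sum_div, ← Finset.sum_add_distrib]
      refine Finset.sum_congr rfl fun i _ => ?_
      rw [map_smul, smul_eq_mul, Pi.add_apply, ha0]
      ring
    have e2 : apI (φ x + q) (φ z) / K = ∑ r, eval (u r) (gramP a b (φ z)) := by
      rw [hxg, map_sum, LinearMap.sum_apply, Finset.sum_div]
      refine Finset.sum_congr rfl fun r _ => ?_
      rw [eval_gramP, apI_comm, ← hu]
    have e3 : ∑ r, ∑ β, u r β ^ 2 ≤ c := by
      rw [hc, le_div_iff₀ (by positivity), Finset.sum_mul]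
      calc ∑ r, (∑ β, u r β ^ 2) * ((a.factorial : ℝ) * b.factorial) = ∑ r, apN (g r) :=
            Finset.sum_congr rfl fun r _ => by rw [hu r, apN_bform]; ring
        _ ≤ ∑ r, gE (g r ^ 2) :=
            Finset.sum_le_sum fun r _ => apN_le_gE_sq _ _ (hg r).isHomogeneous
        _ = gE (φ x + q) := by rw [hxg, map_sum]
        _ = _ := by rw [map_add, hφ.mean, zero_add, hq, gE_rsq_pow_mul_rsq_pow]
    change ∑ i, (x + a0) i * z i ≤ c * lam z
    rw [e1, e2]
    calc ∑ r, eval (u r) (gramP a b (φ z)) ≤ ∑ r, lam z * ∑ β, u r β ^ 2 :=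
          Finset.sum_le_sum fun r _ => (le_abs_self _).trans (hform z (u r))
      _ = lam z * ∑ r, ∑ β, u r β ^ 2 := by rw [Finset.mul_sum]
      _ ≤ lam z * c := mul_le_mul_of_nonneg_left e3 (hlam0 z)
      _ = c * lam z := mul_comm _ _
  have hfin := urysohn hD (X := fun z => c * lam z) (hmeas.const_mul c)
    (fun z => mul_nonneg hc0.le (hlam0 z)) (B := c * B)
    (fun z => by rw [mul_assoc]; exact mul_le_mul_of_nonneg_left (hB z) hc0.le)
    (w := c * L) (mul_pos hc0 hL)
    (by rw [integral_const_mul]; exact mul_le_mul_of_nonneg_left hI hc0.le) hkey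
  have htr : volume ((fun x => x + a0) '' A) = volume A := by
    rw [Set.image_add_right, measure_preimage_add_right]
  rwa [htr] at hfin

end SumsOfSquaresVolume

section BrunnMinkowski

open scoped Pointwise

/-- Brunn–Minkowski in its multiplicative form. -/
lemma brunn_minkowski {D : ℕ} {s t : ℝ} (hs : 0 < s) (ht : 0 < t) (hst : s + t = 1)
    {A B S : Set (Fin D → ℝ)} (hA : MeasurableSet A) (hB : MeasurableSet B) (hS : MeasurableSet S)
    (h : ∀ x ∈ A, ∀ y ∈ B, s • x + t • y ∈ S) :
    volume A ^ s * volume B ^ t ≤ volume S := by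
  have := prekopa_leindler hs ht hst D (f := A.indicator 1) (g := B.indicator 1)
    (h := S.indicator 1) (measurable_one.indicator hA) (measurable_one.indicator hB)
    (measurable_one.indicator hS) (fun x y => by
      by_cases hx : x ∈ A
      · by_cases hy : y ∈ B
        · simp [hx, hy, h x hx y hy]
        · simp [hy, ht]
      · simp [hx, hs])
  simpa only [lintegral_indicator_one hA, lintegral_indicator_one hB,
    lintegral_indicator_one hS] using this

/-- A point of a nonempty closed convex set fixed by all norm-preserving symmetries. -/
lemma zero_mem_of_invariant {D : ℕ} {𝒯 : Set ((Fin D → ℝ) →ₗ[ℝ] (Fin D → ℝ))}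
    (hT : ∀ T ∈ 𝒯, ∀ a, ∑ i, T a i ^ 2 = ∑ i, a i ^ 2)
    (hfix : ∀ a, (∀ T ∈ 𝒯, T a = a) → a = 0)
    {S : Set (Fin D → ℝ)} (hne : S.Nonempty) (hS : Convex ℝ S) (hcl : IsClosed S)
    (hST : ∀ T ∈ 𝒯, ∀ a ∈ S, T a ∈ S) : (0 : Fin D → ℝ) ∈ S := by
  have hcont : Continuous fun a : Fin D → ℝ => ∑ i, a i ^ 2 := by fun_prop
  obtain ⟨b, hb⟩ := hne
  have hcomp : IsCompact (S ∩ {a | ∑ i, a i ^ 2 ≤ ∑ i, b i ^ 2}) := by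
    refine Metric.isCompact_of_isClosed_isBounded
      (hcl.inter (isClosed_le hcont continuous_const)) ?_
    refine (Metric.isBounded_closedBall (x := (0 : Fin D → ℝ)) (r := √(∑ i, b i ^ 2))).subset ?_
    rintro a ⟨-, ha⟩
    rw [mem_closedBall_zero_iff, pi_norm_le_iff_of_nonneg (Real.sqrt_nonneg _)]
    intro i
    rw [Real.norm_eq_abs]
    refine Real.abs_le_sqrt (le_trans ?_ ha)
    exact Finset.single_le_sum (f := fun i => a i ^ 2) (fun j _ => sq_nonneg _) (Finset.mem_univ i)
  obtain ⟨a, ⟨haS, hab⟩, hmin⟩ := hcomp.exists_isMinOn ⟨b, hb, le_refl (∑ i, b i ^ 2)⟩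
    hcont.continuousOn
  have hmin' : ∀ x ∈ S, ∑ i, a i ^ 2 ≤ ∑ i, x i ^ 2 := by
    intro x hx
    by_cases hxb : ∑ i, x i ^ 2 ≤ ∑ i, b i ^ 2
    · exact hmin ⟨hx, hxb⟩
    · exact le_trans hab (not_le.mp hxb).le
  have hfa : a = 0 := by
    refine hfix a fun T hTT => ?_
    have h1 := hmin' _ (hS haS (hST T hTT a haS) (a := 1 / 2) (b := 1 / 2) (by norm_num)
      (by norm_num) (by norm_num))
    have h2 := hT T hTT a
    have h3 : ∑ i, ((1 / 2 : ℝ) • a + (1 / 2 : ℝ) • T a) i ^ 2 =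
        1 / 2 * ∑ i, a i ^ 2 + 1 / 2 * ∑ i, T a i ^ 2 - 1 / 4 * ∑ i, (T a i - a i) ^ 2 := by
      rw [Finset.mul_sum, Finset.mul_sum, Finset.mul_sum, ← Finset.sum_add_distrib,
        ← Finset.sum_sub_distrib]
      refine Finset.sum_congr rfl fun i _ => ?_
      simp only [Pi.add_apply, Pi.smul_apply, smul_eq_mul]
      ring
    rw [h3, h2] at h1
    have h4 : ∑ i, (T a i - a i) ^ 2 = 0 :=
      le_antisymm (by linarith) (Finset.sum_nonneg fun i _ => sq_nonneg _)
    rw [Finset.sum_eq_zero_iff_of_nonneg fun i _ => sq_nonneg _] at h4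
    funext i
    have := h4 i (Finset.mem_univ i)
    exact sub_eq_zero.mp (pow_eq_zero_iff two_ne_zero |>.mp this)
  rwa [← hfa]

lemma abs_det_eq_one {D : ℕ} {T : (Fin D → ℝ) →ₗ[ℝ] (Fin D → ℝ)}
    (hT : ∀ a, ∑ i, T a i ^ 2 = ∑ i, a i ^ 2) : |LinearMap.det T| = 1 := by
  have hpol : ∀ x y, T x ⬝ᵥ T y = x ⬝ᵥ y := by
    intro x y
    have h1 := hT (x + y)
    have h2 := hT x
    have h3 := hT y
    have e : ∀ u v : Fin D → ℝ,
        ∑ i, (u + v) i ^ 2 = ∑ i, u i ^ 2 + 2 * (u ⬝ᵥ v) + ∑ i, v i ^ 2 := by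
      intro u v
      rw [dotProduct, Finset.mul_sum, ← Finset.sum_add_distrib, ← Finset.sum_add_distrib]
      exact Finset.sum_congr rfl fun i _ => by rw [Pi.add_apply]; ring
    rw [map_add, e, e] at h1
    linarith
  set M := LinearMap.toMatrix' T with hM
  have hMM : M.transpose * M = 1 := by
    ext i j
    have h := hpol (Pi.single i 1) (Pi.single j 1)
    rw [← LinearMap.toMatrix'_mulVec, ← LinearMap.toMatrix'_mulVec, ← hM, Matrix.mulVec_single_one,
      Matrix.mulVec_single_one] at h
    rw [Matrix.mul_apply', Matrix.one_apply]
    simp only [dotProduct, Pi.single_apply] at h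
    simpa [dotProduct, Matrix.col, eq_comm] using h
  have hd := congrArg Matrix.det hMM
  rw [Matrix.det_mul, Matrix.det_transpose, Matrix.det_one, hM, LinearMap.det_toMatrix'] at hd
  rw [← abs_one, ← sq_eq_sq_iff_abs_eq_abs, sq, hd, one_pow]

/-- The Milman–Pajor inequality for bodies without invariant directions. -/
lemma volume_le_of_isBounded {D : ℕ} {𝒯 : Set ((Fin D → ℝ) →ₗ[ℝ] (Fin D → ℝ))}
    (hT : ∀ T ∈ 𝒯, ∀ a, ∑ i, T a i ^ 2 = ∑ i, a i ^ 2)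
    (hfix : ∀ a, (∀ T ∈ 𝒯, T a = a) → a = 0)
    {K : Set (Fin D → ℝ)} (hK : Convex ℝ K) (hcl : IsClosed K)
    (hKT : ∀ T ∈ 𝒯, ∀ a ∈ K, T a ∈ K) (hbd : Bornology.IsBounded K) :
    volume K ≤ 2 ^ D * volume (K ∩ -K) := by
  by_cases hK0 : volume K = 0
  · rw [hK0]; exact zero_le
  have hKfin : volume K ≠ ⊤ := hbd.measure_lt_top.ne
  set W : (Fin D → ℝ) → Set (Fin D → ℝ) := fun a => K ∩ {x | a - x ∈ K} with hW
  have hWcl : ∀ a, IsClosed (W a) := fun a =>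
    hcl.inter (hcl.preimage (continuous_const.sub continuous_id))
  set g : (Fin D → ℝ) → ENNReal := fun a => volume (W a) with hg
  have hgm : Measurable fun z : (Fin D → ℝ) × (Fin D → ℝ) =>
      K.indicator (1 : (Fin D → ℝ) → ENNReal) z.2 *
        K.indicator (1 : (Fin D → ℝ) → ENNReal) (z.1 - z.2) := by
    have h1 : Measurable (K.indicator (1 : (Fin D → ℝ) → ENNReal)) :=
      measurable_one.indicator hcl.measurableSet
    exact (h1.comp measurable_snd).mul (h1.comp (measurable_fst.sub measurable_snd))
  have hgi : ∀ a, g a = ∫⁻ x, K.indicator (1 : (Fin D → ℝ) → ENNReal) x *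
      K.indicator (1 : (Fin D → ℝ) → ENNReal) (a - x) := by
    intro a
    change volume (W a) = _
    rw [← lintegral_indicator_one (hWcl a).measurableSet]
    refine lintegral_congr fun x => ?_
    by_cases h1 : x ∈ K <;> by_cases h2 : a - x ∈ K <;> simp [hW, h1, h2]
  have hgint : ∫⁻ a, g a = volume K * volume K := by
    simp_rw [hgi]
    rw [lintegral_lintegral_swap hgm.aemeasurable]
    have h1 : ∀ x : Fin D → ℝ, ∫⁻ a, K.indicator (1 : (Fin D → ℝ) → ENNReal) x *
        K.indicator (1 : (Fin D → ℝ) → ENNReal) (a - x) =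
        K.indicator (1 : (Fin D → ℝ) → ENNReal) x * volume K := by
      intro x
      have hm : Measurable fun a => K.indicator (1 : (Fin D → ℝ) → ENNReal) (a - x) :=
        (measurable_one.indicator hcl.measurableSet).comp (measurable_id.sub_const x)
      rw [lintegral_const_mul _ hm,
        lintegral_sub_right_eq_self (fun a => K.indicator (1 : (Fin D → ℝ) → ENNReal) a) x,
        lintegral_indicator_one hcl.measurableSet]
    simp_rw [h1]
    rw [lintegral_mul_const _ (measurable_one.indicator hcl.measurableSet),
      lintegral_indicator_one hcl.measurableSet]
  have h2K : volume ((2 : ℝ) • K) = 2 ^ D * volume K := by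
    rw [Measure.addHaar_smul]
    simp
  have hsupp : ∀ a, a ∉ (2 : ℝ) • K → g a = 0 := by
    intro a ha
    have : W a = ∅ := by
      by_contra hne
      obtain ⟨x, hx, hax⟩ := Set.nonempty_iff_ne_empty.mpr hne
      refine ha ⟨(1 / 2 : ℝ) • x + (1 / 2 : ℝ) • (a - x),
        hK hx hax (by norm_num) (by norm_num) (by norm_num), ?_⟩
      funext i
      simp only [Pi.smul_apply, Pi.add_apply, Pi.sub_apply, smul_eq_mul]
      ring
    rw [hg]
    simp [this]
  have h2Kcl : IsClosed ((2 : ℝ) • K) := hcl.smul_of_ne_zero two_ne_zero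
  have hset : ∫⁻ a in (2 : ℝ) • K, g a = volume K * volume K := by
    rw [← hgint, ← lintegral_indicator h2Kcl.measurableSet]
    refine lintegral_congr fun a => ?_
    by_cases ha : a ∈ (2 : ℝ) • K
    · rw [Set.indicator_of_mem ha]
    · rw [Set.indicator_of_notMem ha, hsupp a ha]
  have h20 : (2 : ENNReal) ^ D ≠ 0 := pow_ne_zero _ two_ne_zero
  have h2t : (2 : ENNReal) ^ D ≠ ⊤ := ENNReal.pow_ne_top ENNReal.ofNat_ne_top
  obtain ⟨a₀, -, ha₀⟩ := exists_setLAverage_le (μ := volume) (s := (2 : ℝ) • K) (f := g)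
    (by rw [h2K]; exact mul_ne_zero h20 hK0) h2Kcl.measurableSet.nullMeasurableSet
    (by rw [hset]; exact ENNReal.mul_ne_top hKfin hKfin)
  set c : ENNReal := volume K / 2 ^ D with hc
  have hc0 : c ≠ 0 := ENNReal.div_ne_zero.mpr ⟨hK0, h2t⟩
  have hct : c ≠ ⊤ := ENNReal.div_ne_top hKfin h20
  rw [setLAverage_eq, hset, h2K, ENNReal.mul_div_mul_right _ _ hK0 hKfin, ← hc] at ha₀
  have h0 : (0 : Fin D → ℝ) ∈ {a | c ≤ g a} := by
    refine zero_mem_of_invariant hT hfix ⟨a₀, ha₀⟩ ?_ ?_ ?_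
    · refine convex_iff_forall_pos.mpr fun x hx y hy s t hs ht hst => ?_
      have := brunn_minkowski hs ht hst (hWcl x).measurableSet (hWcl y).measurableSet
        (hWcl (s • x + t • y)).measurableSet (fun u hu v hv => by
          refine ⟨hK hu.1 hv.1 hs.le ht.le hst, ?_⟩
          have h := hK hu.2 hv.2 hs.le ht.le hst
          rw [smul_sub, smul_sub] at h
          change s • x + t • y - (s • u + t • v) ∈ K
          convert h using 1
          abel)
      refine le_trans ?_ this
      calc c = c ^ s * c ^ t := by rw [← ENNReal.rpow_add _ _ hc0 hct, hst, ENNReal.rpow_one]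
        _ ≤ _ := mul_le_mul' (ENNReal.rpow_le_rpow hx hs.le) (ENNReal.rpow_le_rpow hy ht.le)
    · refine isClosed_of_closure_subset fun a ha => ?_
      obtain ⟨u, hu, hua⟩ := mem_closure_iff_seq_limit.mp ha
      have hfatou := limsup_lintegral_le (μ := (volume : Measure (Fin D → ℝ)))
        (f := fun n x => (W (u n)).indicator (1 : (Fin D → ℝ) → ENNReal) x)
        (K.indicator 1) (fun n => measurable_one.indicator (hWcl (u n)).measurableSet)
        (fun n => Filter.Eventually.of_forall fun x =>
          Set.indicator_le_indicator_of_subset Set.inter_subset_left (fun _ => zero_le) x)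
        (by rw [lintegral_indicator_one hcl.measurableSet]; exact hKfin)
      have h1 : ∫⁻ x, Filter.limsup (fun n => (W (u n)).indicator (1 : (Fin D → ℝ) → ENNReal) x)
          Filter.atTop ≤ g a := by
        change _ ≤ volume (W a)
        rw [← lintegral_indicator_one (hWcl a).measurableSet]
        refine lintegral_mono fun x => ?_
        by_cases hx : x ∈ W a
        · rw [Set.indicator_of_mem hx]
          refine Filter.limsup_le_of_le (h := Filter.Eventually.of_forall fun n => ?_)
          exact Set.indicator_le_self' (fun _ _ => zero_le) x
        · rw [Set.indicator_of_notMem hx]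
          refine Filter.limsup_le_of_le (h := ?_)
          by_cases hxK : x ∈ K
          · have hax : a - x ∈ Kᶜ := fun h => hx ⟨hxK, h⟩
            filter_upwards [(hua.sub_const x).eventually (hcl.isOpen_compl.mem_nhds hax)] with n hn
            rw [Set.indicator_of_notMem fun h => hn h.2]
          · refine Filter.Eventually.of_forall fun n => ?_
            rw [Set.indicator_of_notMem fun h => hxK h.1]
      refine le_trans ?_ (hfatou.trans h1)
      refine Filter.le_limsup_of_frequently_le (Filter.Frequently.of_forall fun n => ?_)
      rw [lintegral_indicator_one (hWcl (u n)).measurableSet]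
      exact hu n
    · intro T hTT a ha
      refine le_trans (show c ≤ g a from ha) ?_
      have h1 := Measure.addHaar_image_linearMap (volume : Measure (Fin D → ℝ)) T (W a)
      rw [abs_det_eq_one (hT T hTT), ENNReal.ofReal_one, one_mul] at h1
      change volume (W a) ≤ volume (W (T a))
      rw [← h1]
      refine measure_mono ?_
      rintro _ ⟨x, ⟨hx, hax⟩, rfl⟩
      refine ⟨hKT T hTT x hx, ?_⟩
      change T a - T x ∈ K
      rw [← map_sub]
      exact hKT T hTT _ hax
  have h1 : W 0 = K ∩ -K := by
    ext x; simp [hW]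
  have h2 : c ≤ volume (K ∩ -K) := by rw [← h1]; exact h0
  rw [hc, ENNReal.div_le_iff h20 h2t, mul_comm] at h2
  exact h2

lemma volume_le_of_invariant {D : ℕ} {𝒯 : Set ((Fin D → ℝ) →ₗ[ℝ] (Fin D → ℝ))}
    (hT : ∀ T ∈ 𝒯, ∀ a, ∑ i, T a i ^ 2 = ∑ i, a i ^ 2)
    (hfix : ∀ a, (∀ T ∈ 𝒯, T a = a) → a = 0)
    {K : Set (Fin D → ℝ)} (hK : Convex ℝ K) (hcl : IsClosed K)
    (hKT : ∀ T ∈ 𝒯, ∀ a ∈ K, T a ∈ K) :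
    volume K ≤ 2 ^ D * volume (K ∩ -K) := by
  have hcont : Continuous fun a : Fin D → ℝ => ∑ i, a i ^ 2 := by fun_prop
  set B : ℕ → Set (Fin D → ℝ) := fun n => {a | ∑ i, a i ^ 2 ≤ (n : ℝ) ^ 2} with hB
  have hBcl : ∀ n, IsClosed (B n) := fun n => isClosed_le hcont continuous_const
  have hBcv : ∀ n, Convex ℝ (B n) := by
    intro n x hx y hy s t hs ht hst
    change ∑ i, (s • x + t • y) i ^ 2 ≤ _
    calc ∑ i, (s • x + t • y) i ^ 2 ≤ ∑ i, (s * x i ^ 2 + t * y i ^ 2) :=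
          Finset.sum_le_sum fun i _ => by
            simp only [Pi.add_apply, Pi.smul_apply, smul_eq_mul]
            obtain rfl : s = 1 - t := by linarith
            nlinarith [mul_nonneg (mul_nonneg hs ht) (sq_nonneg (x i - y i))]
      _ = s * ∑ i, x i ^ 2 + t * ∑ i, y i ^ 2 := by
          rw [Finset.sum_add_distrib, Finset.mul_sum, Finset.mul_sum]
      _ ≤ s * (n : ℝ) ^ 2 + t * (n : ℝ) ^ 2 := by gcongr <;> assumption
      _ = (n : ℝ) ^ 2 := by rw [← add_mul, hst, one_mul]
  have hun : K = ⋃ n, K ∩ B n := by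
    rw [← Set.inter_iUnion]
    refine (Set.inter_eq_left.mpr fun a _ => ?_).symm
    obtain ⟨n, hn⟩ := exists_nat_ge (√(∑ i, a i ^ 2))
    exact Set.mem_iUnion.mpr ⟨n, (Real.sqrt_le_left (by positivity)).mp hn⟩
  have hmono : Monotone fun n => K ∩ B n := by
    intro i j hij
    refine Set.inter_subset_inter_right _ fun a ha => le_trans ha.out ?_
    gcongr
  conv_lhs => rw [hun, hmono.measure_iUnion]
  refine iSup_le fun n => ?_
  refine (volume_le_of_isBounded hT hfix (hK.inter (hBcv n)) (hcl.inter (hBcl n))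
    (fun T hTT a ha => ⟨hKT T hTT a ha.1, ?_⟩) ?_).trans ?_
  · change ∑ i, T a i ^ 2 ≤ _
    rw [hT T hTT]; exact ha.2
  · refine (Metric.isBounded_closedBall (x := (0 : Fin D → ℝ)) (r := n)).subset ?_
    rintro a ⟨-, ha⟩
    rw [mem_closedBall_zero_iff, pi_norm_le_iff_of_nonneg (by positivity)]
    intro i
    rw [Real.norm_eq_abs]
    refine abs_le_of_sq_le_sq (le_trans ?_ ha) (by positivity)
    exact Finset.single_le_sum (f := fun i => a i ^ 2) (fun j _ => sq_nonneg _) (Finset.mem_univ i)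
  · gcongr
    · exact Set.inter_subset_left
    · exact Set.inter_subset_left

end BrunnMinkowski

section OrthogonalInvariance

section Substitution

variable {ι κ ι' κ' : Type*} [Fintype ι] [Fintype κ] [Fintype ι'] [Fintype κ']

lemma IsBih.prod {η : Type*} (s : Finset η) {a b : η → ℕ} {p : η → MvPolynomial (ι ⊕ κ) ℝ}
    (h : ∀ i, IsBih (a i) (b i) (p i)) :
    IsBih (∑ i ∈ s, a i) (∑ i ∈ s, b i) (∏ i ∈ s, p i) := by
  classical
  induction s using Finset.induction_on with
  | empty => simpa using isBih_one
  | insert i s hi ih =>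
    rw [Finset.sum_insert hi, Finset.sum_insert hi, Finset.prod_insert hi]
    exact (h i).mul ih

lemma IsBih.aeval {a b a₁ b₁ a₂ b₂ : ℕ} {θ : ι ⊕ κ → MvPolynomial (ι' ⊕ κ') ℝ}
    (h₁ : ∀ i, IsBih a₁ b₁ (θ (Sum.inl i))) (h₂ : ∀ j, IsBih a₂ b₂ (θ (Sum.inr j)))
    {f : MvPolynomial (ι ⊕ κ) ℝ} (hf : IsBih a b f) :
    IsBih (a * a₁ + b * a₂) (a * b₁ + b * b₂) (aeval θ f) := by
  rw [f.as_sum, map_sum]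
  refine IsBih.sum fun α hα => ?_
  have hαb : α ∈ bexp ι κ a b := by
    by_contra h0
    exact mem_support_iff.mp hα (hf α h0)
  rw [mem_bexp] at hαb
  rw [aeval_monomial, Finsupp.prod_fintype _ _ (fun _ => pow_zero _), Fintype.prod_sum_type,
    ← Algebra.smul_def]
  refine IsBih.smul ?_ _
  have e₁ := IsBih.prod Finset.univ fun i => (h₁ i).pow (α (Sum.inl i))
  have e₂ := IsBih.prod Finset.univ fun j => (h₂ j).pow (α (Sum.inr j))
  rw [← Finset.sum_mul, ← Finset.sum_mul, hαb.1] at e₁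
  rw [← Finset.sum_mul, ← Finset.sum_mul, hαb.2] at e₂
  exact e₁.mul e₂

end Substitution

section Orthogonal

variable {τ : Type*} [Fintype τ]

/-- Substitution of the variables by a square matrix. -/
def lsub (Q : Matrix τ τ ℝ) : MvPolynomial τ ℝ →ₐ[ℝ] MvPolynomial τ ℝ :=
  aeval fun i => ∑ j, C (Q i j) * X j

lemma eval_lsub (Q : Matrix τ τ ℝ) (f : MvPolynomial τ ℝ) (w : τ → ℝ) :
    eval w (lsub Q f) = eval (Q.mulVec w) f := by
  rw [lsub, ← MvPolynomial.coe_aeval_eq_eval, ← MvPolynomial.coe_aeval_eq_eval]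
  change (aeval w) (aeval _ f) = aeval _ f
  rw [← AlgHom.comp_apply, comp_aeval]
  congr 2
  funext i
  simp [Matrix.mulVec, dotProduct]

variable [DecidableEq τ]

lemma sum_mulVec_sq {Q : Matrix τ τ ℝ} (hQ : Q * Q.transpose = 1) (w : τ → ℝ) :
    ∑ i, Q.mulVec w i ^ 2 = ∑ i, w i ^ 2 := by
  have h : Q.mulVec w ⬝ᵥ Q.mulVec w = w ⬝ᵥ w := by
    rw [Matrix.dotProduct_mulVec, ← Matrix.mulVec_transpose, Matrix.mulVec_mulVec,
      mul_eq_one_comm.mp hQ, Matrix.one_mulVec]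
  simpa only [dotProduct, ← sq] using h

lemma map_mulVec_gam {Q : Matrix τ τ ℝ} (hQ : Q * Q.transpose = 1) :
    (gam τ).map Q.mulVec = gam τ := by
  have hQm : Measurable Q.mulVec := by
    have : Continuous Q.mulVec := Continuous.matrix_mulVec continuous_const continuous_id
    exact this.measurable
  have hdet : |Q.det| = 1 := by
    have hd := congrArg Matrix.det hQ
    rw [Matrix.det_mul, Matrix.det_transpose, Matrix.det_one] at hd
    rw [← abs_one, ← sq_eq_sq_iff_abs_eq_abs, sq, hd, one_pow]
  have hdet0 : Q.det ≠ 0 := fun h => by simp [h] at hdet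
  have hvol : (volume : Measure (τ → ℝ)).map Q.mulVec = volume := by
    have := Real.map_matrix_volume_pi_eq_smul_volume_pi hdet0
    rw [abs_inv, hdet, inv_one, ENNReal.ofReal_one, one_smul] at this
    exact this
  ext s hs
  rw [Measure.map_apply hQm hs, ← lintegral_indicator_one (hQm hs), ← lintegral_indicator_one hs,
    lintegral_gam (measurable_one.indicator (hQm hs)), lintegral_gam (measurable_one.indicator hs)]
  congr 1
  conv_rhs => rw [← hvol]
  rw [lintegral_map (by
    refine Measurable.mul (by fun_prop) (measurable_one.indicator hs)) hQm]
  refine lintegral_congr fun w => ?_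
  rw [sum_mulVec_sq hQ]
  rfl

lemma gE_lsub {Q : Matrix τ τ ℝ} (hQ : Q * Q.transpose = 1) (f : MvPolynomial τ ℝ) :
    gE (lsub Q f) = gE f := by
  have hQm : Measurable Q.mulVec := by
    have : Continuous Q.mulVec := Continuous.matrix_mulVec continuous_const continuous_id
    exact this.measurable
  rw [gE_def, gE_def]
  conv_rhs => rw [← map_mulVec_gam hQ]
  rw [integral_map hQm.aemeasurable (continuous_eval f).aestronglyMeasurable]
  simp only [eval_lsub]

/-- Orthogonal matrices act transitively on spheres. -/
lemma exists_orthogonal_mulVec_eq {x x' : τ → ℝ} (h : ∑ i, x i ^ 2 = ∑ i, x' i ^ 2) :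
    ∃ Q : Matrix τ τ ℝ, Q * Q.transpose = 1 ∧ Q.mulVec x = x' := by
  set v := x - x' with hv
  by_cases hv0 : v = 0
  · exact ⟨1, by simp, by rw [Matrix.one_mulVec]; exact sub_eq_zero.mp hv0⟩
  have hxx : x ⬝ᵥ x = x' ⬝ᵥ x' := by simpa only [dotProduct, ← sq] using h
  have hvv : v ⬝ᵥ v ≠ 0 := by rwa [Ne, dotProduct_self_eq_zero]
  have hvx : 2 * (v ⬝ᵥ x) = v ⬝ᵥ v := by
    rw [hv, sub_dotProduct, sub_dotProduct, dotProduct_sub, dotProduct_sub, hxx,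
      dotProduct_comm x x']
    ring
  refine ⟨1 - (2 / (v ⬝ᵥ v)) • Matrix.vecMulVec v v, ?_, ?_⟩
  · rw [Matrix.transpose_sub, Matrix.transpose_smul, Matrix.transpose_one,
      Matrix.transpose_vecMulVec, Matrix.sub_mul, Matrix.one_mul, Matrix.mul_sub, Matrix.mul_one,
      Matrix.smul_mul, Matrix.mul_smul, Matrix.vecMulVec_mul_vecMulVec, smul_smul,
      Matrix.vecMulVec_smul, smul_smul]
    have : 2 / (v ⬝ᵥ v) * (2 / (v ⬝ᵥ v)) * (v ⬝ᵥ v) = 2 / (v ⬝ᵥ v) + 2 / (v ⬝ᵥ v) := by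
      field_simp; norm_num
    rw [this, add_smul]
    abel
  · rw [Matrix.sub_mulVec, Matrix.one_mulVec, Matrix.smul_mulVec, Matrix.vecMulVec_mulVec]
    funext i
    simp only [Pi.sub_apply, Pi.smul_apply, smul_eq_mul, MulOpposite.smul_eq_mul_unop,
      MulOpposite.unop_op]
    have : 2 / (v ⬝ᵥ v) * (v i * (v ⬝ᵥ x)) = v i := by
      rw [show 2 / (v ⬝ᵥ v) * (v i * (v ⬝ᵥ x)) = v i * (2 * (v ⬝ᵥ x)) / (v ⬝ᵥ v) by ring, hvx]
      field_simp
    rw [this, hv, Pi.sub_apply]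
    ring

end Orthogonal

variable {n m : ℕ}

lemma IsBih.lsub_fromBlocks {a b : ℕ} {f : MvPolynomial (Fin n ⊕ Fin m) ℝ} (hf : IsBih a b f)
    (Q₁ : Matrix (Fin n) (Fin n) ℝ) (Q₂ : Matrix (Fin m) (Fin m) ℝ) :
    IsBih a b (lsub (Matrix.fromBlocks Q₁ 0 0 Q₂) f) := by
  have := IsBih.aeval (a₁ := 1) (b₁ := 0) (a₂ := 0) (b₂ := 1)
    (θ := fun i => ∑ j, C (Matrix.fromBlocks Q₁ 0 0 Q₂ i j) * X j) (fun i => ?_) (fun i => ?_) hf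
  · simp only [mul_one, mul_zero, add_zero, zero_add] at this
    exact this
  · simp only [Fintype.sum_sum_type, Matrix.fromBlocks_apply₁₁, Matrix.fromBlocks_apply₁₂,
      Matrix.zero_apply, C_mul', zero_smul, Finset.sum_const_zero, add_zero]
    exact IsBih.sum fun j _ => (isBih_X_inl j).smul _
  · simp only [Fintype.sum_sum_type, Matrix.fromBlocks_apply₂₁, Matrix.fromBlocks_apply₂₂,
      Matrix.zero_apply, C_mul', zero_smul, Finset.sum_const_zero, zero_add]
    exact IsBih.sum fun j _ => (isBih_X_inr j).smul _

lemma fromBlocks_orthogonal {Q₁ : Matrix (Fin n) (Fin n) ℝ} {Q₂ : Matrix (Fin m) (Fin m) ℝ}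
    (h₁ : Q₁ * Q₁.transpose = 1) (h₂ : Q₂ * Q₂.transpose = 1) :
    Matrix.fromBlocks Q₁ 0 0 Q₂ * (Matrix.fromBlocks Q₁ 0 0 Q₂).transpose = 1 := by
  rw [Matrix.fromBlocks_transpose, Matrix.fromBlocks_multiply]
  simp [h₁, h₂, Matrix.fromBlocks_one]

lemma beval_lsub (Q₁ : Matrix (Fin n) (Fin n) ℝ) (Q₂ : Matrix (Fin m) (Fin m) ℝ)
    (f : MvPolynomial (Fin n ⊕ Fin m) ℝ) (x : Fin n → ℝ) (y : Fin m → ℝ) :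
    beval (lsub (Matrix.fromBlocks Q₁ 0 0 Q₂) f) x y = beval f (Q₁.mulVec x) (Q₂.mulVec y) := by
  rw [beval, eval_lsub, Matrix.fromBlocks_mulVec, beval]
  simp

lemma continuous_beval (f : MvPolynomial (Fin n ⊕ Fin m) ℝ) :
    Continuous fun z : (Fin n → ℝ) × (Fin m → ℝ) => beval f z.1 z.2 := by
  refine (continuous_eval f).comp (continuous_pi fun i => ?_)
  cases i
  · exact (continuous_apply _).comp continuous_fst
  · exact (continuous_apply _).comp continuous_snd

lemma bip_eq_bavg (σ₁ : Measure (Fin n → ℝ)) (σ₂ : Measure (Fin m → ℝ))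
    (f g : MvPolynomial (Fin n ⊕ Fin m) ℝ) : bip σ₁ σ₂ f g = bavg σ₁ σ₂ (f * g) := by
  simp only [bip, bavg, beval, map_mul]

variable {σ₁ : Measure (Fin n → ℝ)} {σ₂ : Measure (Fin m → ℝ)}

lemma bavg_lsub (hσ₁ : IsSphereMeasure n σ₁) (hσ₂ : IsSphereMeasure m σ₂)
    {Q₁ : Matrix (Fin n) (Fin n) ℝ} {Q₂ : Matrix (Fin m) (Fin m) ℝ}
    (h₁ : Q₁ * Q₁.transpose = 1) (h₂ : Q₂ * Q₂.transpose = 1)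
    (f : MvPolynomial (Fin n ⊕ Fin m) ℝ) :
    bavg σ₁ σ₂ (lsub (Matrix.fromBlocks Q₁ 0 0 Q₂) f) = bavg σ₁ σ₂ f := by
  have := hσ₁.prob
  have := hσ₂.prob
  have hQ₁ : Measurable Q₁.mulVec :=
    (Continuous.matrix_mulVec continuous_const continuous_id : Continuous Q₁.mulVec).measurable
  have hQ₂ : Measurable Q₂.mulVec :=
    (Continuous.matrix_mulVec continuous_const continuous_id : Continuous Q₂.mulVec).measurable
  have hF : StronglyMeasurable fun x => ∫ y, beval f x y ∂σ₂ :=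
    StronglyMeasurable.integral_prod_right' (continuous_beval f).stronglyMeasurable
  simp only [bavg, beval_lsub]
  have e₁ : ∀ x, ∫ y, beval f (Q₁.mulVec x) (Q₂.mulVec y) ∂σ₂ =
      ∫ y, beval f (Q₁.mulVec x) y ∂σ₂ := by
    intro x
    conv_rhs => rw [← hσ₂.invariant Q₂ h₂]
    rw [integral_map hQ₂.aemeasurable]
    exact ((continuous_beval f).comp
      (continuous_const.prodMk continuous_id)).aestronglyMeasurable
  simp_rw [e₁]
  conv_rhs => rw [← hσ₁.invariant Q₁ h₁]
  rw [integral_map hQ₁.aemeasurable hF.aestronglyMeasurable]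

lemma bavg_const (hσ₁ : IsSphereMeasure n σ₁) (hσ₂ : IsSphereMeasure m σ₂)
    {f : MvPolynomial (Fin n ⊕ Fin m) ℝ} {c : ℝ}
    (hf : ∀ x ∈ unitSphere n, ∀ y ∈ unitSphere m, beval f x y = c) : bavg σ₁ σ₂ f = c := by
  have := hσ₁.prob
  have := hσ₂.prob
  have h₁ : ∀ᵐ x ∂σ₁, x ∈ unitSphere n := hσ₁.onSphere
  have h₂ : ∀ᵐ y ∂σ₂, y ∈ unitSphere m := hσ₂.onSphere
  have : ∀ᵐ x ∂σ₁, ∫ y, beval f x y ∂σ₂ = c := by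
    filter_upwards [h₁] with x hx
    rw [integral_congr_ae (g := fun _ => c) (by filter_upwards [h₂] with y hy using hf x hx y hy)]
    simp
  rw [bavg, integral_congr_ae this]
  simp

end OrthogonalInvariance

section UnitaryParametrization

variable {n m k₁ k₂ D : ℕ} {σ₁ : Measure (Fin n → ℝ)} {σ₂ : Measure (Fin m → ℝ)}
  {ψ : (Fin D → ℝ) →ₗ[ℝ] MvPolynomial (Fin n ⊕ Fin m) ℝ}

lemma IsUnitaryParam.mem (hψ : IsUnitaryParam n m D σ₁ σ₂ (MSet n m k₁ k₂ σ₁ σ₂) ψ)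
    (a : Fin D → ℝ) : ψ a ∈ MSet n m k₁ k₂ σ₁ σ₂ := by
  rw [← hψ.range]
  exact ⟨a, rfl⟩

lemma IsUnitaryParam.isBih (hψ : IsUnitaryParam n m D σ₁ σ₂ (MSet n m k₁ k₂ σ₁ σ₂) ψ)
    (a : Fin D → ℝ) : IsBih (2 * k₁) (2 * k₂) (ψ a) :=
  mem_biform_iff.mp (hψ.mem a).1

/-- The isometries of the parameter space induced by pairs of orthogonal matrices. -/
def orthIsom (ψ : (Fin D → ℝ) →ₗ[ℝ] MvPolynomial (Fin n ⊕ Fin m) ℝ) :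
    Set ((Fin D → ℝ) →ₗ[ℝ] (Fin D → ℝ)) :=
  {T | ∃ (Q₁ : Matrix (Fin n) (Fin n) ℝ) (Q₂ : Matrix (Fin m) (Fin m) ℝ),
    Q₁ * Q₁.transpose = 1 ∧ Q₂ * Q₂.transpose = 1 ∧
      ∀ a, ψ (T a) = lsub (Matrix.fromBlocks Q₁ 0 0 Q₂) (ψ a)}

lemma IsUnitaryParam.exists_lift (hψ : IsUnitaryParam n m D σ₁ σ₂ (MSet n m k₁ k₂ σ₁ σ₂) ψ)
    (hσ₁ : IsSphereMeasure n σ₁) (hσ₂ : IsSphereMeasure m σ₂)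
    {Q₁ : Matrix (Fin n) (Fin n) ℝ} {Q₂ : Matrix (Fin m) (Fin m) ℝ}
    (h₁ : Q₁ * Q₁.transpose = 1) (h₂ : Q₂ * Q₂.transpose = 1) :
    ∃ T ∈ orthIsom ψ, ∀ a, ψ (T a) = lsub (Matrix.fromBlocks Q₁ 0 0 Q₂) (ψ a) := by
  let e := LinearEquiv.ofInjective ψ hψ.inj
  have hmem : ∀ a, ((lsub (Matrix.fromBlocks Q₁ 0 0 Q₂)).toLinearMap ∘ₗ ψ) a ∈
      LinearMap.range ψ := by
    intro a
    have : lsub (Matrix.fromBlocks Q₁ 0 0 Q₂) (ψ a) ∈ Set.range ψ := by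
      rw [hψ.range]
      exact ⟨mem_biform_iff.mpr ((hψ.isBih a).lsub_fromBlocks Q₁ Q₂),
        (bavg_lsub hσ₁ hσ₂ h₁ h₂ _).trans (hψ.mem a).2⟩
    exact this
  let T : (Fin D → ℝ) →ₗ[ℝ] (Fin D → ℝ) :=
    e.symm.toLinearMap ∘ₗ LinearMap.codRestrict (LinearMap.range ψ) _ hmem
  have hT : ∀ a, ψ (T a) = lsub (Matrix.fromBlocks Q₁ 0 0 Q₂) (ψ a) := by
    intro a
    have : e (T a) = LinearMap.codRestrict (LinearMap.range ψ) _ hmem a := e.apply_symm_apply _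
    exact congrArg Subtype.val this
  exact ⟨T, ⟨Q₁, Q₂, h₁, h₂, hT⟩, hT⟩

lemma IsUnitaryParam.sum_sq (hψ : IsUnitaryParam n m D σ₁ σ₂ (MSet n m k₁ k₂ σ₁ σ₂) ψ)
    (a : Fin D → ℝ) : ∑ i, a i ^ 2 = bavg σ₁ σ₂ (ψ a * ψ a) := by
  rw [← bip_eq_bavg, hψ.ip]
  simp only [sq]

lemma IsUnitaryParam.orthIsom_isometry
    (hψ : IsUnitaryParam n m D σ₁ σ₂ (MSet n m k₁ k₂ σ₁ σ₂) ψ)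
    (hσ₁ : IsSphereMeasure n σ₁) (hσ₂ : IsSphereMeasure m σ₂) :
    ∀ T ∈ orthIsom ψ, ∀ a, ∑ i, T a i ^ 2 = ∑ i, a i ^ 2 := by
  rintro T ⟨Q₁, Q₂, h₁, h₂, hT⟩ a
  rw [hψ.sum_sq, hψ.sum_sq, hT, ← map_mul, bavg_lsub hσ₁ hσ₂ h₁ h₂]

lemma IsUnitaryParam.eq_zero_of_fixed
    (hψ : IsUnitaryParam n m D σ₁ σ₂ (MSet n m k₁ k₂ σ₁ σ₂) ψ)
    (hσ₁ : IsSphereMeasure n σ₁) (hσ₂ : IsSphereMeasure m σ₂) (hn : 0 < n) (hm : 0 < m)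
    (a : Fin D → ℝ) (ha : ∀ T ∈ orthIsom ψ, T a = a) : a = 0 := by
  let x₀ : Fin n → ℝ := Pi.single ⟨0, hn⟩ 1
  let y₀ : Fin m → ℝ := Pi.single ⟨0, hm⟩ 1
  have hx₀ : ∑ i, x₀ i ^ 2 = 1 := by simp [x₀, Pi.single_apply]
  have hy₀ : ∑ i, y₀ i ^ 2 = 1 := by simp [y₀, Pi.single_apply]
  have hconst : ∀ x ∈ unitSphere n, ∀ y ∈ unitSphere m, beval (ψ a) x y = beval (ψ a) x₀ y₀ := by
    intro x hx y hy
    obtain ⟨Q₁, h₁, hQx⟩ := exists_orthogonal_mulVec_eq (hx₀.trans hx.out.symm)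
    obtain ⟨Q₂, h₂, hQy⟩ := exists_orthogonal_mulVec_eq (hy₀.trans hy.out.symm)
    obtain ⟨T, hT, hTψ⟩ := hψ.exists_lift hσ₁ hσ₂ h₁ h₂
    have := congrArg (fun f => beval f x₀ y₀) (hTψ a)
    simp only [beval_lsub, hQx, hQy, ha T hT] at this
    exact this.symm
  have h0 : beval (ψ a) x₀ y₀ = 0 := (bavg_const hσ₁ hσ₂ hconst).symm.trans (hψ.mem a).2
  have hsq : ∑ i, a i ^ 2 = 0 := by
    rw [hψ.sum_sq]
    refine bavg_const hσ₁ hσ₂ fun x hx y hy => ?_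
    have := hconst x hx y hy
    rw [h0, beval] at this
    rw [beval, map_mul, this, zero_mul]
  funext i
  exact pow_eq_zero_iff two_ne_zero |>.mp
    ((Finset.sum_eq_zero_iff_of_nonneg fun i _ => sq_nonneg (a i)).mp hsq i (Finset.mem_univ i))

lemma IsUnitaryParam.gE_eq_zero (hψ : IsUnitaryParam n m D σ₁ σ₂ (MSet n m k₁ k₂ σ₁ σ₂) ψ)
    (hσ₁ : IsSphereMeasure n σ₁) (hσ₂ : IsSphereMeasure m σ₂) (hn : 0 < n) (hm : 0 < m)
    (a : Fin D → ℝ) : gE (ψ a) = 0 := by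
  let ℓ : (Fin D → ℝ) →ₗ[ℝ] ℝ := gE ∘ₗ ψ
  have hc : Continuous ℓ := ℓ.continuous_of_finiteDimensional
  have h : (0 : Fin D → ℝ) ∈ ℓ ⁻¹' {ℓ a} := by
    refine zero_mem_of_invariant (hψ.orthIsom_isometry hσ₁ hσ₂)
      (hψ.eq_zero_of_fixed hσ₁ hσ₂ hn hm) ⟨a, rfl⟩
      ((convex_singleton (ℓ a)).linear_preimage ℓ) (isClosed_singleton.preimage hc) ?_
    rintro T ⟨Q₁, Q₂, h₁, h₂, hT⟩ b hb
    have hb' : gE (ψ b) = gE (ψ a) := hb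
    change gE (ψ (T b)) = gE (ψ a)
    rw [hT, gE_lsub (fromBlocks_orthogonal h₁ h₂), hb']
  have h' : ℓ 0 = ℓ a := h
  rw [map_zero] at h'
  exact h'.symm

lemma qpoly_eq : qpoly n m k₁ k₂ = rsq Sum.inl ^ k₁ * rsq Sum.inr ^ k₂ := rfl

lemma isBih_qpoly : IsBih (2 * k₁) (2 * k₂) (qpoly n m k₁ k₂) := by
  rw [qpoly_eq]
  exact isBih_rsq_pow_mul k₁ k₂

lemma eval_qpoly (w : Fin n ⊕ Fin m → ℝ) : eval w (qpoly n m k₁ k₂) =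
    (∑ i, w (Sum.inl i) ^ 2) ^ k₁ * (∑ j, w (Sum.inr j) ^ 2) ^ k₂ := by
  rw [qpoly_eq]
  exact eval_rsq_pow_mul w k₁ k₂

lemma lsub_qpoly_eval {Q₁ : Matrix (Fin n) (Fin n) ℝ} {Q₂ : Matrix (Fin m) (Fin m) ℝ}
    (h₁ : Q₁ * Q₁.transpose = 1) (h₂ : Q₂ * Q₂.transpose = 1) (w : Fin n ⊕ Fin m → ℝ) :
    eval ((Matrix.fromBlocks Q₁ 0 0 Q₂).mulVec w) (qpoly n m k₁ k₂) =
      eval w (qpoly n m k₁ k₂) := by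
  have e₁ := sum_mulVec_sq h₁ (fun i => w (Sum.inl i))
  have e₂ := sum_mulVec_sq h₂ (fun i => w (Sum.inr i))
  rw [eval_qpoly, eval_qpoly, ← e₁, ← e₂, Matrix.fromBlocks_mulVec]
  simp only [Matrix.zero_mulVec, add_zero, zero_add, Sum.elim_inl, Sum.elim_inr]
  rfl

lemma IsUnitaryParam.preimage_posSet (hψ : IsUnitaryParam n m D σ₁ σ₂ (MSet n m k₁ k₂ σ₁ σ₂) ψ) :
    ψ ⁻¹' tilde n m k₁ k₂ σ₁ σ₂ (PosSet n m k₁ k₂) =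
      {a | ∀ w, 0 ≤ eval w (ψ a + qpoly n m k₁ k₂)} := by
  ext a
  constructor
  · intro h w
    have := h.out.2.2 (fun i => w (Sum.inl i)) (fun i => w (Sum.inr i))
    have e : Sum.elim (fun i => w (Sum.inl i)) (fun i => w (Sum.inr i)) = w := by
      ext i
      cases i <;> rfl
    rwa [beval, e] at this
  · intro h
    exact ⟨hψ.mem a, mem_biform_iff.mpr ((hψ.isBih a).add isBih_qpoly), fun x y => h _⟩

lemma IsUnitaryParam.preimage_sqSet (hψ : IsUnitaryParam n m D σ₁ σ₂ (MSet n m k₁ k₂ σ₁ σ₂) ψ) :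
    ψ ⁻¹' tilde n m k₁ k₂ σ₁ σ₂ (SqSet n m k₁ k₂) =
      {a | ∃ (N : ℕ) (g : Fin N → MvPolynomial (Fin n ⊕ Fin m) ℝ), (∀ i, IsBih k₁ k₂ (g i)) ∧
        ψ a + qpoly n m k₁ k₂ = ∑ i, g i ^ 2} := by
  ext a
  constructor
  · rintro ⟨-, N, g, hg, h⟩
    exact ⟨N, g, fun i => mem_biform_iff.mp (hg i), h⟩
  · rintro ⟨N, g, hg, h⟩
    exact ⟨hψ.mem a, N, g, fun i => mem_biform_iff.mpr (hg i), h⟩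

lemma IsUnitaryParam.volume_pos_le_inter_neg
    (hψ : IsUnitaryParam n m D σ₁ σ₂ (MSet n m k₁ k₂ σ₁ σ₂) ψ)
    (hσ₁ : IsSphereMeasure n σ₁) (hσ₂ : IsSphereMeasure m σ₂) (hn : 0 < n) (hm : 0 < m) :
    volume {a | ∀ w, 0 ≤ eval w (ψ a + qpoly n m k₁ k₂)} ≤
      2 ^ D * volume {a | ∀ w, |eval w (ψ a)| ≤ eval w (qpoly n m k₁ k₂)} := by
  set K := {a | ∀ w, 0 ≤ eval w (ψ a + qpoly n m k₁ k₂)} with hKdef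
  have hlin : ∀ w : Fin n ⊕ Fin m → ℝ, ∃ ℓ : (Fin D → ℝ) →ₗ[ℝ] ℝ, ∀ a, ℓ a = eval w (ψ a) :=
    fun w => ⟨(MvPolynomial.aeval w).toLinearMap ∘ₗ ψ, fun a => by simp⟩
  choose ℓ hℓ using hlin
  have hK : K = ⋂ w, ℓ w ⁻¹' Set.Ici (-eval w (qpoly n m k₁ k₂)) := by
    ext a
    simp only [hKdef, Set.mem_iInter, Set.mem_preimage, hℓ, Set.mem_Ici]
    refine forall_congr' fun w => ?_
    rw [map_add, neg_le_iff_add_nonneg]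
  have h := volume_le_of_invariant (K := K) (hψ.orthIsom_isometry hσ₁ hσ₂)
      (hψ.eq_zero_of_fixed hσ₁ hσ₂ hn hm) ?_ ?_ ?_
  · refine h.trans (mul_le_mul_right (measure_mono ?_) _)
    rintro a ⟨h1, h2⟩ w
    have e1 := h1.out w
    have e2 := (Set.mem_neg.mp h2).out w
    rw [map_add] at e1 e2
    rw [map_neg, map_neg] at e2
    rw [abs_le]
    constructor <;> linarith
  · rw [hK]
    exact convex_iInter fun w => (convex_Ici _).linear_preimage (ℓ w)
  · rw [hK]
    exact isClosed_iInter fun w => isClosed_Ici.preimage (ℓ w).continuous_of_finiteDimensional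
  · rintro T ⟨Q₁, Q₂, h₁, h₂, hT⟩ a ha w
    have := ha.out ((Matrix.fromBlocks Q₁ 0 0 Q₂).mulVec w)
    rw [map_add, lsub_qpoly_eval h₁ h₂, ← eval_lsub, ← hT] at this
    rw [map_add]
    exact this

end UnitaryParametrization

section DerivativeBounds

lemma pderiv_aeval_eq_sum {σ τ : Type*} [Fintype σ] (θ : σ → MvPolynomial τ ℝ) (s : τ)
    (f : MvPolynomial σ ℝ) :
    pderiv s (aeval θ f) = ∑ i, aeval θ (pderiv i f) * pderiv s (θ i) := by
  classical
  induction f using MvPolynomial.induction_on with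
  | C c => simp [MvPolynomial.algebraMap_eq]
  | add p q hp hq => simp only [map_add, hp, hq, add_mul, Finset.sum_add_distrib]
  | mul_X p j hp =>
    have : ∀ i, aeval θ (pderiv i (p * X j)) * pderiv s (θ i) =
        θ j * (aeval θ (pderiv i p) * pderiv s (θ i)) +
          (if j = i then aeval θ p * pderiv s (θ i) else 0) := by
      intro i
      rw [pderiv_mul, map_add, map_mul, map_mul, aeval_X, pderiv_X, Pi.single_apply]
      split_ifs with h
      · subst h; rw [map_one]; ring
      · rw [map_zero]; ring
    simp only [this, Finset.sum_add_distrib, Finset.sum_ite_eq, Finset.mem_univ, if_true,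
      ← Finset.mul_sum, ← hp]
    rw [map_mul, pderiv_mul, aeval_X]
    ring

lemma eval_single_of_isHomogeneous {σ : Type*} [Fintype σ] [DecidableEq σ] {k : ℕ}
    {p : MvPolynomial σ ℝ} (hp : p.IsHomogeneous k) (s : σ) :
    eval (Pi.single s 1) p = coeff (Finsupp.single s k) p := by
  have hz : ∀ α ∈ p.support, α ≠ Finsupp.single s k →
      coeff α p * ∏ i, (Pi.single s 1 : σ → ℝ) i ^ α i = 0 := by
    intro α hα hne
    obtain ⟨i, hi, hαi⟩ : ∃ i, i ≠ s ∧ α i ≠ 0 := by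
      by_contra! h
      refine hne ?_
      have hsum := sum_eq_of_mem_support hp hα
      rw [Finset.sum_eq_single s (fun i _ hi => h i hi) (by simp)] at hsum
      ext i
      by_cases hi : i = s
      · subst hi; simp [hsum]
      · rw [h i hi, Finsupp.single_apply, if_neg (Ne.symm hi)]
    rw [Finset.prod_eq_zero (Finset.mem_univ i), mul_zero]
    rw [Pi.single_eq_of_ne hi, zero_pow hαi]
  rw [eval_eq', Finset.sum_eq_single _ hz]
  · rw [Finset.prod_eq_one, mul_one]
    intro i _
    by_cases h : i = s
    · subst h; simp
    · simp [Ne.symm h]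
  · intro hk
    rw [notMem_support_iff.mp hk, zero_mul]

lemma eval_aeval {σ τ : Type*} (θ : σ → MvPolynomial τ ℝ) (z : τ → ℝ) (f : MvPolynomial σ ℝ) :
    eval z (aeval θ f) = eval (fun i => eval z (θ i)) f := by
  induction f using MvPolynomial.induction_on with
  | C c => simp [MvPolynomial.algebraMap_eq]
  | add p q hp hq => simp only [map_add, hp, hq]
  | mul_X p j hp => simp only [map_mul, hp, aeval_X, eval_X]

lemma Gm_two (k : ℕ) : Gm 2 k = 2 ^ k * k.factorial := by
  induction k with
  | zero => simp [Gm_zero]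
  | succ k ih => rw [Gm_succ, ih, Nat.factorial_succ]; push_cast; ring

variable {ι κ : Type*} [Fintype ι] [Fintype κ]

/-- A directional Bernstein inequality for biforms dominated by a power of the norms. -/
lemma IsBih.directional_sq_le {k b : ℕ} {f : MvPolynomial (ι ⊕ κ) ℝ} (hf : IsBih (k + 1) b f)
    (hb : ∀ w, eval w f ^ 2 ≤ (∑ i, w (Sum.inl i) ^ 2) ^ (k + 1) * (∑ j, w (Sum.inr j) ^ 2) ^ b)
    (w : ι ⊕ κ → ℝ) {u : ι → ℝ} (hu : ∑ i, u i ^ 2 = ∑ i, w (Sum.inl i) ^ 2) :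
    (∑ i, u i * eval w (pderiv (Sum.inl i) f)) ^ 2 ≤
      4 ^ (k + 1) * (k + 1) * (∑ i, w (Sum.inl i) ^ 2) ^ (k + 1) *
        (∑ j, w (Sum.inr j) ^ 2) ^ b := by
  classical
  set r := ∑ i, w (Sum.inl i) ^ 2 with hr
  set Y := ∑ j, w (Sum.inr j) ^ 2 with hY
  have hr0 : 0 ≤ r := Finset.sum_nonneg fun i _ => sq_nonneg _
  have hY0 : 0 ≤ Y := Finset.sum_nonneg fun i _ => sq_nonneg _
  let s₀ : Fin 2 ⊕ Fin 0 := Sum.inl 0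
  let s₁ : Fin 2 ⊕ Fin 0 := Sum.inl 1
  have hs : s₁ ≠ s₀ := by simp [s₀, s₁]
  let θ : ι ⊕ κ → MvPolynomial (Fin 2 ⊕ Fin 0) ℝ :=
    Sum.elim (fun i => C (w (Sum.inl i)) * X s₀ + C (u i) * X s₁) (fun j => C (w (Sum.inr j)))
  set h := MvPolynomial.aeval θ f with hh
  have hbih : IsBih (k + 1) 0 h := by
    have := IsBih.aeval (a₁ := 1) (b₁ := 0) (a₂ := 0) (b₂ := 0) (θ := θ) (fun i => ?_)
      (fun j => ?_) hf
    · simpa only [mul_one, mul_zero, add_zero] using this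
    · change IsBih 1 0 (C (w (Sum.inl i)) * X s₀ + C (u i) * X s₁)
      rw [C_mul', C_mul']
      exact ((isBih_X_inl 0).smul _).add ((isBih_X_inl 1).smul _)
    · change IsBih 0 0 (C (w (Sum.inr j)))
      rw [← mul_one (C _), C_mul']
      exact isBih_one.smul _
  have hhom : h.IsHomogeneous (k + 1) := by simpa using hbih.isHomogeneous
  have hev : ∀ z : Fin 2 ⊕ Fin 0 → ℝ, eval z h ^ 2 ≤ (2 * r) ^ (k + 1) * Y ^ b *
      eval z (rsq (Sum.inl : Fin 2 → Fin 2 ⊕ Fin 0) ^ (k + 1) *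
        rsq (Sum.inr : Fin 0 → Fin 2 ⊕ Fin 0) ^ 0) := by
    intro z
    have e : eval z h = eval (fun i => eval z (θ i)) f := eval_aeval θ z f
    have hsum : ∑ i, (w (Sum.inl i) * z s₀ + u i * z s₁) ^ 2 ≤ 2 * r * (z s₀ ^ 2 + z s₁ ^ 2) := by
      calc ∑ i, (w (Sum.inl i) * z s₀ + u i * z s₁) ^ 2
          ≤ ∑ i, (w (Sum.inl i) ^ 2 * (2 * z s₀ ^ 2) + u i ^ 2 * (2 * z s₁ ^ 2)) :=
            Finset.sum_le_sum fun i _ => by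
              nlinarith [sq_nonneg (w (Sum.inl i) * z s₀ - u i * z s₁)]
        _ = 2 * r * (z s₀ ^ 2 + z s₁ ^ 2) := by
            rw [Finset.sum_add_distrib, ← Finset.sum_mul, ← Finset.sum_mul, hu]; ring
    rw [e, eval_rsq_pow_mul, pow_zero, mul_one, Fin.sum_univ_two]
    refine (hb _).trans ?_
    simp only [θ, Sum.elim_inl, Sum.elim_inr, map_add, map_mul, eval_C, eval_X]
    calc _ ≤ (2 * r * (z s₀ ^ 2 + z s₁ ^ 2)) ^ (k + 1) * Y ^ b :=
          mul_le_mul_of_nonneg_right (pow_le_pow_left₀ (Finset.sum_nonneg fun i _ => sq_nonneg _)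
            hsum _) (by positivity)
      _ = _ := by rw [mul_pow]; ring
  have hgE : gE (h ^ 2) ≤ (2 * r) ^ (k + 1) * Y ^ b * (2 ^ (k + 1) * (k + 1).factorial) := by
    have := gE_mono (p := h ^ 2) (q := C ((2 * r) ^ (k + 1) * Y ^ b) *
      (rsq (Sum.inl : Fin 2 → Fin 2 ⊕ Fin 0) ^ (k + 1) *
        rsq (Sum.inr : Fin 0 → Fin 2 ⊕ Fin 0) ^ 0)) (fun z => by
        rw [map_pow, map_mul, eval_C]; exact hev z)
    rwa [gE_C_mul, gE_rsq_pow_mul_rsq_pow, Fintype.card_fin, Gm_zero, mul_one, Gm_two] at this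
  have hc : eval (Pi.single s₀ 1) (pderiv s₁ h) =
      ∑ i, u i * eval w (pderiv (Sum.inl i) f) := by
    have e : (fun i => eval (Pi.single s₀ 1) (θ i)) = w := by
      funext i
      cases i <;> simp [θ, hs]
    rw [hh, pderiv_aeval_eq_sum, map_sum, Fintype.sum_sum_type]
    simp only [map_mul, eval_aeval, e]
    have e₁ : ∀ i, eval (Pi.single s₀ 1) (pderiv s₁ (θ (Sum.inl i))) = u i := by
      intro i
      simp [θ, pderiv_X, hs.symm]
    have e₂ : ∀ j, eval (Pi.single s₀ 1) (pderiv s₁ (θ (Sum.inr j))) = 0 := by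
      intro j
      simp [θ]
    simp only [e₁, e₂, mul_zero, Finset.sum_const_zero, add_zero]
    exact Finset.sum_congr rfl fun i _ => mul_comm _ _
  have hd : (pderiv s₁ h).IsHomogeneous k := by simpa using (hbih.pderiv_inl 1).isHomogeneous
  set α : Fin 2 ⊕ Fin 0 →₀ ℕ := Finsupp.single s₀ k + Finsupp.single s₁ 1 with hα
  have hcoef : coeff α h = ∑ i, u i * eval w (pderiv (Sum.inl i) f) := by
    rw [← hc, eval_single_of_isHomogeneous hd, coeff_pderiv, Finsupp.single_apply,
      if_neg hs.symm]
    simp [hα]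
  have hfac : fac α = k.factorial := by
    rw [fac, Fintype.prod_sum_type, Fin.prod_univ_two]
    simp [hα, s₀, s₁]
  have h1 : k.factorial * coeff α h ^ 2 ≤ gE (h ^ 2) := by
    refine le_trans ?_ (apN_le_gE_sq _ h hhom)
    rw [← hfac, apN_eq_sum_support]
    by_cases hm : α ∈ h.support
    · exact Finset.single_le_sum (f := fun α => fac α * coeff α h ^ 2)
        (fun β _ => mul_nonneg (fac_pos β).le (sq_nonneg _)) hm
    · rw [notMem_support_iff.mp hm]
      simp only [ne_eq, OfNat.ofNat_ne_zero, not_false_eq_true, zero_pow, mul_zero]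
      exact Finset.sum_nonneg fun β _ => mul_nonneg (fac_pos β).le (sq_nonneg _)
  rw [hcoef] at h1
  have h2 := h1.trans hgE
  have hk : (0 : ℝ) < k.factorial := by positivity
  refine le_of_mul_le_mul_left (h2.trans (le_of_eq ?_)) hk
  rw [Nat.factorial_succ, show (4 : ℝ) = 2 * 2 by norm_num, mul_pow, mul_pow]
  push_cast
  ring

/-- A Bernstein inequality for the gradient of biforms dominated by a power of the norms. -/
lemma IsBih.sum_pderiv_sq_le {k b : ℕ} (hk : 0 < k) {f : MvPolynomial (ι ⊕ κ) ℝ}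
    (hf : IsBih (k + 1) b f)
    (hb : ∀ w, eval w f ^ 2 ≤ (∑ i, w (Sum.inl i) ^ 2) ^ (k + 1) * (∑ j, w (Sum.inr j) ^ 2) ^ b)
    (w : ι ⊕ κ → ℝ) :
    ∑ i, eval w (pderiv (Sum.inl i) f) ^ 2 ≤ 4 ^ (k + 1) * (k + 1) *
      ((∑ i, w (Sum.inl i) ^ 2) ^ k * (∑ j, w (Sum.inr j) ^ 2) ^ b) := by
  set r := ∑ i, w (Sum.inl i) ^ 2 with hr
  set Y := ∑ j, w (Sum.inr j) ^ 2 with hY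
  have hr0 : 0 ≤ r := Finset.sum_nonneg fun i _ => sq_nonneg _
  have hY0 : 0 ≤ Y := Finset.sum_nonneg fun i _ => sq_nonneg _
  set v : ι → ℝ := fun i => eval w (pderiv (Sum.inl i) f) with hv
  set S := ∑ i, v i ^ 2 with hS
  have hS0 : 0 ≤ S := Finset.sum_nonneg fun i _ => sq_nonneg _
  change S ≤ _
  rcases hr0.eq_or_lt with hr1 | hr1
  · have hR : 0 ≤ (4 : ℝ) ^ (k + 1) * (k + 1) * (r ^ k * Y ^ b) := by positivity
    refine (le_of_eq ?_).trans hR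
    refine Finset.sum_eq_zero fun i _ => ?_
    have := (hf.pderiv_inl i).eval_sq_le w
    rw [← hr, ← hr1, zero_pow hk.ne', zero_mul, mul_zero] at this
    exact le_antisymm (nonpos_of_mul_nonpos_right this (by positivity)) (sq_nonneg _)
  rcases hS0.eq_or_lt with hS1 | hS1
  · rw [← hS1]; positivity
  have hu : ∑ i, (√(r / S) * v i) ^ 2 = r := by
    simp only [mul_pow, ← Finset.mul_sum, ← hS]
    rw [Real.sq_sqrt (by positivity)]
    field_simp
  have h := hf.directional_sq_le hb w hu
  have e : ∑ i, √(r / S) * v i * eval w (pderiv (Sum.inl i) f) = √(r / S) * S := by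
    rw [hS, Finset.mul_sum]
    exact Finset.sum_congr rfl fun i _ => by rw [mul_assoc, sq]
  rw [e, mul_pow, Real.sq_sqrt (by positivity), ← hr, ← hY,
    show r / S * S ^ 2 = r * S by field_simp] at h
  refine le_of_mul_le_mul_left (h.trans (le_of_eq ?_)) hr1
  rw [pow_succ r]
  ring

lemma IsBih.apN_le_of_sq_le {k b : ℕ} (hk : 0 < k) {f : MvPolynomial (ι ⊕ κ) ℝ}
    (hf : IsBih (k + 1) b f)
    (hb : ∀ w, eval w f ^ 2 ≤
      (∑ i, w (Sum.inl i) ^ 2) ^ (k + 1) * (∑ j, w (Sum.inr j) ^ 2) ^ b) :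
    apN f ≤ 4 ^ (k + 1) * (Gm (Fintype.card ι) k * Gm (Fintype.card κ) b) := by
  classical
  have h1 : ∑ i, apN (pderiv (Sum.inl i) f) = ((k + 1 : ℕ) : ℝ) * apN f := by
    have := sum_apN_pderiv (s := Finset.univ.map ⟨Sum.inl, Sum.inl_injective⟩) (k := k + 1) (p := f)
      (fun α hα => by
        rw [Finset.sum_map]
        have : α ∈ bexp ι κ (k + 1) b := by
          by_contra h; exact mem_support_iff.mp hα (hf α h)
        exact (mem_bexp.mp this).1)
    rwa [Finset.sum_map] at this
  have h2 : ∑ i, apN (pderiv (Sum.inl i) f) ≤ gE (∑ i, pderiv (Sum.inl i) f ^ 2) := by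
    rw [map_sum]
    exact Finset.sum_le_sum fun i _ => apN_le_gE_sq _ _ (hf.pderiv_inl i).isHomogeneous
  have h3 : gE (∑ i, pderiv (Sum.inl i) f ^ 2) ≤
      4 ^ (k + 1) * (k + 1) * (Gm (Fintype.card ι) k * Gm (Fintype.card κ) b) := by
    rw [← gE_rsq_pow_mul_rsq_pow, ← gE_C_mul]
    refine gE_mono fun w => ?_
    rw [map_sum, map_mul, eval_C, eval_rsq_pow_mul]
    simp only [map_pow]
    exact hf.sum_pderiv_sq_le hk hb w
  have h4 := h1.symm.le.trans (h2.trans h3)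
  push_cast at h4
  refine le_of_mul_le_mul_left (h4.trans (le_of_eq ?_)) (by positivity : (0 : ℝ) < k + 1)
  ring

lemma apN_rename {σ τ : Type*} [Fintype σ] [Fintype τ] (e : σ ≃ τ) (f : MvPolynomial σ ℝ) :
    apN (rename e f) = apN f := by
  classical
  rw [apN_eq_sum_support, apN_eq_sum_support, support_rename_of_injective e.injective,
    Finset.sum_image (Finsupp.mapDomain_injective e.injective).injOn]
  refine Finset.sum_congr rfl fun α _ => ?_
  rw [coeff_rename_mapDomain _ e.injective]
  congr 1
  rw [fac, fac, ← e.prod_comp]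
  exact Finset.prod_congr rfl fun i _ => by rw [Finsupp.mapDomain_apply e.injective]

lemma IsBih.rename_swap {a b : ℕ} {f : MvPolynomial (ι ⊕ κ) ℝ} (hf : IsBih a b f) :
    IsBih b a (rename (Equiv.sumComm ι κ) f) := by
  have := IsBih.aeval (a₁ := 0) (b₁ := 1) (a₂ := 1) (b₂ := 0)
    (θ := X ∘ Equiv.sumComm ι κ) (fun i => isBih_X_inr i) (fun j => isBih_X_inl j) hf
  simp only [mul_one, mul_zero, add_zero, zero_add] at this
  rwa [rename_eq_aeval]

lemma IsBih.apN_le_of_sq_le' {a k : ℕ} (hk : 0 < k) {f : MvPolynomial (ι ⊕ κ) ℝ}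
    (hf : IsBih a (k + 1) f)
    (hb : ∀ w, eval w f ^ 2 ≤
      (∑ i, w (Sum.inl i) ^ 2) ^ a * (∑ j, w (Sum.inr j) ^ 2) ^ (k + 1)) :
    apN f ≤ 4 ^ (k + 1) * (Gm (Fintype.card ι) a * Gm (Fintype.card κ) k) := by
  rw [← apN_rename (Equiv.sumComm ι κ), mul_comm (Gm _ _)]
  refine hf.rename_swap.apN_le_of_sq_le hk fun w => ?_
  rw [eval_rename, mul_comm]
  exact hb _

end DerivativeBounds

section VolumeRatio

lemma volume_sum_sq_le {D : ℕ} (hD : 0 < D) {R : ℝ} (hR : 0 < R) :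
    volume {z : Fin D → ℝ | ∑ i, z i ^ 2 ≤ R ^ 2} ≤
      ENNReal.ofReal ((√(2 * Real.pi * Real.exp 1) * (R * √D) / D) ^ D) := by
  have hD' : (0 : ℝ) < D := by exact_mod_cast hD
  have hDs : 0 < √(D : ℝ) := Real.sqrt_pos.mpr hD'
  refine urysohn hD (X := fun z => R * √(∑ i, z i ^ 2)) (by fun_prop)
    (fun z => by positivity) (B := R) (fun z => ?_) (by positivity) ?_ fun x hx z => ?_
  · refine mul_le_mul_of_nonneg_left ?_ hR.le
    exact Real.sqrt_le_iff.mpr ⟨Finset.sum_nonneg fun i _ => abs_nonneg _, sum_sq_le_sq_sum_abs z⟩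
  · have h1 : ∫ z : Fin D → ℝ, ∑ i, z i ^ 2 ∂gam (Fin D) = D := by
      have := gE_rsq_pow (ι := Fin D) 1
      rw [pow_one, gE_def, Gm_succ, Gm_zero, Fintype.card_fin] at this
      simpa [eval_rsq] using this
    have h2 : Integrable (fun z : Fin D → ℝ => ∑ i, z i ^ 2) (gam (Fin D)) := by
      have := integrable_eval (rsq (id : Fin D → Fin D))
      simpa only [eval_rsq, id] using this
    have h3 : ∫ z : Fin D → ℝ, √(∑ i, z i ^ 2) ∂gam (Fin D) ≤
        ∫ z : Fin D → ℝ, ((∑ i, z i ^ 2) * (2 * √D)⁻¹ + √D / 2) ∂gam (Fin D) := by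
      refine integral_mono_of_nonneg (Filter.Eventually.of_forall fun z => Real.sqrt_nonneg _)
        ((h2.mul_const _).add (integrable_const _)) (Filter.Eventually.of_forall fun z => ?_)
      have hs : 0 ≤ ∑ i, z i ^ 2 := Finset.sum_nonneg fun i _ => sq_nonneg _
      have e := Real.sq_sqrt hs
      change √(∑ i, z i ^ 2) ≤ (∑ i, z i ^ 2) * (2 * √D)⁻¹ + √D / 2
      set s := √(∑ i, z i ^ 2)
      rw [← e, ← sub_nonneg]
      have : s ^ 2 * (2 * √D)⁻¹ + √D / 2 - s = (s - √D) ^ 2 / (2 * √D) := by field_simp; ring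
      rw [this]
      positivity
    rw [integral_const_mul]
    refine mul_le_mul_of_nonneg_left (h3.trans (le_of_eq ?_)) hR.le
    rw [integral_add (h2.mul_const _) (integrable_const _), integral_mul_const, h1]
    simp only [integral_const, probReal_univ, one_smul]
    have e := Real.sq_sqrt hD'.le
    field_simp
    linarith
  · have hc := Finset.sum_mul_sq_le_sq_mul_sq Finset.univ x z
    refine (Real.le_sqrt_of_sq_le hc).trans ?_
    rw [Real.sqrt_mul (Finset.sum_nonneg fun i _ => sq_nonneg _)]
    refine mul_le_mul_of_nonneg_right ?_ (Real.sqrt_nonneg _)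
    exact Real.sqrt_le_iff.mpr ⟨hR.le, hx⟩

variable {ι κ : Type*} [Fintype ι] [Fintype κ] {D : ℕ} {a b : ℕ}
  {φ : (Fin D → ℝ) →ₗ[ℝ] MvPolynomial (ι ⊕ κ) ℝ}

lemma IsApolarParam.volume_abs_le (hφ : IsApolarParam a b φ) (hD : 0 < D) (ha : 0 < a) (hb : 0 < b)
    {R : ℝ} (hR : 0 < R)
    (h : 4 ^ (2 * a) * (Gm (Fintype.card ι) (2 * a - 1) * Gm (Fintype.card κ) (2 * b)) ≤
        (2 * a).factorial * (2 * b).factorial * R ^ 2 ∨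
      4 ^ (2 * b) * (Gm (Fintype.card ι) (2 * a) * Gm (Fintype.card κ) (2 * b - 1)) ≤
        (2 * a).factorial * (2 * b).factorial * R ^ 2) :
    volume {z | ∀ w, |eval w (φ z)| ≤ eval w (rsq Sum.inl ^ a * rsq Sum.inr ^ b)} ≤
      ENNReal.ofReal ((√(2 * Real.pi * Real.exp 1) * (R * √D) / D) ^ D) := by
  refine (measure_mono fun z hz => ?_).trans (volume_sum_sq_le hD hR)
  have hsq : ∀ w, eval w (φ z) ^ 2 ≤
      (∑ i, w (Sum.inl i) ^ 2) ^ (2 * a) * (∑ j, w (Sum.inr j) ^ 2) ^ (2 * b) := by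
    intro w
    have := hz.out w
    rw [eval_rsq_pow_mul] at this
    rw [← sq_abs]
    refine (pow_le_pow_left₀ (abs_nonneg _) this 2).trans (le_of_eq ?_)
    rw [mul_pow, ← pow_mul, ← pow_mul, mul_comm a, mul_comm b]
  have hbih := hφ.bih z
  have hn := hφ.norm z
  have hK : (0 : ℝ) < (2 * a).factorial * (2 * b).factorial := by positivity
  change ∑ i, z i ^ 2 ≤ R ^ 2
  refine le_of_mul_le_mul_left ?_ hK
  rw [← hn]
  rcases h with h | h
  · obtain ⟨k, hk⟩ : ∃ k, 2 * a = k + 1 := ⟨2 * a - 1, by omega⟩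
    refine le_trans ?_ h
    rw [hk] at hsq hbih ⊢
    exact hbih.apN_le_of_sq_le (by omega) hsq
  · obtain ⟨k, hk⟩ : ∃ k, 2 * b = k + 1 := ⟨2 * b - 1, by omega⟩
    refine le_trans ?_ h
    rw [hk] at hsq hbih ⊢
    exact hbih.apN_le_of_sq_le' (by omega) hsq

lemma half_mul_pow_le {D : ℕ} (hD : 0 < D) {x : ℝ} (hx : 0 ≤ x) :
    (x / 2) ^ D ≤ 1 / 2 * x ^ D := by
  rw [div_pow, div_eq_mul_inv, mul_comm]
  refine mul_le_mul_of_nonneg_right ?_ (by positivity)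
  rw [one_div]
  exact inv_anti₀ two_pos (le_self_pow₀ one_le_two hD.ne')

variable {n m k₁ k₂ : ℕ} {σ₁ : Measure (Fin n → ℝ)} {σ₂ : Measure (Fin m → ℝ)}
  {ψ : (Fin D → ℝ) →ₗ[ℝ] MvPolynomial (Fin n ⊕ Fin m) ℝ}

/-- Bounds for the volume radius ratio in terms of auxiliary parameters. -/
lemma IsUnitaryParam.ratio_bounds (hψ : IsUnitaryParam n m D σ₁ σ₂ (MSet n m k₁ k₂ σ₁ σ₂) ψ)
    (hσ₁ : IsSphereMeasure n σ₁) (hσ₂ : IsSphereMeasure m σ₂) (hn : 0 < n) (hm : 0 < m)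
    (hk₁ : 0 < k₁) (hk₂ : 0 < k₂) (hD : 0 < D) {p q : ℕ} (hp : 0 < p) (hq : 0 < q)
    {L t R : ℝ} (hL : 0 < L) (ht : 0 < t) (hR : 0 < R)
    (hd : 0 < (bexp (Fin n) (Fin m) k₁ k₂).card)
    (hLp : dfac p * Gm (bexp (Fin n) (Fin m) k₁ k₂).card (2 * p) ≤
      (2 * p).factorial * L ^ (2 * p))
    (htq : 2 * (dfac q * (Gm n (q * (2 * k₁)) * Gm m (q * (2 * k₂)))) ≤
      ((q * (2 * k₁)).factorial * (q * (2 * k₂)).factorial) * t ^ (2 * q))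
    (hRR : 4 ^ (2 * k₁) * (Gm n (2 * k₁ - 1) * Gm m (2 * k₂)) ≤
        (2 * k₁).factorial * (2 * k₂).factorial * R ^ 2 ∨
      4 ^ (2 * k₂) * (Gm n (2 * k₁) * Gm m (2 * k₂ - 1)) ≤
        (2 * k₁).factorial * (2 * k₂).factorial * R ^ 2) :
    ENNReal.ofReal (√D / (8 * √(Real.exp 1) * L * R)) ≤
      (volume (⇑ψ ⁻¹' tilde n m k₁ k₂ σ₁ σ₂ (SqSet n m k₁ k₂)) /
          volume (⇑ψ ⁻¹' tilde n m k₁ k₂ σ₁ σ₂ (PosSet n m k₁ k₂))) ^ ((1 : ℝ) / (D : ℝ)) ∧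
    (volume (⇑ψ ⁻¹' tilde n m k₁ k₂ σ₁ σ₂ (SqSet n m k₁ k₂)) /
        volume (⇑ψ ⁻¹' tilde n m k₁ k₂ σ₁ σ₂ (PosSet n m k₁ k₂))) ^ ((1 : ℝ) / (D : ℝ)) ≤
      ENNReal.ofReal (2 * √(Real.exp 1) *
        (Gm n k₁ * Gm m k₂ / (k₁.factorial * k₂.factorial)) * L * t / D) := by
  obtain ⟨T, hT, hTψ⟩ := exists_apolar_param ψ hψ.inj
    (K := (2 * k₁).factorial * (2 * k₂).factorial) (by positivity)
  have hφ : IsApolarParam k₁ k₂ (ψ ∘ₗ T) :=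
    ⟨fun z => hψ.isBih _, hTψ, fun z => hψ.gE_eq_zero hσ₁ hσ₂ hn hm _⟩
  have hD' : (0 : ℝ) < D := by exact_mod_cast hD
  rw [hψ.preimage_posSet, hψ.preimage_sqSet]
  have hneg := hψ.volume_pos_le_inter_neg hσ₁ hσ₂ hn hm
  set SQ := {a | ∃ (N : ℕ) (g : Fin N → MvPolynomial (Fin n ⊕ Fin m) ℝ), (∀ i, IsBih k₁ k₂ (g i)) ∧
        ψ a + qpoly n m k₁ k₂ = ∑ i, g i ^ 2}
  set PO := {a | ∀ w, 0 ≤ eval w (ψ a + qpoly n m k₁ k₂)}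
  set AB := {a | ∀ w, |eval w (ψ a)| ≤ eval w (qpoly n m k₁ k₂)}
  have hpre : ∀ S : Set (Fin D → ℝ),
      volume (T ⁻¹' S) = ENNReal.ofReal |(LinearMap.det T)⁻¹| * volume S :=
    fun S => Measure.addHaar_preimage_linearMap volume hT S
  set δ := ENNReal.ofReal |(LinearMap.det T)⁻¹|
  have hδ0 : δ ≠ 0 := (ENNReal.ofReal_pos.mpr (abs_pos.mpr (inv_ne_zero hT))).ne'
  have hδt : δ ≠ ⊤ := ENNReal.ofReal_ne_top
  have hratio : volume SQ / volume PO = volume (T ⁻¹' SQ) / volume (T ⁻¹' PO) := by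
    rw [hpre, hpre, ENNReal.mul_div_mul_left _ _ hδ0 hδt]
  have hneg' : volume (T ⁻¹' PO) ≤ 2 ^ D * volume (T ⁻¹' AB) := by
    rw [hpre, hpre, mul_left_comm]
    exact mul_le_mul_right hneg _
  have hS₁ : ENNReal.ofReal (1 / 2 * (√(2 * Real.pi) / (2 * L)) ^ D) ≤ volume (T ⁻¹' SQ) := by
    refine hφ.volume_sq_ge hp (by positivity) hd ?_
    rw [mul_pow, mul_left_comm ((2 * p).factorial : ℝ)]
    refine mul_le_mul ?_ hLp (mul_nonneg (dfac_nonneg _) (Gm_nonneg _ _)) (by positivity)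
    exact le_self_pow₀ one_le_two (by omega)
  have hS₂ : volume (T ⁻¹' SQ) ≤ ENNReal.ofReal ((√(2 * Real.pi * Real.exp 1) *
        (Gm n k₁ * Gm m k₂ / (k₁.factorial * k₂.factorial) * L) / D) ^ D) := by
    have := hφ.volume_sq_le hD hp hL (by simpa using hn) (by simpa using hm) hLp
    simp only [Fintype.card_fin] at this
    exact this
  have hP₁ : ENNReal.ofReal (1 / 2 * (√(2 * Real.pi) / t) ^ D) ≤ volume (T ⁻¹' PO) :=
    hφ.volume_pos_ge hq ht (by simpa using hn) (by simpa using hm) (by simpa using htq)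
  have hP₂ : volume (T ⁻¹' PO) ≤
      2 ^ D * ENNReal.ofReal ((√(2 * Real.pi * Real.exp 1) * (R * √D) / D) ^ D) :=
    hneg'.trans (mul_le_mul_right (hφ.volume_abs_le hD hk₁ hk₂ hR (by simpa using hRR)) _)
  have hPO0 : volume (T ⁻¹' PO) ≠ 0 :=
    (lt_of_lt_of_le (ENNReal.ofReal_pos.mpr (by positivity)) hP₁).ne'
  have hPOt : volume (T ⁻¹' PO) ≠ ⊤ :=
    (lt_of_le_of_lt hP₂ (ENNReal.mul_lt_top (by simp) ENNReal.ofReal_lt_top)).ne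
  rw [hratio]
  have hsqrt : √(2 * Real.pi * Real.exp 1) = √(2 * Real.pi) * √(Real.exp 1) :=
    Real.sqrt_mul (by positivity) _
  have hDs : √(D : ℝ) * √D = D := Real.mul_self_sqrt hD'.le
  constructor
  · rw [one_div, ENNReal.le_rpow_inv_iff hD', ENNReal.rpow_natCast,
      ENNReal.le_div_iff_mul_le (Or.inl hPO0) (Or.inl hPOt)]
    refine (mul_le_mul_right hP₂ _).trans (le_trans ?_ hS₁)
    rw [← ENNReal.ofReal_pow (by positivity), ← mul_assoc,
      show (2 : ENNReal) = ENNReal.ofReal 2 by simp, ← ENNReal.ofReal_pow (by positivity),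
      ← ENNReal.ofReal_mul (by positivity), ← ENNReal.ofReal_mul (by positivity)]
    refine ENNReal.ofReal_le_ofReal (le_trans (le_of_eq ?_) (half_mul_pow_le hD (by positivity)))
    rw [← mul_pow, ← mul_pow, hsqrt]
    congr 1
    field_simp
    rw [sq, hDs]
    ring
  · rw [one_div, ENNReal.rpow_inv_le_iff hD', ENNReal.rpow_natCast]
    refine ENNReal.div_le_of_le_mul (hS₂.trans ?_)
    refine le_trans ?_ (mul_le_mul_right ((ENNReal.ofReal_le_ofReal
      (half_mul_pow_le hD (by positivity))).trans hP₁) _)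
    have hG₁ := Gm_pos hn k₁
    have hG₂ := Gm_pos hm k₂
    rw [← ENNReal.ofReal_pow (by positivity), ← ENNReal.ofReal_mul (by positivity)]
    refine ENNReal.ofReal_le_ofReal (le_of_eq ?_)
    rw [← mul_pow, hsqrt]
    congr 1
    field_simp

end VolumeRatio

section Factorials

/-- The rising factorial `n (n + 1) ⋯ (n + k - 1)` as a real number. -/
def Am (n k : ℕ) : ℝ := ∏ i ∈ Finset.range k, ((n : ℝ) + i)

lemma Am_zero (n : ℕ) : Am n 0 = 1 := Finset.prod_range_zero _

lemma Am_succ (n k : ℕ) : Am n (k + 1) = Am n k * (n + k) := Finset.prod_range_succ _ _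

lemma Am_pos {n : ℕ} (hn : 0 < n) (k : ℕ) : 0 < Am n k :=
  Finset.prod_pos fun i _ => by positivity

lemma choose_mul_factorial (n k : ℕ) :
    ((n + k - 1).choose k : ℝ) * k.factorial = Am n k := by
  rw [Am, mul_comm]
  have := Nat.ascFactorial_eq_factorial_mul_choose' n k
  rw [Nat.ascFactorial_eq_prod_range] at this
  exact_mod_cast this.symm

lemma mul_factorial_le_Am {n k₀ k : ℕ} (hn : 0 < n) {c : ℝ}
    (h₀ : c * k₀.factorial ≤ Am n k₀) (hk : k₀ ≤ k) : c * k.factorial ≤ Am n k := by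
  induction k, hk using Nat.le_induction with
  | base => exact h₀
  | succ k _ ih =>
    have hn' : (1 : ℝ) ≤ n := by exact_mod_cast hn
    rw [Am_succ, Nat.factorial_succ]
    push_cast
    calc c * ((k + 1) * k.factorial) = c * k.factorial * (1 + k) := by ring
      _ ≤ Am n k * (n + k) := mul_le_mul ih (by linarith) (by positivity) (Am_pos hn k).le

lemma le_choose_of_mul_factorial_le {n k : ℕ} {c : ℝ} (h : c * k.factorial ≤ Am n k) :
    c ≤ ((n + k - 1).choose k : ℝ) := by
  rw [← choose_mul_factorial] at h
  exact le_of_mul_le_mul_right h (by positivity)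

lemma three_le_choose {n k : ℕ} (hn : 3 ≤ n) (hk : 0 < k) :
    (3 : ℝ) ≤ ((n + k - 1).choose k : ℝ) := by
  have hn' : (3 : ℝ) ≤ n := by exact_mod_cast hn
  refine le_choose_of_mul_factorial_le (mul_factorial_le_Am (k₀ := 1) (by omega) ?_ hk)
  simp [Am_succ, Am_zero]
  exact_mod_cast hn

lemma six_le_choose {n k : ℕ} (hn : 3 ≤ n) (hk : 0 < k) :
    (6 : ℝ) ≤ ((n + 2 * k - 1).choose (2 * k) : ℝ) := by
  have hn' : (3 : ℝ) ≤ n := by exact_mod_cast hn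
  refine le_choose_of_mul_factorial_le
    (mul_factorial_le_Am (k₀ := 2) (by omega) ?_ (by omega))
  simp only [Am_succ, Am_zero, Nat.factorial]
  push_cast
  nlinarith

lemma pow_le_Am (n k : ℕ) : (n : ℝ) ^ k ≤ Am n k := by
  have : (n : ℝ) ^ k = ∏ _i ∈ Finset.range k, (n : ℝ) := by simp
  rw [this]
  exact Finset.prod_le_prod (fun i _ => by positivity) fun i _ => by
    have : (0 : ℝ) ≤ i := by positivity
    linarith

lemma Gm_le_two_pow_mul_Am (n k : ℕ) : Gm n k ≤ 2 ^ k * Am n k := by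
  have : (2 : ℝ) ^ k = ∏ _i ∈ Finset.range k, (2 : ℝ) := by simp
  rw [this, Am, ← Finset.prod_mul_distrib]
  exact Finset.prod_le_prod (fun i _ => by positivity) fun i _ => by
    have : (0 : ℝ) ≤ n := by positivity
    linarith

lemma Gm_mul_Am_le (n k : ℕ) : Gm n k * Am n k ≤ Am n (2 * k) := by
  have hA : 0 ≤ Am n k := Finset.prod_nonneg fun i _ => by positivity
  have e : Am n (k + k) = Am n k * ∏ i ∈ Finset.range k, ((n : ℝ) + ((k + i : ℕ) : ℝ)) :=
    Finset.prod_range_add _ _ _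
  rw [two_mul, e, mul_comm]
  refine mul_le_mul_of_nonneg_left ?_ hA
  refine Finset.prod_le_prod (fun i _ => by positivity) fun i hi => ?_
  have : (i : ℝ) ≤ k := by exact_mod_cast (Finset.mem_range.mp hi).le
  push_cast
  linarith

lemma pow_mul_Am_le (n k : ℕ) :
    (n : ℝ) ^ k * Am n k ≤ 4 ^ k * ((n : ℝ) / 2 + 2 * k) ^ (2 * k) := by
  have e₁ : (n : ℝ) ^ k = ∏ _i ∈ Finset.range k, (n : ℝ) := by simp
  have e₂ : 4 ^ k * ((n : ℝ) / 2 + 2 * k) ^ (2 * k) =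
      ∏ _i ∈ Finset.range k, (4 * ((n : ℝ) / 2 + 2 * k) ^ 2) := by
    simp [mul_pow, pow_mul]
  rw [e₁, e₂, Am, ← Finset.prod_mul_distrib]
  refine Finset.prod_le_prod (fun i _ => by positivity) fun i hi => ?_
  have h1 : (i : ℝ) ≤ k := by exact_mod_cast (Finset.mem_range.mp hi).le
  have h2 : (0 : ℝ) ≤ i := by positivity
  have h3 : (0 : ℝ) ≤ n := by positivity
  nlinarith [mul_nonneg h3 (h2.trans h1), mul_le_mul_of_nonneg_left h1 h3,
    sq_nonneg (k : ℝ)]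

lemma Gm_mono_left {n n' : ℕ} (h : n ≤ n') (k : ℕ) : Gm n k ≤ Gm n' k := by
  have : (n : ℝ) ≤ n' := by exact_mod_cast h
  exact Finset.prod_le_prod (fun i _ => by positivity) fun i _ => by linarith

lemma Gm_two_mul (q k : ℕ) : Gm (2 * q) k = 2 ^ k * Am q k := by
  have : (2 : ℝ) ^ k = ∏ _i ∈ Finset.range k, (2 : ℝ) := by simp
  rw [this, Am, ← Finset.prod_mul_distrib]
  exact Finset.prod_congr rfl fun i _ => by push_cast; ring

lemma Gm_le_of_le_two_mul {n q : ℕ} (hq : 0 < q) (h : n ≤ 2 * q) (K : ℕ) :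
    Gm n K ≤ 4 ^ K * 2 ^ (q - 1) * K.factorial := by
  refine (Gm_mono_left h K).trans ?_
  rw [Gm_two_mul, ← choose_mul_factorial]
  have h1 : ((q + K - 1).choose K : ℝ) ≤ 2 ^ (q + K - 1) := by
    exact_mod_cast Nat.choose_le_two_pow (q + K - 1) K
  have h2 : q + K - 1 = K + (q - 1) := by omega
  rw [h2, pow_add] at h1
  calc 2 ^ K * (((q + K - 1).choose K : ℝ) * K.factorial)
      ≤ 2 ^ K * (2 ^ K * 2 ^ (q - 1) * K.factorial) := by rw [h2]; gcongr
    _ = 4 ^ K * 2 ^ (q - 1) * K.factorial := by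
        rw [show (4 : ℝ) = 2 * 2 by norm_num, mul_pow]; ring

lemma dfac_le (q : ℕ) : dfac q ≤ (2 * q) ^ q := by
  have : ((2 : ℝ) * q) ^ q = ∏ _i ∈ Finset.range q, (2 * q : ℝ) := by simp
  rw [this]
  refine Finset.prod_le_prod (fun i _ => by positivity) fun i hi => ?_
  have : (i : ℝ) + 1 ≤ q := by exact_mod_cast Finset.mem_range.mp hi
  linarith

lemma factorial_two_mul_eq (p : ℕ) : ((2 * p).factorial : ℝ) = dfac p * (2 ^ p * p.factorial) := by
  induction p with
  | zero => simp [dfac]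
  | succ p ih =>
    rw [show 2 * (p + 1) = 2 * p + 1 + 1 by ring, Nat.factorial_succ, Nat.factorial_succ,
      Nat.factorial_succ p, dfac, Finset.prod_range_succ, ← dfac]
    push_cast
    rw [ih]
    ring

lemma pow_self_le (p : ℕ) : (p : ℝ) ^ p ≤ 3 ^ p * p.factorial := by
  have h := Real.pow_div_factorial_le_exp (x := (p : ℝ)) (by positivity) p
  rw [div_le_iff₀ (by positivity), ← Real.exp_one_pow] at h
  refine h.trans (mul_le_mul_of_nonneg_right ?_ (by positivity))
  exact pow_le_pow_left₀ (by positivity) (Real.exp_one_lt_d9.le.trans (by norm_num)) _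

lemma gram_moment_le {d : ℕ} (hd : 9 ≤ d) :
    dfac ((d + 1) / 2) * Gm d (2 * ((d + 1) / 2)) ≤
      (2 * ((d + 1) / 2)).factorial * √(30 * d) ^ (2 * ((d + 1) / 2)) := by
  set p := (d + 1) / 2 with hp
  have h1 : (d : ℝ) ≤ 2 * p := by exact_mod_cast (show d ≤ 2 * p by omega)
  have h2 : (2 : ℝ) * p ≤ d + 1 := by exact_mod_cast (show 2 * p ≤ d + 1 by omega)
  have h9 : (9 : ℝ) ≤ d := by exact_mod_cast hd
  rw [factorial_two_mul_eq, mul_assoc]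
  refine mul_le_mul_of_nonneg_left ?_ (dfac_nonneg _)
  have hG : Gm d (2 * p) ≤ (6 * p) ^ (2 * p) := by
    have : ((6 : ℝ) * p) ^ (2 * p) = ∏ _i ∈ Finset.range (2 * p), (6 * p : ℝ) := by simp
    rw [this]
    refine Finset.prod_le_prod (fun i _ => by positivity) fun i hi => ?_
    have : (i : ℝ) ≤ 2 * p := by exact_mod_cast (Finset.mem_range.mp hi).le
    linarith
  refine hG.trans ?_
  rw [pow_mul, pow_mul, Real.sq_sqrt (by positivity)]
  calc ((6 * p : ℝ) ^ 2) ^ p = (36 * p) ^ p * p ^ p := by rw [← mul_pow]; ring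
    _ ≤ (36 * p) ^ p * (3 ^ p * p.factorial) := by gcongr; exact pow_self_le p
    _ = (108 * p : ℝ) ^ p * p.factorial := by
        rw [show (108 * p : ℝ) = 36 * p * 3 by ring, mul_pow (36 * p : ℝ) 3]; ring
    _ ≤ (60 * d : ℝ) ^ p * p.factorial := by gcongr ?_ ^ p * _; linarith
    _ = 2 ^ p * p.factorial * (30 * d) ^ p := by
        rw [show (60 * d : ℝ) = 2 * (30 * d) by ring, mul_pow 2 (30 * d : ℝ)]; ring

lemma sphere_moment_le {n m : ℕ} (hn : 3 ≤ n) (k₁ k₂ : ℕ) :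
    2 * (dfac ((max n m + 1) / 2) * (Gm n ((max n m + 1) / 2 * (2 * k₁)) *
        Gm m ((max n m + 1) / 2 * (2 * k₂)))) ≤
      (((max n m + 1) / 2 * (2 * k₁)).factorial * ((max n m + 1) / 2 * (2 * k₂)).factorial) *
        (4 ^ (k₁ + k₂) * √(6 * (max n m : ℕ))) ^ (2 * ((max n m + 1) / 2)) := by
  set M := max n m with hM
  have hM3 : 3 ≤ M := hn.trans (le_max_left _ _)
  set q := (M + 1) / 2 with hq
  have hq0 : 0 < q := by omega
  have h1 : n ≤ 2 * q := (le_max_left n m).trans (by omega)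
  have h2 : m ≤ 2 * q := (le_max_right n m).trans (by omega)
  have h3 : (2 : ℝ) * q ≤ M + 1 := by exact_mod_cast (show 2 * q ≤ M + 1 by omega)
  have hM3' : (3 : ℝ) ≤ M := by exact_mod_cast hM3
  have g1 := Gm_le_of_le_two_mul hq0 h1 (q * (2 * k₁))
  have g2 := Gm_le_of_le_two_mul hq0 h2 (q * (2 * k₂))
  have h22 : (2 : ℝ) * 2 ^ (q - 1) = 2 ^ q := by
    rw [← pow_succ']; congr 1; omega
  have h8 : 2 ^ q * 2 ^ (q - 1) * (2 * q : ℝ) ^ q ≤ (6 * M) ^ q := by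
    calc 2 ^ q * 2 ^ (q - 1) * (2 * q : ℝ) ^ q ≤ 2 ^ q * 2 ^ q * (2 * q : ℝ) ^ q := by
          gcongr
          · norm_num
          · omega
      _ = (8 * q : ℝ) ^ q := by rw [← mul_pow, ← mul_pow]; ring
      _ ≤ _ := by gcongr ?_ ^ q; linarith
  calc 2 * (dfac q * (Gm n (q * (2 * k₁)) * Gm m (q * (2 * k₂))))
      ≤ 2 * ((2 * q) ^ q * ((4 ^ (q * (2 * k₁)) * 2 ^ (q - 1) * (q * (2 * k₁)).factorial) *
          (4 ^ (q * (2 * k₂)) * 2 ^ (q - 1) * (q * (2 * k₂)).factorial))) := by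
        have := Gm_nonneg n (q * (2 * k₁))
        have := Gm_nonneg m (q * (2 * k₂))
        gcongr
        exact dfac_le q
    _ = ((q * (2 * k₁)).factorial * (q * (2 * k₂)).factorial) *
          ((4 ^ (q * (2 * k₁)) * 4 ^ (q * (2 * k₂))) *
            (2 * 2 ^ (q - 1) * 2 ^ (q - 1) * (2 * q) ^ q)) := by ring
    _ ≤ ((q * (2 * k₁)).factorial * (q * (2 * k₂)).factorial) *
          ((4 ^ (q * (2 * k₁)) * 4 ^ (q * (2 * k₂))) * (6 * M) ^ q) := by
        rw [h22]
        gcongr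
    _ = _ := by
        rw [mul_pow (4 ^ (k₁ + k₂) : ℝ) (√(6 * (M : ℝ))), pow_mul (√(6 * (M : ℝ))),
          Real.sq_sqrt (by positivity), ← pow_mul, ← pow_add]
        congr 3
        ring

end Factorials

section UpperBound

lemma factorial_two_mul_le (k : ℕ) :
    ((2 * k).factorial : ℝ) ≤ 4 ^ k * (k.factorial : ℝ) ^ 2 := by
  have h1 : (2 * k).choose k ≤ 4 ^ k := by
    have := Nat.choose_le_two_pow (2 * k) k
    rwa [pow_mul] at this
  have h2 := Nat.choose_mul_factorial_mul_factorial (show k ≤ 2 * k by omega)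
  rw [show 2 * k - k = k by omega] at h2
  have : (2 * k).factorial ≤ 4 ^ k * k.factorial ^ 2 := by
    rw [← h2, mul_assoc, sq]
    exact Nat.mul_le_mul_right _ h1
  exact_mod_cast this

lemma two_mul_factorial_sq_le {k : ℕ} (hk : 0 < k) :
    2 * (k.factorial : ℝ) ^ 2 ≤ ((2 * k).factorial : ℝ) := by
  have h1 : 2 ≤ (2 * k).choose k :=
    Nat.le_of_dvd (Nat.choose_pos (by omega)) (Nat.two_dvd_centralBinom_of_one_le hk)
  have h2 := Nat.choose_mul_factorial_mul_factorial (show k ≤ 2 * k by omega)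
  rw [show 2 * k - k = k by omega] at h2
  have : 2 * k.factorial ^ 2 ≤ (2 * k).factorial := by
    rw [← h2, mul_assoc, sq]
    exact Nat.mul_le_mul_right _ h1
  exact_mod_cast this

lemma Gm_sq_mul_choose_le {n : ℕ} (hn : 0 < n) (k : ℕ) :
    (Gm n k / k.factorial) ^ 2 * ((n + k - 1).choose k : ℝ) * (n : ℝ) ^ k ≤
      4 ^ k * ((2 * k).factorial / k.factorial) *
        ((n + 2 * k - 1).choose (2 * k) : ℝ) ^ 2 := by
  have e1 := choose_mul_factorial n k
  have e2 := choose_mul_factorial n (2 * k)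
  rw [← eq_div_iff (by positivity)] at e1 e2
  rw [e1, e2]
  have hA := Am_pos hn k
  have hG := Gm_nonneg n k
  have h1 := Gm_mul_Am_le n k
  have h2 := pow_le_Am n k
  have h3 := factorial_two_mul_le k
  have h4 : Gm n k ^ 2 * Am n k * (n : ℝ) ^ k ≤ Am n (2 * k) ^ 2 := by
    calc Gm n k ^ 2 * Am n k * (n : ℝ) ^ k ≤ Gm n k ^ 2 * Am n k * Am n k := by gcongr
      _ = (Gm n k * Am n k) ^ 2 := by ring
      _ ≤ _ := by gcongr
  calc (Gm n k / k.factorial) ^ 2 * (Am n k / k.factorial) * (n : ℝ) ^ k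
      = (Gm n k ^ 2 * Am n k * (n : ℝ) ^ k) * 1 / (k.factorial : ℝ) ^ 3 := by
        field_simp
    _ ≤ Am n (2 * k) ^ 2 * (4 ^ k * (k.factorial : ℝ) ^ 2 / (2 * k).factorial) /
          (k.factorial : ℝ) ^ 3 := by
        gcongr
        rw [le_div_iff₀ (by positivity), one_mul]
        exact h3
    _ = _ := by field_simp

/-- The product `C(n + 2 k₁ - 1, 2 k₁) C(m + 2 k₂ - 1, 2 k₂)` exceeds its predecessor by a factor
of at most `36 / 35`. -/
lemma choose_mul_choose_le_of_eq {n m k₁ k₂ D : ℕ} (hn : 3 ≤ n) (hm : 3 ≤ m) (hk₁ : 0 < k₁)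
    (hk₂ : 0 < k₂)
    (hD : D = Nat.choose (n + 2 * k₁ - 1) (2 * k₁) * Nat.choose (m + 2 * k₂ - 1) (2 * k₂) - 1) :
    ((n + 2 * k₁ - 1).choose (2 * k₁) : ℝ) * ((m + 2 * k₂ - 1).choose (2 * k₂) : ℝ) ≤
      36 / 35 * D ∧ 35 ≤ D := by
  have h1 : 6 ≤ (n + 2 * k₁ - 1).choose (2 * k₁) := by exact_mod_cast six_le_choose hn hk₁
  have h2 : 6 ≤ (m + 2 * k₂ - 1).choose (2 * k₂) := by exact_mod_cast six_le_choose hm hk₂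
  have h3 := Nat.mul_le_mul h1 h2
  have h4 : 35 ≤ D := by omega
  refine ⟨?_, h4⟩
  have h5 : Nat.choose (n + 2 * k₁ - 1) (2 * k₁) * Nat.choose (m + 2 * k₂ - 1) (2 * k₂) =
      D + 1 := by
    omega
  rw [← Nat.cast_mul, h5]
  have : (35 : ℝ) ≤ D := by exact_mod_cast h4
  push_cast
  linarith

lemma nine_le_choose_mul_choose {n m k₁ k₂ : ℕ} (hn : 3 ≤ n) (hm : 3 ≤ m) (hk₁ : 0 < k₁)
    (hk₂ : 0 < k₂) : 9 ≤ (n + k₁ - 1).choose k₁ * (m + k₂ - 1).choose k₂ := by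
  have h1 : 3 ≤ (n + k₁ - 1).choose k₁ := by exact_mod_cast three_le_choose hn hk₁
  have h2 : 3 ≤ (m + k₂ - 1).choose k₂ := by exact_mod_cast three_le_choose hm hk₂
  exact Nat.mul_le_mul h1 h2

lemma pow_mul_pow_eq_min_mul_max (n m : ℕ) {k₁ k₂ : ℕ} (hk₁ : 0 < k₁) (hk₂ : 0 < k₂) :
    (n : ℝ) ^ k₁ * (m : ℝ) ^ k₂ =
      ((n : ℝ) ^ (k₁ - 1) * (m : ℝ) ^ (k₂ - 1) * (min n m : ℕ)) * (max n m : ℕ) := by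
  obtain ⟨a, rfl⟩ := Nat.exists_eq_succ_of_ne_zero hk₁.ne'
  obtain ⟨b, rfl⟩ := Nat.exists_eq_succ_of_ne_zero hk₂.ne'
  have : ((min n m : ℕ) : ℝ) * (max n m : ℕ) = n * m := by exact_mod_cast min_mul_max n m
  rw [mul_assoc _ ((min n m : ℕ) : ℝ), this]
  simp only [Nat.succ_eq_add_one, Nat.add_sub_cancel, pow_succ]
  ring

lemma upper_le_sqrt {n m k₁ k₂ D : ℕ} (hn : 3 ≤ n) (hm : 3 ≤ m) (hk₁ : 0 < k₁) (hk₂ : 0 < k₂)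
    (hD : D = Nat.choose (n + 2 * k₁ - 1) (2 * k₁) * Nat.choose (m + 2 * k₂ - 1) (2 * k₂) - 1) :
    2 * √(Real.exp 1) * (Gm n k₁ * Gm m k₂ / (k₁.factorial * k₂.factorial)) *
        √(30 * ((n + k₁ - 1).choose k₁ * (m + k₂ - 1).choose k₂ : ℕ)) *
        (4 ^ (k₁ + k₂) * √(6 * (max n m : ℕ))) / D ≤
      √(2100 * 64 ^ (k₁ + k₂) *
        ((2 * k₁).factorial * (2 * k₂).factorial / (k₁.factorial * k₂.factorial)) /
        ((n : ℝ) ^ (k₁ - 1) * (m : ℝ) ^ (k₂ - 1) * (min n m : ℕ))) := by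
  refine Real.le_sqrt_of_sq_le ?_
  obtain ⟨hN, hD35⟩ := choose_mul_choose_le_of_eq hn hm hk₁ hk₂ hD
  have hD0 : (0 : ℝ) < D := by exact_mod_cast (show 0 < D by omega)
  have hn0 : (0 : ℝ) < n := by exact_mod_cast (show 0 < n by omega)
  have hm0 : (0 : ℝ) < m := by exact_mod_cast (show 0 < m by omega)
  have hmin : (0 : ℝ) < (min n m : ℕ) := by exact_mod_cast (show 0 < min n m by omega)
  have hmax : (0 : ℝ) < (max n m : ℕ) := by exact_mod_cast (show 0 < max n m by omega)
  have hP : 0 < (n : ℝ) ^ (k₁ - 1) * (m : ℝ) ^ (k₂ - 1) * (min n m : ℕ) := by positivity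
  have hPM := pow_mul_pow_eq_min_mul_max n m hk₁ hk₂
  have x1 := Gm_sq_mul_choose_le (show 0 < n by omega) k₁
  have x2 := Gm_sq_mul_choose_le (show 0 < m by omega) k₂
  rw [le_div_iff₀ hP, div_pow, div_mul_eq_mul_div, div_le_iff₀ (by positivity)]
  simp only [mul_pow]
  rw [Real.sq_sqrt (by positivity), Real.sq_sqrt (by positivity), Real.sq_sqrt (by positivity)]
  set P := (n : ℝ) ^ (k₁ - 1) * (m : ℝ) ^ (k₂ - 1) * (min n m : ℕ)
  set M : ℝ := ((max n m : ℕ) : ℝ)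
  push_cast
  set d₁ := ((n + k₁ - 1).choose k₁ : ℝ)
  set d₂ := ((m + k₂ - 1).choose k₂ : ℝ)
  set N₁ := ((n + 2 * k₁ - 1).choose (2 * k₁) : ℝ)
  set N₂ := ((m + 2 * k₂ - 1).choose (2 * k₂) : ℝ)
  have hG1 := Gm_nonneg n k₁
  have hG2 := Gm_nonneg m k₂
  have hexp := Real.exp_one_lt_d9.le
  calc 2 ^ 2 * Real.exp 1 * (Gm n k₁ * Gm m k₂ / (k₁.factorial * k₂.factorial)) ^ 2 *
        (30 * (d₁ * d₂)) * ((4 ^ (k₁ + k₂)) ^ 2 * (6 * M)) * P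
      = 720 * Real.exp 1 * 16 ^ (k₁ + k₂) *
          (((Gm n k₁ / k₁.factorial) ^ 2 * d₁ * (n : ℝ) ^ k₁) *
            ((Gm m k₂ / k₂.factorial) ^ 2 * d₂ * (m : ℝ) ^ k₂)) := by
        rw [show ((Gm n k₁ / k₁.factorial) ^ 2 * d₁ * (n : ℝ) ^ k₁) *
            ((Gm m k₂ / k₂.factorial) ^ 2 * d₂ * (m : ℝ) ^ k₂) =
          (Gm n k₁ / k₁.factorial) ^ 2 * d₁ * ((Gm m k₂ / k₂.factorial) ^ 2 * d₂) *
            ((n : ℝ) ^ k₁ * (m : ℝ) ^ k₂) by ring, hPM, ← pow_mul, mul_comm _ 2, pow_mul,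
          show (4 : ℝ) ^ 2 = 16 by norm_num, mul_div_mul_comm]
        ring
    _ ≤ 720 * Real.exp 1 * 16 ^ (k₁ + k₂) *
          ((4 ^ k₁ * ((2 * k₁).factorial / k₁.factorial) * N₁ ^ 2) *
            (4 ^ k₂ * ((2 * k₂).factorial / k₂.factorial) * N₂ ^ 2)) := by gcongr
    _ = 720 * Real.exp 1 * 64 ^ (k₁ + k₂) *
          ((2 * k₁).factorial * (2 * k₂).factorial / (k₁.factorial * k₂.factorial)) *
          (N₁ * N₂) ^ 2 := by
        rw [show (64 : ℝ) = 16 * 4 by norm_num, mul_pow (16 : ℝ), pow_add (4 : ℝ),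
          mul_div_mul_comm]
        ring
    _ ≤ 720 * 2.7182818286 * 64 ^ (k₁ + k₂) *
          ((2 * k₁).factorial * (2 * k₂).factorial / (k₁.factorial * k₂.factorial)) *
          (36 / 35 * D) ^ 2 := by gcongr
    _ = 720 * 2.7182818286 * (36 / 35) ^ 2 * (64 ^ (k₁ + k₂) *
          ((2 * k₁).factorial * (2 * k₂).factorial / (k₁.factorial * k₂.factorial)) *
          (D : ℝ) ^ 2) := by ring
    _ ≤ 2100 * (64 ^ (k₁ + k₂) *
          ((2 * k₁).factorial * (2 * k₂).factorial / (k₁.factorial * k₂.factorial)) *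
          (D : ℝ) ^ 2) := mul_le_mul_of_nonneg_right (by norm_num) (by positivity)
    _ = _ := by ring

lemma sqrt_le_upper_one {n m : ℕ} (hn : 3 ≤ n) (hm : 3 ≤ m) :
    √(2100 * 64 ^ (1 + 1) *
        ((2 * 1).factorial * (2 * 1).factorial / (Nat.factorial 1 * Nat.factorial 1)) /
        ((n : ℝ) ^ (1 - 1) * (m : ℝ) ^ (1 - 1) * (min n m : ℕ))) ≤
      (2 : ℝ) ^ (12 : ℕ) * (5 : ℝ) ^ 2 * (6 : ℝ) ^ ((1 : ℝ) / 2) * (10 : ℝ) ^ ((2 : ℝ) / 9) /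
        ((3 : ℝ) ^ 3 * Real.sqrt (((min n m : ℕ) : ℝ) + 1)) := by
  have hmin : (3 : ℝ) ≤ (min n m : ℕ) := by exact_mod_cast le_min hn hm
  have h10 : (1 : ℝ) ≤ (10 : ℝ) ^ ((2 : ℝ) / 9) := Real.one_le_rpow (by norm_num) (by norm_num)
  set x : ℝ := ((min n m : ℕ) : ℝ)
  rw [← Real.sqrt_eq_rpow]
  calc _ ≤ √((4096 * 25 / 27) ^ 2 * 6 / (x + 1)) := by
        refine Real.sqrt_le_sqrt ?_
        simp [Nat.factorial]
        rw [div_le_div_iff₀ (by linarith) (by linarith)]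
        nlinarith
    _ = 4096 * 25 / 27 * √6 / √(x + 1) := by
        rw [Real.sqrt_div (by positivity), Real.sqrt_mul (by positivity),
          Real.sqrt_sq (by positivity)]
    _ = 4096 * 25 * √6 * 1 / (27 * √(x + 1)) := by ring
    _ ≤ _ := by
        norm_num only
        gcongr

lemma sqrt_le_upper {n m k₁ k₂ : ℕ} (hn : 3 ≤ n) (hm : 3 ≤ m) (hk₁ : 0 < k₁) (hk₂ : 0 < k₂) :
    √(2100 * 64 ^ (k₁ + k₂) *
        ((2 * k₁).factorial * (2 * k₂).factorial / (k₁.factorial * k₂.factorial)) /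
        ((n : ℝ) ^ (k₁ - 1) * (m : ℝ) ^ (k₂ - 1) * (min n m : ℕ))) ≤
      (Real.sqrt 3 * Real.exp 3 * (4 : ℝ) ^ (2 * k₁ + 2 * k₂ + 1) *
          Real.sqrt ((((2 * k₁).factorial : ℝ) * ((2 * k₂).factorial : ℝ) /
              ((k₁.factorial : ℝ) * (k₂.factorial : ℝ))) *
            (⌈Real.log (2 * ((max k₁ k₂ : ℕ) : ℝ) + 1)⌉ : ℝ))) *
        ((n : ℝ) ^ (k₁ - 1) * (m : ℝ) ^ (k₂ - 1) * ((min n m : ℕ) : ℝ)) ^ (-(1 : ℝ) / 2) := by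
  have hn0 : (0 : ℝ) < n := by exact_mod_cast (show 0 < n by omega)
  have hm0 : (0 : ℝ) < m := by exact_mod_cast (show 0 < m by omega)
  have hmin : (0 : ℝ) < (min n m : ℕ) := by exact_mod_cast (show 0 < min n m by omega)
  have hP : 0 < (n : ℝ) ^ (k₁ - 1) * (m : ℝ) ^ (k₂ - 1) * (min n m : ℕ) := by positivity
  set P := (n : ℝ) ^ (k₁ - 1) * (m : ℝ) ^ (k₂ - 1) * (min n m : ℕ)
  have hceil : (1 : ℝ) ≤ (⌈Real.log (2 * ((max k₁ k₂ : ℕ) : ℝ) + 1)⌉ : ℝ) := by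
    have : (1 : ℝ) ≤ (max k₁ k₂ : ℕ) := by exact_mod_cast (show 1 ≤ max k₁ k₂ by omega)
    have h : 0 < ⌈Real.log (2 * ((max k₁ k₂ : ℕ) : ℝ) + 1)⌉ :=
      Int.ceil_pos.mpr (Real.log_pos (by linarith))
    exact_mod_cast h
  set c : ℝ := (⌈Real.log (2 * ((max k₁ k₂ : ℕ) : ℝ) + 1)⌉ : ℝ)
  set F : ℝ := ((2 * k₁).factorial : ℝ) * ((2 * k₂).factorial : ℝ) /
    ((k₁.factorial : ℝ) * (k₂.factorial : ℝ))
  have hF : 0 ≤ F := by positivity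
  have hPr : P ^ (-(1 : ℝ) / 2) = (√P)⁻¹ := by
    rw [neg_div, Real.rpow_neg hP.le, Real.sqrt_eq_rpow]
  have hexp : (20 : ℝ) ≤ Real.exp 3 := by
    have h1 : Real.exp 3 = Real.exp 1 ^ 3 := by rw [← Real.exp_nat_mul]; norm_num
    have h2 := Real.exp_one_gt_d9.le
    rw [h1]
    calc (20 : ℝ) ≤ 2.7182818283 ^ 3 := by norm_num
      _ ≤ _ := by gcongr
  have h16 : (16 : ℝ) ≤ 4 ^ (k₁ + k₂) := by
    calc (16 : ℝ) = 4 ^ 2 := by norm_num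
      _ ≤ _ := pow_le_pow_right₀ (by norm_num) (by omega)
  rw [hPr, Real.sqrt_div (by positivity), div_eq_mul_inv]
  refine mul_le_mul_of_nonneg_right ?_ (by positivity)
  rw [Real.sqrt_le_left (by positivity)]
  simp only [mul_pow]
  rw [Real.sq_sqrt (by norm_num), Real.sq_sqrt (by positivity)]
  calc 2100 * 64 ^ (k₁ + k₂) * F ≤ 3 * 20 ^ 2 * (4 ^ (k₁ + k₂) * 64 ^ (k₁ + k₂) * 16) * F * 1 := by
        rw [mul_one]
        gcongr ?_ * _
        nlinarith [show (0 : ℝ) < 64 ^ (k₁ + k₂) by positivity]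
    _ = 3 * 20 ^ 2 * ((4 ^ (2 * k₁ + 2 * k₂ + 1)) ^ 2) * F * 1 := by
        rw [← mul_pow, ← pow_mul, show (2 * k₁ + 2 * k₂ + 1) * 2 = 4 * (k₁ + k₂) + 2 by ring,
          pow_add (4 : ℝ) (4 * (k₁ + k₂)) 2, pow_mul (4 : ℝ) 4]
        norm_num
    _ ≤ 3 * Real.exp 3 ^ 2 * ((4 ^ (2 * k₁ + 2 * k₂ + 1)) ^ 2) * F * c := by gcongr
    _ = _ := by ring

end UpperBound

section LowerBound

/-- The lower bound for the volume ratio in the general case. -/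
def lowerConst (n m k₁ k₂ : ℕ) : ℝ :=
  (2 * ((k₁.factorial : ℝ) * (k₂.factorial : ℝ)) ^ ((3 : ℝ) / 2) /
      (Real.sqrt 3 * (4 : ℝ) ^ (2 * (k₁ + k₂ + 1)) *
        Real.sqrt (((2 * k₁).factorial : ℝ) * ((2 * k₂).factorial : ℝ)) *
        ((min k₁ k₂ : ℕ) : ℝ))) *
    (Real.sqrt ((n : ℝ) ^ k₁ * (m : ℝ) ^ k₂ *
        (2 + max ((n : ℝ) / (k₁ : ℝ) ^ 2) ((m : ℝ) / (k₂ : ℝ) ^ 2))) /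
      (((n : ℝ) / 2 + 2 * (k₁ : ℝ)) ^ k₁ * ((m : ℝ) / 2 + 2 * (k₂ : ℝ)) ^ k₂))

lemma lowerConst_swap (n m k₁ k₂ : ℕ) : lowerConst n m k₁ k₂ = lowerConst m n k₂ k₁ := by
  unfold lowerConst
  rw [mul_comm (k₁.factorial : ℝ), mul_comm ((2 * k₁).factorial : ℝ), add_comm k₁ k₂,
    min_comm k₁ k₂, mul_comm ((n : ℝ) ^ k₁), max_comm ((n : ℝ) / _),
    mul_comm (((n : ℝ) / 2 + 2 * (k₁ : ℝ)) ^ k₁)]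

lemma sqrt_le_lower {n m k₁ k₂ D : ℕ} (hn : 3 ≤ n) (hm : 3 ≤ m) (hk₁ : 0 < k₁) (hk₂ : 0 < k₂)
    (hD : D = Nat.choose (n + 2 * k₁ - 1) (2 * k₁) * Nat.choose (m + 2 * k₂ - 1) (2 * k₂) - 1)
    {d : ℝ} (hd : 0 < d) :
    √((n + (2 * k₁ - 1 : ℕ)) / (2700 * 64 ^ k₁ * 4 ^ k₂ * d)) ≤
      √D / (8 * √(Real.exp 1) * √(30 * d) *
        √(4 ^ (2 * k₁) * (Gm n (2 * k₁ - 1) * Gm m (2 * k₂)) /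
          ((2 * k₁).factorial * (2 * k₂).factorial))) := by
  obtain ⟨hN, hD35⟩ := choose_mul_choose_le_of_eq hn hm hk₁ hk₂ hD
  have hn0 : 0 < n := by omega
  have hm0 : 0 < m := by omega
  have hG1 := Gm_pos hn0 (2 * k₁ - 1)
  have hG2 := Gm_pos hm0 (2 * k₂)
  have hA1 := Am_pos hn0 (2 * k₁ - 1)
  have hA2 := Am_pos hm0 (2 * k₂)
  have g1 := Gm_le_two_pow_mul_Am n (2 * k₁ - 1)
  have g2 := Gm_le_two_pow_mul_Am m (2 * k₂)
  have e1 := choose_mul_factorial n (2 * k₁)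
  have e2 := choose_mul_factorial m (2 * k₂)
  have hs : Am n (2 * k₁) = Am n (2 * k₁ - 1) * (n + (2 * k₁ - 1 : ℕ)) := by
    rw [← Am_succ]; congr 1; omega
  rw [← eq_div_iff (by positivity)] at e1 e2
  rw [e1, e2, hs] at hN
  have hpow : (4 : ℝ) ^ (2 * k₁) * (2 ^ (2 * k₁ - 1) * 2 ^ (2 * k₂)) * 2 = 64 ^ k₁ * 4 ^ k₂ := by
    have h : (2 : ℝ) ^ (2 * k₁ - 1) * 2 = 4 ^ k₁ := by
      rw [← pow_succ, show 2 * k₁ - 1 + 1 = 2 * k₁ by omega, pow_mul]; norm_num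
    rw [show (64 : ℝ) ^ k₁ = 4 ^ (2 * k₁) * 4 ^ k₁ by rw [pow_mul, ← mul_pow]; norm_num, ← h,
      show (4 : ℝ) ^ k₂ = 2 ^ (2 * k₂) by rw [pow_mul]; norm_num]
    ring
  rw [← Real.sqrt_mul_self (show (0 : ℝ) ≤ 8 by norm_num), ← Real.sqrt_mul (by norm_num),
    ← Real.sqrt_mul (by positivity), ← Real.sqrt_mul (by positivity),
    ← Real.sqrt_div (by positivity)]
  refine Real.sqrt_le_sqrt ?_
  set x : ℝ := (n : ℝ) + (2 * k₁ - 1 : ℕ)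
  have hx : 0 ≤ x := by positivity
  set f : ℝ := (2 * k₁).factorial * (2 * k₂).factorial with hf
  have hf0 : 0 < f := by positivity
  rw [div_le_div_iff₀ (by positivity) (by positivity)]
  calc x * (8 * 8 * Real.exp 1 * (30 * d) *
          (4 ^ (2 * k₁) * (Gm n (2 * k₁ - 1) * Gm m (2 * k₂)) / f))
      ≤ x * (8 * 8 * 2.7182818286 * (30 * d) *
          (4 ^ (2 * k₁) * ((2 ^ (2 * k₁ - 1) * Am n (2 * k₁ - 1)) *
            (2 ^ (2 * k₂) * Am m (2 * k₂))) / f)) := by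
        have := Real.exp_one_lt_d9.le
        gcongr
    _ = 960 * 2.7182818286 * d * (4 ^ (2 * k₁) * (2 ^ (2 * k₁ - 1) * 2 ^ (2 * k₂)) * 2) *
          (Am n (2 * k₁ - 1) * x / (2 * k₁).factorial * (Am m (2 * k₂) / (2 * k₂).factorial)) := by
        rw [hf]; field_simp; ring
    _ ≤ 960 * 2.7182818286 * d * (64 ^ k₁ * 4 ^ k₂) * (36 / 35 * D) := by
        rw [hpow]; gcongr
    _ = 960 * 2.7182818286 * (36 / 35) * (D * (64 ^ k₁ * 4 ^ k₂ * d)) := by ring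
    _ ≤ 2700 * (D * (64 ^ k₁ * 4 ^ k₂ * d)) :=
        mul_le_mul_of_nonneg_right (by norm_num) (by positivity)
    _ = _ := by ring

lemma lowerConst_le_sqrt {n m k₁ k₂ : ℕ} (hn : 3 ≤ n) (hm : 3 ≤ m) (hk₁ : 0 < k₁) (hk₂ : 0 < k₂)
    (h : (m : ℝ) / (k₂ : ℝ) ^ 2 ≤ (n : ℝ) / (k₁ : ℝ) ^ 2) :
    lowerConst n m k₁ k₂ ≤
      √((n + (2 * k₁ - 1 : ℕ)) / (2700 * 64 ^ k₁ * 4 ^ k₂ *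
        ((n + k₁ - 1).choose k₁ * (m + k₂ - 1).choose k₂ : ℕ))) := by
  have hn0 : (0 : ℝ) < n := by exact_mod_cast (show 0 < n by omega)
  have hm0 : (0 : ℝ) < m := by exact_mod_cast (show 0 < m by omega)
  have hA1 := Am_pos (show 0 < n by omega) k₁
  have hA2 := Am_pos (show 0 < m by omega) k₂
  have hk₁' : (1 : ℝ) ≤ k₁ := by exact_mod_cast hk₁
  have hk₂' : (1 : ℝ) ≤ k₂ := by exact_mod_cast hk₂
  have hmin : (1 : ℝ) ≤ (min k₁ k₂ : ℕ) := by exact_mod_cast (show 1 ≤ min k₁ k₂ by omega)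
  have e1 := choose_mul_factorial n k₁
  have e2 := choose_mul_factorial m k₂
  rw [← eq_div_iff (by positivity)] at e1 e2
  have p1 := pow_mul_Am_le n k₁
  have p2 := pow_mul_Am_le m k₂
  have q1 := two_mul_factorial_sq_le hk₁
  have q2 := two_mul_factorial_sq_le hk₂
  have hmx : (n : ℝ) / (k₁ : ℝ) ^ 2 ≤ n := div_le_self hn0.le (one_le_pow₀ hk₁')
  have h21 : ((2 * k₁ - 1 : ℕ) : ℝ) = 2 * k₁ - 1 := by
    rw [Nat.cast_sub (by omega)]; push_cast; ring
  rw [lowerConst, max_eq_left h, h21]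
  push_cast
  rw [e1, e2]
  have h32 : (((k₁.factorial : ℝ) * (k₂.factorial : ℝ)) ^ ((3 : ℝ) / 2)) ^ 2 =
      ((k₁.factorial : ℝ) * (k₂.factorial : ℝ)) ^ 3 := by
    rw [← Real.rpow_natCast, ← Real.rpow_mul (by positivity), ← Real.rpow_natCast]
    norm_num
  refine Real.le_sqrt_of_sq_le ?_
  rw [← Nat.cast_min]
  simp only [mul_pow, div_pow, h32]
  rw [Real.sq_sqrt (by positivity), Real.sq_sqrt (by positivity), Real.sq_sqrt (by positivity)]
  have hX : 0 < ((n : ℝ) / 2 + 2 * k₁) ^ k₁ := by positivity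
  have hY : 0 < ((m : ℝ) / 2 + 2 * k₂) ^ k₂ := by positivity
  rw [mul_comm 2 k₁, pow_mul] at p1
  rw [mul_comm 2 k₂, pow_mul] at p2
  rw [show ((4 : ℝ) ^ (2 * (k₁ + k₂ + 1))) ^ 2 = 256 * (4 ^ k₁) ^ 4 * (4 ^ k₂) ^ 4 by ring,
    show (64 : ℝ) ^ k₁ = (4 ^ k₁) ^ 3 by rw [← pow_mul, mul_comm, pow_mul]; norm_num]
  have hc₁ : (0 : ℝ) < 4 ^ k₁ := by positivity
  have hc₂ : (4 : ℝ) ≤ 4 ^ k₂ := le_self_pow₀ (by norm_num) hk₂.ne'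
  set X := ((n : ℝ) / 2 + 2 * k₁) ^ k₁
  set Y := ((m : ℝ) / 2 + 2 * k₂) ^ k₂
  set c₁ := (4 : ℝ) ^ k₁
  set c₂ := (4 : ℝ) ^ k₂
  set mn : ℝ := ((min k₁ k₂ : ℕ) : ℝ)
  set mx := (n : ℝ) / (k₁ : ℝ) ^ 2
  have ha : (0 : ℝ) < k₁.factorial := by positivity
  have hb : (0 : ℝ) < k₂.factorial := by positivity
  have hA : (0 : ℝ) < (2 * k₁).factorial := by positivity
  have hB : (0 : ℝ) < (2 * k₂).factorial := by positivity
  have hmx0 : 0 ≤ mx := by positivity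
  set a : ℝ := (k₁.factorial : ℝ)
  set b : ℝ := (k₂.factorial : ℝ)
  set A : ℝ := ((2 * k₁).factorial : ℝ)
  set B : ℝ := ((2 * k₂).factorial : ℝ)
  have hc₂' : 0 < c₂ := by linarith
  have hmn : 0 < mn := by linarith
  have r1 : a ^ 2 / A ≤ 1 / 2 := by rw [div_le_div_iff₀ hA two_pos]; linarith
  have r2 : b ^ 2 / B ≤ 1 / 2 := by rw [div_le_div_iff₀ hB two_pos]; linarith
  have r3 : (n : ℝ) ^ k₁ * Am n k₁ / X ^ 2 ≤ c₁ := (div_le_iff₀ (by positivity)).mpr p1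
  have r4 : (m : ℝ) ^ k₂ * Am m k₂ / Y ^ 2 ≤ c₂ := (div_le_iff₀ (by positivity)).mpr p2
  have r5 : 1 / mn ^ 2 ≤ 1 := (div_le_one (by positivity)).mpr (one_le_pow₀ hmin)
  have r6 : 1 / c₂ ^ 2 ≤ 1 / 4 ^ 2 := by gcongr
  rw [le_div_iff₀ (by positivity)]
  calc _ = (a ^ 2 / A) * (b ^ 2 / B) * ((n : ℝ) ^ k₁ * Am n k₁ / X ^ 2) *
          ((m : ℝ) ^ k₂ * Am m k₂ / Y ^ 2) * (1 / mn ^ 2) * (2 + mx) *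
          (4 * 2700 / (768 * c₁ * c₂ ^ 3)) := by field_simp; ring
    _ ≤ (1 / 2) * (1 / 2) * c₁ * c₂ * 1 * (2 + n) * (4 * 2700 / (768 * c₁ * c₂ ^ 3)) := by gcongr
    _ = 2700 / 768 * (2 + n) * (1 / c₂ ^ 2) := by field_simp; ring
    _ ≤ 2700 / 768 * (2 + n) * (1 / 4 ^ 2) := by gcongr
    _ ≤ _ := by linarith

lemma lower_one_le_sqrt {n m : ℕ} (hm : 3 ≤ m) (h : m ≤ n) :
    3 * Real.sqrt 3 / ((2 : ℝ) ^ (10 : ℕ) * (7 : ℝ) ^ 2 * Real.sqrt ((min n m : ℕ) : ℝ)) ≤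
      √((n + (2 * 1 - 1 : ℕ)) / (2700 * 64 ^ 1 * 4 ^ 1 *
        ((n + 1 - 1).choose 1 * (m + 1 - 1).choose 1 : ℕ))) := by
  have hm0 : (0 : ℝ) < m := by exact_mod_cast (show 0 < m by omega)
  have hn0 : (0 : ℝ) < n := by exact_mod_cast (show 0 < n by omega)
  rw [min_eq_right h]
  simp only [Nat.add_sub_cancel, Nat.choose_one_right]
  refine Real.le_sqrt_of_sq_le ?_
  simp only [mul_pow, div_pow]
  rw [Real.sq_sqrt (by positivity), Real.sq_sqrt (by positivity)]
  push_cast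
  rw [div_le_div_iff₀ (by positivity) (by positivity)]
  norm_num
  nlinarith [mul_pos hn0 hm0]

lemma lower_le_sqrt {n m k₁ k₂ : ℕ} (hn : 3 ≤ n) (hm : 3 ≤ m) (hk₁ : 0 < k₁) (hk₂ : 0 < k₂)
    (h : (m : ℝ) / (k₂ : ℝ) ^ 2 ≤ (n : ℝ) / (k₁ : ℝ) ^ 2) :
    (if k₁ = 1 ∧ k₂ = 1 then
        3 * Real.sqrt 3 / ((2 : ℝ) ^ (10 : ℕ) * (7 : ℝ) ^ 2 * Real.sqrt ((min n m : ℕ) : ℝ))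
      else lowerConst n m k₁ k₂) ≤
      √((n + (2 * k₁ - 1 : ℕ)) / (2700 * 64 ^ k₁ * 4 ^ k₂ *
        ((n + k₁ - 1).choose k₁ * (m + k₂ - 1).choose k₂ : ℕ))) := by
  split_ifs with h1
  · obtain ⟨rfl, rfl⟩ := h1
    refine lower_one_le_sqrt hm ?_
    simpa using h
  · exact lowerConst_le_sqrt hn hm hk₁ hk₂ h

/-- A Lipschitz constant `R` satisfying one of the two Bernstein-type conditions for which the
lower bound on the volume ratio dominates the claimed constant. -/
lemma exists_lower {n m k₁ k₂ D : ℕ} (hn : 3 ≤ n) (hm : 3 ≤ m) (hk₁ : 0 < k₁) (hk₂ : 0 < k₂)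
    (hD : D = Nat.choose (n + 2 * k₁ - 1) (2 * k₁) * Nat.choose (m + 2 * k₂ - 1) (2 * k₂) - 1) :
    ∃ R : ℝ, 0 < R ∧
      (4 ^ (2 * k₁) * (Gm n (2 * k₁ - 1) * Gm m (2 * k₂)) ≤
          (2 * k₁).factorial * (2 * k₂).factorial * R ^ 2 ∨
        4 ^ (2 * k₂) * (Gm n (2 * k₁) * Gm m (2 * k₂ - 1)) ≤
          (2 * k₁).factorial * (2 * k₂).factorial * R ^ 2) ∧
      (if k₁ = 1 ∧ k₂ = 1 then
          3 * Real.sqrt 3 / ((2 : ℝ) ^ (10 : ℕ) * (7 : ℝ) ^ 2 * Real.sqrt ((min n m : ℕ) : ℝ))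
        else lowerConst n m k₁ k₂) ≤
        √D / (8 * √(Real.exp 1) *
          √(30 * ((n + k₁ - 1).choose k₁ * (m + k₂ - 1).choose k₂ : ℕ)) * R) := by
  have hn0 : 0 < n := by omega
  have hm0 : 0 < m := by omega
  have hd9 := nine_le_choose_mul_choose hn hm hk₁ hk₂
  have hd0 : (0 : ℝ) < ((n + k₁ - 1).choose k₁ * (m + k₂ - 1).choose k₂ : ℕ) := by
    exact_mod_cast (show 0 < _ by linarith)
  have hf : (0 : ℝ) < (2 * k₁).factorial * (2 * k₂).factorial := by positivity
  rcases le_total ((m : ℝ) / (k₂ : ℝ) ^ 2) ((n : ℝ) / (k₁ : ℝ) ^ 2) with h | h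
  · have hG : 0 < Gm n (2 * k₁ - 1) * Gm m (2 * k₂) := mul_pos (Gm_pos hn0 _) (Gm_pos hm0 _)
    refine ⟨√(4 ^ (2 * k₁) * (Gm n (2 * k₁ - 1) * Gm m (2 * k₂)) /
      ((2 * k₁).factorial * (2 * k₂).factorial)), by positivity, Or.inl ?_,
      (lower_le_sqrt hn hm hk₁ hk₂ h).trans (sqrt_le_lower hn hm hk₁ hk₂ hD hd0)⟩
    rw [Real.sq_sqrt (by positivity), mul_div_cancel₀ _ hf.ne']
  · have hG : 0 < Gm n (2 * k₁) * Gm m (2 * k₂ - 1) := mul_pos (Gm_pos hn0 _) (Gm_pos hm0 _)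
    refine ⟨√(4 ^ (2 * k₂) * (Gm n (2 * k₁) * Gm m (2 * k₂ - 1)) /
      ((2 * k₁).factorial * (2 * k₂).factorial)), by positivity, Or.inr ?_, ?_⟩
    · rw [Real.sq_sqrt (by positivity), mul_div_cancel₀ _ hf.ne']
    · have h1 := lower_le_sqrt hm hn hk₂ hk₁ h
      rw [mul_comm ((m + k₂ - 1).choose k₂), lowerConst_swap, min_comm m n] at h1
      simp only [and_comm (a := k₂ = 1)] at h1
      rw [mul_comm (Gm n _), mul_comm ((2 * k₁).factorial : ℝ)]
      exact h1.trans (sqrt_le_lower hm hn hk₂ hk₁ (by rw [mul_comm]; exact hD) hd0)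

end LowerBound

end BiformPaper

open BiformPaper in
/-- **Corollary (ratio of the volumes of the sections of sums of squares and nonnegative
biforms).** For integers `n, m ≥ 3` and positive integers `k₁, k₂`:
`f_{2k₁,2k₂} ≤ (Vol S̃q / Vol P̃os)^{1/D_𝓜} ≤ g_{2k₁,2k₂}`. -/
theorem statement3 (n m k₁ k₂ : ℕ) (hn : 3 ≤ n) (hm : 3 ≤ m) (hk₁ : 0 < k₁) (hk₂ : 0 < k₂)
    (D : ℕ)
    (hD : D = Nat.choose (n + 2 * k₁ - 1) (2 * k₁) * Nat.choose (m + 2 * k₂ - 1) (2 * k₂) - 1)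
    (σ₁ : Measure (Fin n → ℝ)) (σ₂ : Measure (Fin m → ℝ))
    (hσ₁ : IsSphereMeasure n σ₁) (hσ₂ : IsSphereMeasure m σ₂)
    (ψ : (Fin D → ℝ) →ₗ[ℝ] MvPolynomial (Fin n ⊕ Fin m) ℝ)
    (hψ : IsUnitaryParam n m D σ₁ σ₂ (MSet n m k₁ k₂ σ₁ σ₂) ψ) :
    ENNReal.ofReal
        (if k₁ = 1 ∧ k₂ = 1 then
          3 * Real.sqrt 3 /
            ((2 : ℝ) ^ (10 : ℕ) * (7 : ℝ) ^ 2 * Real.sqrt ((min n m : ℕ) : ℝ))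
        else
          (2 * ((k₁.factorial : ℝ) * (k₂.factorial : ℝ)) ^ ((3 : ℝ) / 2) /
              (Real.sqrt 3 * (4 : ℝ) ^ (2 * (k₁ + k₂ + 1)) *
                Real.sqrt (((2 * k₁).factorial : ℝ) * ((2 * k₂).factorial : ℝ)) *
                ((min k₁ k₂ : ℕ) : ℝ))) *
            (Real.sqrt ((n : ℝ) ^ k₁ * (m : ℝ) ^ k₂ *
                (2 + max ((n : ℝ) / (k₁ : ℝ) ^ 2) ((m : ℝ) / (k₂ : ℝ) ^ 2))) /
              (((n : ℝ) / 2 + 2 * (k₁ : ℝ)) ^ k₁ * ((m : ℝ) / 2 + 2 * (k₂ : ℝ)) ^ k₂))) ≤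
      (volume (⇑ψ ⁻¹' tilde n m k₁ k₂ σ₁ σ₂ (SqSet n m k₁ k₂)) /
          volume (⇑ψ ⁻¹' tilde n m k₁ k₂ σ₁ σ₂ (PosSet n m k₁ k₂))) ^ ((1 : ℝ) / (D : ℝ)) ∧
    (volume (⇑ψ ⁻¹' tilde n m k₁ k₂ σ₁ σ₂ (SqSet n m k₁ k₂)) /
        volume (⇑ψ ⁻¹' tilde n m k₁ k₂ σ₁ σ₂ (PosSet n m k₁ k₂))) ^ ((1 : ℝ) / (D : ℝ)) ≤
      ENNReal.ofReal
        (if k₁ = 1 ∧ k₂ = 1 then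
          (2 : ℝ) ^ (12 : ℕ) * (5 : ℝ) ^ 2 * (6 : ℝ) ^ ((1 : ℝ) / 2) * (10 : ℝ) ^ ((2 : ℝ) / 9) /
            ((3 : ℝ) ^ 3 * Real.sqrt (((min n m : ℕ) : ℝ) + 1))
        else
          (Real.sqrt 3 * Real.exp 3 * (4 : ℝ) ^ (2 * k₁ + 2 * k₂ + 1) *
              Real.sqrt ((((2 * k₁).factorial : ℝ) * ((2 * k₂).factorial : ℝ) /
                  ((k₁.factorial : ℝ) * (k₂.factorial : ℝ))) *
                (⌈Real.log (2 * ((max k₁ k₂ : ℕ) : ℝ) + 1)⌉ : ℝ))) *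
            ((n : ℝ) ^ (k₁ - 1) * (m : ℝ) ^ (k₂ - 1) * ((min n m : ℕ) : ℝ)) ^ (-(1 : ℝ) / 2)) := by
  have hn0 : 0 < n := by omega
  have hm0 : 0 < m := by omega
  have hD0 : 0 < D := by linarith [(choose_mul_choose_le_of_eq hn hm hk₁ hk₂ hD).2]
  have hcard : (bexp (Fin n) (Fin m) k₁ k₂).card =
      (n + k₁ - 1).choose k₁ * (m + k₂ - 1).choose k₂ := by
    simp only [card_bexp, card_sexp, Fintype.card_fin]
  have hd9 := nine_le_choose_mul_choose hn hm hk₁ hk₂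
  have hd0 : (0 : ℝ) < ((n + k₁ - 1).choose k₁ * (m + k₂ - 1).choose k₂ : ℕ) := by
    exact_mod_cast (show 0 < _ by linarith)
  have hmax : (0 : ℝ) < (max n m : ℕ) := by exact_mod_cast (show 0 < max n m by omega)
  have key := fun {R : ℝ} hR hRR => hψ.ratio_bounds hσ₁ hσ₂ hn0 hm0 hk₁ hk₂ hD0
    (p := ((bexp (Fin n) (Fin m) k₁ k₂).card + 1) / 2) (q := (max n m + 1) / 2)
    (L := √(30 * (bexp (Fin n) (Fin m) k₁ k₂).card))
    (t := 4 ^ (k₁ + k₂) * √(6 * (max n m : ℕ))) (R := R) (by omega) (by omega)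
    (by rw [hcard]; positivity) (by positivity) hR (by omega)
    (gram_moment_le (by rw [hcard]; exact hd9)) (sphere_moment_le hn k₁ k₂) hRR
  rw [hcard] at key
  obtain ⟨R, hR, hRR, hlow⟩ := exists_lower hn hm hk₁ hk₂ hD
  refine ⟨(ENNReal.ofReal_le_ofReal hlow).trans (key hR hRR).1,
    (key hR hRR).2.trans (ENNReal.ofReal_le_ofReal ((upper_le_sqrt hn hm hk₁ hk₂ hD).trans ?_))⟩
  split_ifs with h
  · obtain ⟨rfl, rfl⟩ := h
    exact sqrt_le_upper_one hn hm
  · exact sqrt_le_upper hn hm hk₁ hk₂
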